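/- arXiv:1406.6335 — 2 statements merged into one kernel-verified Lean document; each statement's English description precedes it below -/
import Mathlib

section
/- Let E be a Riesz space with point separating order dual. Then the range γ((Orth(E)^~)_n^~) of the Arens homomorphism γ is an order ideal in Orth(E^~) if and only if the Arens homomorphism m : Z(E)'' → Z(E^~) is surjective, i.e. m(Z(E)'') = Z(E^~). -/
noncomputable section

open Set

/-- A map between preordered sets is *order bounded* if it maps order intervals into
order intervals. -/
def IsOrdBdd {E F : Type*} [Preorder E] [Preorder F] (f : E → F) : Prop :=
  ∀ a b : E, ∃ c d : F, ∀ x : E, a ≤ x → x ≤ b → c ≤ f x ∧ f x ≤ d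

/-- A map of a Riesz space is *band preserving* if it preserves disjointness. -/
def IsBandPres {E : Type*} [Lattice E] [AddCommGroup E] (T : E → E) : Prop :=
  ∀ x y : E, |x| ⊓ |y| = 0 → |T x| ⊓ |y| = 0

/-- An *orthomorphism*: an order bounded, band preserving linear map. -/
def IsOrtho {E : Type*} [Lattice E] [AddCommGroup E] [Module ℝ E] (T : E → E) : Prop :=
  IsLinearMap ℝ T ∧ IsOrdBdd T ∧ IsBandPres T

/-- A member of the *ideal center* `Z(E)`: an orthomorphism dominated by a multiple of the
identity. -/
def IsCentral {E : Type*} [Lattice E] [AddCommGroup E] [Module ℝ E] (T : E → E) : Prop :=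
  IsOrtho T ∧ ∃ c : ℝ, ∀ x : E, 0 ≤ x → -(c • x) ≤ T x ∧ T x ≤ c • x

/-- Order continuity of a real functional: it converges to `0` along every downward
directed system with infimum `0`. -/
def IsOrderContinuousFun {X : Type*} [Lattice X] [AddCommGroup X] (φ : X → ℝ) : Prop :=
  ∀ s : Set X, s.Nonempty → DirectedOn (· ≥ ·) s → IsGLB s 0 →
    ∀ ε : ℝ, 0 < ε → ∃ x ∈ s, ∀ y ∈ s, y ≤ x → |φ y| < ε

/-- `p` realizes the Riesz space `D` as the order dual `E^∼` of `E`. -/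
structure IsOrderDual (E D : Type*) [Lattice E] [AddCommGroup E] [Module ℝ E]
    [Lattice D] [AddCommGroup D] [Module ℝ D] (p : D → E → ℝ) : Prop where
  lin_fun : ∀ f : D, IsLinearMap ℝ (p f)
  lin_vec : ∀ x : E, IsLinearMap ℝ fun f => p f x
  bdd : ∀ f : D, IsOrdBdd (p f)
  inj : ∀ f g : D, (∀ x, p f x = p g x) → f = g
  surj : ∀ φ : E → ℝ, IsLinearMap ℝ φ → IsOrdBdd φ → ∃ f : D, ∀ x, p f x = φ x
  le_iff : ∀ f g : D, f ≤ g ↔ ∀ x : E, 0 ≤ x → p f x ≤ p g x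

/-- `p` realizes the Riesz space `B` as the order continuous order dual `(X^∼)ₙ` of `X`
(used for `X = A^∼`, giving `B = (A^∼)ₙ^∼`). -/
structure IsOrderContinuousDual (X B : Type*) [Lattice X] [AddCommGroup X] [Module ℝ X]
    [Lattice B] [AddCommGroup B] [Module ℝ B] (p : B → X → ℝ) : Prop where
  lin_fun : ∀ F : B, IsLinearMap ℝ (p F)
  lin_vec : ∀ f : X, IsLinearMap ℝ fun F => p F f
  bdd : ∀ F : B, IsOrdBdd (p F)
  cont : ∀ F : B, IsOrderContinuousFun (p F)
  inj : ∀ F G : B, (∀ f, p F f = p G f) → F = G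
  surj : ∀ φ : X → ℝ, IsLinearMap ℝ φ → IsOrdBdd φ → IsOrderContinuousFun φ →
    ∃ F : B, ∀ f, p F f = φ f
  le_iff : ∀ F G : B, F ≤ G ↔ ∀ f : X, 0 ≤ f → p F f ≤ p G f

/-- `ρ` realizes the lattice-ordered algebra `O` as the `f`-algebra `Orth(E)` of all
orthomorphisms of `E`. -/
structure IsOrthAlg (E O : Type*) [Lattice E] [AddCommGroup E] [Module ℝ E]
    [Lattice O] [Ring O] [Module ℝ O] (ρ : O → E → E) : Prop where
  ortho : ∀ a : O, IsOrtho (ρ a)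
  lin_vec : ∀ x : E, IsLinearMap ℝ fun a => ρ a x
  map_one : ∀ x : E, ρ 1 x = x
  map_mul : ∀ (a b : O) (x : E), ρ (a * b) x = ρ a (ρ b x)
  inj : ∀ a b : O, (∀ x, ρ a x = ρ b x) → a = b
  surj : ∀ T : E → E, IsOrtho T → ∃ a : O, ∀ x, ρ a x = T x
  le_iff : ∀ a b : O, a ≤ b ↔ ∀ x : E, 0 ≤ x → ρ a x ≤ ρ b x

/-- `ρ` realizes the normed lattice-ordered algebra `Z` as the ideal center `Z(E)` of `E`,
an AM-space whose norm is the order unit norm (the order/algebra unit being `id`). -/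
structure IsCenterOf (E Z : Type*) [Lattice E] [AddCommGroup E] [Module ℝ E]
    [Lattice Z] [NormedRing Z] [NormedAlgebra ℝ Z] (ρ : Z → E → E) : Prop where
  central : ∀ a : Z, IsCentral (ρ a)
  lin_vec : ∀ x : E, IsLinearMap ℝ fun a => ρ a x
  map_one : ∀ x : E, ρ 1 x = x
  map_mul : ∀ (a b : Z) (x : E), ρ (a * b) x = ρ a (ρ b x)
  inj : ∀ a b : Z, (∀ x, ρ a x = ρ b x) → a = b
  surj : ∀ T : E → E, IsCentral T → ∃ a : Z, ∀ x, ρ a x = T x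
  le_iff : ∀ a b : Z, a ≤ b ↔ ∀ x : E, 0 ≤ x → ρ a x ≤ ρ b x
  norm_le_iff : ∀ (a : Z) (c : ℝ), 0 ≤ c →
    (‖a‖ ≤ c ↔ ∀ x : E, 0 ≤ x → -(c • x) ≤ ρ a x ∧ ρ a x ≤ c • x)

/-- The pairing `p : D → E → ℝ` separates the points of `E`. -/
def SepPoints {E D : Type*} [Zero E] (p : D → E → ℝ) : Prop :=
  ∀ x : E, (∀ f : D, p f x = 0) → x = 0

/-- `y` belongs to the `σ(E,D)`-closure of `s ⊆ E`, for the pairing `p : D → E → ℝ`. -/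
def InWeakClosure {E D : Type*} (p : D → E → ℝ) (s : Set E) (y : E) : Prop :=
  ∀ (fs : Finset D) (ε : ℝ), 0 < ε → ∃ z ∈ s, ∀ f ∈ fs, |p f z - p f y| < ε

/-- `E` has a *topologically full center*: for each `x ∈ E₊` the `σ(E,E^∼)`-closure of
`Z(E)x` contains the order ideal generated by `x`.  Here `p : D → E → ℝ` is the duality
with `E^∼` and `ρ : Z → E → E` is the action of the ideal center. -/
def TopFullCenter {E D Z : Type*} [Lattice E] [AddCommGroup E] [Module ℝ E]
    (p : D → E → ℝ) (ρ : Z → E → E) : Prop :=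
  ∀ x : E, 0 ≤ x → ∀ y : E, (∃ c : ℝ, 0 ≤ c ∧ |y| ≤ c • x) →
    InWeakClosure p {z | ∃ T : Z, ρ T x = z} y

/-- `FG` is the Arens product `F ⬝ G` in the order bidual `B` of the algebra `A`:
`(F⬝G)(f) = F(G⬝f)`, `(G⬝f)(a) = G(f⬝a)`, `(f⬝a)(b) = f(ab)`; `pA : DA → A → ℝ` is the
duality of `A` with `A^∼` and `pB : B → DA → ℝ` that of `(A^∼)ₙ^∼` with `A^∼`. -/
def IsArensProduct {A DA B : Type*} [Mul A] (pA : DA → A → ℝ) (pB : B → DA → ℝ)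
    (F G FG : B) : Prop :=
  ∀ f Gf : DA,
    (∀ (a : A) (fa : DA), (∀ b : A, pA fa b = pA f (a * b)) → pA Gf a = pB G fa) →
    pB FG f = pB F Gf

/-- The ring structure of `B` is the Arens multiplication inherited from `A`, with unit the
canonical image of `1 ∈ A`. -/
structure IsArensAlgebra {A DA B : Type*} [Monoid A] [Ring B]
    (pA : DA → A → ℝ) (pB : B → DA → ℝ) : Prop where
  mul_def : ∀ F G : B, IsArensProduct pA pB F G (F * G)
  one_def : ∀ f : DA, pB 1 f = pA f 1

section NormedArens

variable (Z : Type*) [NormedRing Z] [NormedAlgebra ℝ Z]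

/-- First step of the Arens construction: `f ⬝ a` for `f ∈ Z'`, `a ∈ Z`:
`(f⬝a)(b) = f(ab)`. -/
def arensDot (f : Z →L[ℝ] ℝ) (a : Z) : Z →L[ℝ] ℝ :=
  f.comp (ContinuousLinearMap.mul ℝ Z a)

/-- `a ↦ f ⬝ a` as a continuous linear map. -/
def arensDotL (f : Z →L[ℝ] ℝ) : Z →L[ℝ] Z →L[ℝ] ℝ :=
  (ContinuousLinearMap.compL ℝ Z Z ℝ f).comp (ContinuousLinearMap.mul ℝ Z)

/-- Second step of the Arens construction: `F ⬝ f` for `F ∈ Z''`, `f ∈ Z'`: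
`(F⬝f)(a) = F(f⬝a)`. -/
def arensFDot (F : (Z →L[ℝ] ℝ) →L[ℝ] ℝ) (f : Z →L[ℝ] ℝ) : Z →L[ℝ] ℝ :=
  F.comp (arensDotL Z f)

/-- `f ↦ f ⬝ ·` as a continuous linear map. -/
def arensDotLL : (Z →L[ℝ] ℝ) →L[ℝ] Z →L[ℝ] Z →L[ℝ] ℝ :=
  ((ContinuousLinearMap.compL ℝ Z (Z →L[ℝ] Z) (Z →L[ℝ] ℝ)).flip
      (ContinuousLinearMap.mul ℝ Z)).comp (ContinuousLinearMap.compL ℝ Z Z ℝ)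

/-- `f ↦ F ⬝ f` as a continuous linear map. -/
def arensFDotL (F : (Z →L[ℝ] ℝ) →L[ℝ] ℝ) : (Z →L[ℝ] ℝ) →L[ℝ] Z →L[ℝ] ℝ :=
  (ContinuousLinearMap.compL ℝ Z (Z →L[ℝ] ℝ) ℝ F).comp (arensDotLL Z)

/-- The *Arens product* on the norm bidual `Z''`: `(F⬝G)(f) = F(G⬝f)`. -/
def arensMul (F G : (Z →L[ℝ] ℝ) →L[ℝ] ℝ) : (Z →L[ℝ] ℝ) →L[ℝ] ℝ :=
  F.comp (arensFDotL Z G)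

/-- The canonical image of `1 ∈ Z` in the bidual `Z''`; it is the unit for the Arens
product. -/
def arensOne : (Z →L[ℝ] ℝ) →L[ℝ] ℝ := ContinuousLinearMap.apply ℝ ℝ (1 : Z)

end NormedArens

section DualOrder

variable {Z : Type*} [Lattice Z] [NormedRing Z] [NormedAlgebra ℝ Z]

/-- Positivity of a functional in `Z'`. -/
def dualNonneg (μ : Z →L[ℝ] ℝ) : Prop := ∀ a : Z, 0 ≤ a → 0 ≤ μ a

/-- The canonical order of the bidual `Z''`. -/
def bidualLe (F G : (Z →L[ℝ] ℝ) →L[ℝ] ℝ) : Prop :=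
  ∀ μ : Z →L[ℝ] ℝ, dualNonneg μ → F μ ≤ G μ

/-- `H = F ⊔ G` in the bidual `Z''`. -/
def IsBidualSup (F G H : (Z →L[ℝ] ℝ) →L[ℝ] ℝ) : Prop :=
  bidualLe F H ∧ bidualLe G H ∧
    ∀ K : (Z →L[ℝ] ℝ) →L[ℝ] ℝ, bidualLe F K → bidualLe G K → bidualLe H K

/-- `s ⊆ Z''` is downward directed with infimum `0`. -/
def BidualDownTo0 (s : Set ((Z →L[ℝ] ℝ) →L[ℝ] ℝ)) : Prop :=
  s.Nonempty ∧ (∀ F ∈ s, ∀ G ∈ s, ∃ H ∈ s, bidualLe H F ∧ bidualLe H G) ∧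
    (∀ F ∈ s, bidualLe 0 F) ∧ ∀ K, (∀ F ∈ s, bidualLe K F) → bidualLe K 0

/-- The Riesz–Kantorovich formula for `|μ|(a)`, `μ ∈ Z'`, `a ∈ Z₊`. -/
def dualAbs (μ : Z →L[ℝ] ℝ) (a : Z) : ℝ := sSup ((fun b => μ b) '' {b : Z | |b| ≤ a})

/-- Disjointness `|μ| ⊓ |ν| = 0` in `Z'`. -/
def DualDisjoint (μ ν : Z →L[ℝ] ℝ) : Prop :=
  ∀ a : Z, 0 ≤ a → ∀ ε : ℝ, 0 < ε →
    ∃ b c : Z, 0 ≤ b ∧ 0 ≤ c ∧ b + c = a ∧ dualAbs μ b + dualAbs ν c < ε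

/-- The Riesz–Kantorovich formula for `|F|(μ)`, `F ∈ Z''`, `μ ∈ Z'₊`. -/
def bidualAbs (F : (Z →L[ℝ] ℝ) →L[ℝ] ℝ) (μ : Z →L[ℝ] ℝ) : ℝ :=
  sSup ((fun ν => F ν) '' {ν : Z →L[ℝ] ℝ | ∀ a : Z, 0 ≤ a → dualAbs ν a ≤ μ a})

/-- Disjointness `|F| ⊓ |G| = 0` in `Z''`. -/
def BidualDisjoint (F G : (Z →L[ℝ] ℝ) →L[ℝ] ℝ) : Prop :=
  ∀ μ : Z →L[ℝ] ℝ, dualNonneg μ → ∀ ε : ℝ, 0 < ε →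
    ∃ μ₁ μ₂ : Z →L[ℝ] ℝ, dualNonneg μ₁ ∧ dualNonneg μ₂ ∧ μ₁ + μ₂ = μ ∧
      bidualAbs F μ₁ + bidualAbs G μ₂ < ε

end DualOrder

/-- A member of the ideal center `Z(J)` of an order ideal `J` of a Riesz space, encoded as a
map defined on the ambient space whose restriction to `J` is the actual operator. -/
def IsCentralOn {D : Type*} [Lattice D] [AddCommGroup D] [Module ℝ D]
    (J : Set D) (S : D → D) : Prop :=
  (∀ f ∈ J, S f ∈ J) ∧ (∀ f ∈ J, ∀ g ∈ J, S (f + g) = S f + S g) ∧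
    (∀ (c : ℝ), ∀ f ∈ J, S (c • f) = c • S f) ∧
    ∃ c : ℝ, ∀ f ∈ J, 0 ≤ f → -(c • f) ≤ S f ∧ S f ≤ c • f

end

section RieszSpace

variable {E : Type*} [Lattice E] [AddCommGroup E] [IsOrderedAddMonoid E]

theorem add_inf_le_inf_add_inf {a b c : E} (ha : 0 ≤ a) (hb : 0 ≤ b) (hc : 0 ≤ c) :
    (a + b) ⊓ c ≤ a ⊓ c + b ⊓ c := by
  have h : (a + b) ⊓ c - b ⊓ c ≤ a ⊓ c := by
    rw [sub_le_iff_le_add, inf_add, add_inf, add_inf]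
    refine le_inf (le_inf inf_le_left ?_) (le_inf ?_ ?_)
    · exact inf_le_right.trans (le_add_of_nonneg_left ha)
    · exact inf_le_right.trans (le_add_of_nonneg_right hb)
    · exact inf_le_right.trans (le_add_of_nonneg_right hc)
  exact sub_le_iff_le_add.1 h

theorem disjoint_abs_of_abs_le {u v w : E} (h : |v| ⊓ |w| = 0) (huv : |u| ≤ |v|) :
    |u| ⊓ |w| = 0 :=
  le_antisymm ((inf_le_inf_right _ huv).trans h.le) (le_inf (abs_nonneg _) (abs_nonneg _))

theorem disjoint_abs_add {u v w : E} (hu : |u| ⊓ |w| = 0) (hv : |v| ⊓ |w| = 0) :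
    |u + v| ⊓ |w| = 0 := by
  refine le_antisymm ?_ (le_inf (abs_nonneg _) (abs_nonneg _))
  calc |u + v| ⊓ |w| ≤ (|u| + |v|) ⊓ |w| := inf_le_inf_right _ (abs_add_le _ _)
    _ ≤ |u| ⊓ |w| + |v| ⊓ |w| :=
      add_inf_le_inf_add_inf (abs_nonneg _) (abs_nonneg _) (abs_nonneg _)
    _ = 0 := by rw [hu, hv, add_zero]

theorem eq_zero_of_disjoint_abs_self {u : E} (h : |u| ⊓ |u| = 0) : u = 0 := by
  rw [inf_idem] at h
  exact le_antisymm ((le_abs_self u).trans h.le) (neg_nonpos.1 ((neg_le_abs u).trans h.le))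

theorem posPart_disjoint_negPart (x : E) : |x⁺| ⊓ |x⁻| = 0 := by
  rw [abs_of_nonneg (posPart_nonneg x), abs_of_nonneg (negPart_nonneg x),
    posPart_inf_negPart_eq_zero]

theorem posPart_le_abs' (x : E) : x⁺ ≤ |x| := sup_le (le_abs_self x) (abs_nonneg x)

theorem negPart_le_abs' (x : E) : x⁻ ≤ |x| := sup_le (neg_le_abs x) (abs_nonneg x)

theorem riesz_decomposition {y u v : E} (hy : 0 ≤ y) (hu : 0 ≤ u) (hv : 0 ≤ v) (hyuv : y ≤ u + v) :
    ∃ a b : E, 0 ≤ a ∧ a ≤ u ∧ 0 ≤ b ∧ b ≤ v ∧ a + b = y := by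
  refine ⟨y ⊓ u, y - y ⊓ u, le_inf hy hu, inf_le_right, sub_nonneg.2 inf_le_left, ?_,
    add_sub_cancel _ _⟩
  rw [sub_le_comm]
  exact le_inf (sub_le_self _ hv) (sub_le_iff_le_add.2 hyuv)

variable [Module ℝ E] [PosSMulMono ℝ E]

theorem abs_real_smul_le (c : ℝ) (x : E) : |c • x| ≤ |c| • |x| := by
  have key : ∀ (d : ℝ), 0 ≤ d → ∀ y : E, |d • y| ≤ d • |y| := fun d hd y =>
    sup_le (smul_le_smul_of_nonneg_left (le_abs_self y) hd)
      (by rw [← smul_neg]; exact smul_le_smul_of_nonneg_left (neg_le_abs y) hd)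
  rcases le_total 0 c with hc | hc
  · rw [abs_of_nonneg hc]; exact key c hc x
  · rw [abs_of_nonpos hc, ← abs_neg (c • x), ← neg_smul]; exact key _ (neg_nonneg.2 hc) x

theorem abs_real_smul (c : ℝ) (x : E) : |c • x| = |c| • |x| := by
  refine le_antisymm (abs_real_smul_le c x) ?_
  rcases eq_or_ne c 0 with rfl | hc
  · simp
  · calc |c| • |x| = |c| • |c⁻¹ • c • x| := by rw [inv_smul_smul₀ hc]
      _ ≤ |c| • |c⁻¹| • |c • x| :=
        smul_le_smul_of_nonneg_left (abs_real_smul_le _ _) (abs_nonneg c)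
      _ = |c • x| := by rw [smul_smul, ← abs_mul, mul_inv_cancel₀ hc, abs_one, one_smul]

theorem real_smul_le_of_le {a b : ℝ} (h : a ≤ b) {x : E} (hx : 0 ≤ x) : a • x ≤ b • x := by
  have := smul_nonneg (sub_nonneg.2 h) hx
  rwa [sub_smul, sub_nonneg] at this

theorem disjoint_abs_smul {u w : E} (c : ℝ) (h : |u| ⊓ |w| = 0) : |c • u| ⊓ |w| = 0 := by
  have key : ∀ n : ℕ, |(n : ℝ) • u| ⊓ |w| = 0 := by
    intro n
    induction n with
    | zero => simp
    | succ n ih => rw [Nat.cast_succ, add_smul, one_smul]; exact disjoint_abs_add ih h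
  obtain ⟨n, hn⟩ := exists_nat_ge |c|
  refine disjoint_abs_of_abs_le (key n) ?_
  rw [abs_real_smul, abs_real_smul, Nat.abs_cast]
  exact real_smul_le_of_le hn (abs_nonneg u)

/-- A positively homogeneous additive function on the positive cone extends to a linear
functional. -/
theorem exists_linearMap_of_cone (σ : E → ℝ)
    (hadd : ∀ x y, 0 ≤ x → 0 ≤ y → σ (x + y) = σ x + σ y)
    (hsmul : ∀ (c : ℝ) x, 0 ≤ c → 0 ≤ x → σ (c • x) = c * σ x) :
    ∃ h : E →ₗ[ℝ] ℝ, ∀ x, 0 ≤ x → h x = σ x := by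
  have key : ∀ u v x : E, 0 ≤ u → 0 ≤ v → x = u - v → σ x⁺ - σ x⁻ = σ u - σ v := by
    intro u v x hu hv hx
    have h1 : x⁺ + v = u + x⁻ := by
      rw [← sub_eq_sub_iff_add_eq_add, posPart_sub_negPart, hx]
    have h2 := congrArg σ h1
    rw [hadd _ _ (posPart_nonneg x) hv, hadd _ _ hu (negPart_nonneg x)] at h2
    linarith
  have h0 : σ 0 = 0 := by simpa using hsmul 0 0 le_rfl le_rfl
  refine ⟨{ toFun := fun x => σ x⁺ - σ x⁻, map_add' := ?_, map_smul' := ?_ }, ?_⟩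
  · intro x y
    rw [key (x⁺ + y⁺) (x⁻ + y⁻) (x + y) (add_nonneg (posPart_nonneg x) (posPart_nonneg y))
      (add_nonneg (negPart_nonneg x) (negPart_nonneg y)),
      hadd _ _ (posPart_nonneg x) (posPart_nonneg y),
      hadd _ _ (negPart_nonneg x) (negPart_nonneg y)]
    · ring
    · rw [add_sub_add_comm, posPart_sub_negPart, posPart_sub_negPart]
  · intro c x
    simp only [RingHom.id_apply, smul_eq_mul]
    rcases le_total 0 c with hc | hc
    · rw [key (c • x⁺) (c • x⁻) (c • x) (smul_nonneg hc (posPart_nonneg x))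
        (smul_nonneg hc (negPart_nonneg x)),
        hsmul _ _ hc (posPart_nonneg x), hsmul _ _ hc (negPart_nonneg x)]
      · ring
      · rw [← smul_sub, posPart_sub_negPart]
    · have hc' := neg_nonneg.2 hc
      rw [key (-c • x⁻) (-c • x⁺) (c • x) (smul_nonneg hc' (negPart_nonneg x))
        (smul_nonneg hc' (posPart_nonneg x)),
        hsmul _ _ hc' (posPart_nonneg x), hsmul _ _ hc' (negPart_nonneg x)]
      · ring
      · rw [← smul_sub, neg_smul, ← smul_neg, neg_sub, posPart_sub_negPart]
  · intro x hx
    show σ x⁺ - σ x⁻ = σ x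
    rw [posPart_eq_self.2 hx, negPart_eq_zero.2 hx, h0, sub_zero]

end RieszSpace

section OrderDual

open Set Filter Topology

variable {E D : Type*} [Lattice E] [AddCommGroup E] [IsOrderedAddMonoid E] [Module ℝ E]
  [PosSMulMono ℝ E] [Lattice D] [AddCommGroup D] [IsOrderedAddMonoid D] [Module ℝ D]
  [PosSMulMono ℝ D] {P : D →ₗ[ℝ] E →ₗ[ℝ] ℝ}

namespace IsOrderDual

theorem apply_nonneg (h : IsOrderDual E D (fun f x => P f x)) {f : D} {x : E} (hf : 0 ≤ f)
    (hx : 0 ≤ x) : 0 ≤ P f x := by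
  simpa using (h.le_iff 0 f).1 hf x hx

theorem mono_left (h : IsOrderDual E D (fun f x => P f x)) {f g : D} {x : E} (hfg : f ≤ g)
    (hx : 0 ≤ x) : P f x ≤ P g x := (h.le_iff f g).1 hfg x hx

theorem mono_right (h : IsOrderDual E D (fun f x => P f x)) {f : D} {x y : E} (hf : 0 ≤ f)
    (hxy : x ≤ y) : P f x ≤ P f y := by
  have := h.apply_nonneg hf (sub_nonneg.2 hxy)
  rwa [map_sub, sub_nonneg] at this

theorem abs_apply_le_of_nonneg (h : IsOrderDual E D (fun f x => P f x)) (f : D) {x : E}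
    (hx : 0 ≤ x) : |P f x| ≤ P |f| x := by
  refine abs_le.2 ⟨?_, h.mono_left (le_abs_self f) hx⟩
  have := h.mono_left (neg_le_abs f) hx
  rw [map_neg, LinearMap.neg_apply] at this
  linarith

theorem abs_apply_le_of_abs_le (h : IsOrderDual E D (fun f x => P f x)) (f : D) {x y : E}
    (hxy : |x| ≤ y) : |P f x| ≤ P |f| y := by
  have h1 := abs_le.1 (h.abs_apply_le_of_nonneg f (posPart_nonneg x))
  have h2 := abs_le.1 (h.abs_apply_le_of_nonneg f (negPart_nonneg x))
  have h3 : P f x = P f x⁺ - P f x⁻ := by rw [← map_sub, posPart_sub_negPart]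
  have h4 : P |f| |x| = P |f| x⁺ + P |f| x⁻ := by rw [← map_add, posPart_add_negPart]
  have h5 := h.mono_right (abs_nonneg f) hxy
  rw [abs_le]
  constructor <;> linarith [h1.1, h1.2, h2.1, h2.2]

theorem exists_of_nonneg (h : IsOrderDual E D (fun f x => P f x)) (φ : E →ₗ[ℝ] ℝ)
    (hφ : ∀ x, 0 ≤ x → 0 ≤ φ x) : ∃ f : D, 0 ≤ f ∧ ∀ x, P f x = φ x := by
  have hmono : ∀ x y, x ≤ y → φ x ≤ φ y := fun x y hxy => by
    have := hφ _ (sub_nonneg.2 hxy)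
    rwa [map_sub, sub_nonneg] at this
  obtain ⟨f, hf⟩ := h.surj φ φ.isLinear
    fun a b => ⟨φ a, φ b, fun x hax hxb => ⟨hmono _ _ hax, hmono _ _ hxb⟩⟩
  refine ⟨f, (h.le_iff 0 f).2 fun x hx => ?_, hf⟩
  simpa [hf] using hφ x hx

theorem exists_of_le (h : IsOrderDual E D (fun f x => P f x)) (φ χ : E →ₗ[ℝ] ℝ)
    (hχ : ∀ x, 0 ≤ x → 0 ≤ χ x) (hφ : ∀ x, 0 ≤ x → φ x ≤ χ x) :
    ∃ f : D, ∀ x, P f x = φ x := by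
  obtain ⟨g, -, hg⟩ := h.exists_of_nonneg χ hχ
  obtain ⟨k, -, hk⟩ := h.exists_of_nonneg (χ - φ) fun x hx => by simpa using hφ x hx
  exact ⟨g - k, fun x => by simp [hg, hk]⟩

/-- The Riesz-Kantorovich formula for the infimum of two functionals. -/
theorem exists_add_lt_inf (h : IsOrderDual E D (fun f x => P f x)) (f g : D) {x : E}
    (hx : 0 ≤ x) {ε : ℝ} (hε : 0 < ε) :
    ∃ y z : E, 0 ≤ y ∧ 0 ≤ z ∧ y + z = x ∧ P f y + P g z < P (f ⊓ g) x + ε := by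
  set V : E → Set ℝ := fun x => {r | ∃ y z : E, 0 ≤ y ∧ 0 ≤ z ∧ y + z = x ∧ P f y + P g z = r}
    with hV
  have hne : ∀ x, 0 ≤ x → (V x).Nonempty := fun x hx => ⟨_, 0, x, le_rfl, hx, zero_add x, rfl⟩
  have hlow : ∀ x r, r ∈ V x → -(P |f| x + P |g| x) ≤ r := by
    rintro x r ⟨y, z, hy, hz, rfl, rfl⟩
    have h1 := (abs_le.1 (h.abs_apply_le_of_nonneg f hy)).1
    have h2 := (abs_le.1 (h.abs_apply_le_of_nonneg g hz)).1
    have h3 := h.apply_nonneg (abs_nonneg f) hz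
    have h4 := h.apply_nonneg (abs_nonneg g) hy
    simp only [map_add]
    linarith
  have hbdd : ∀ x, BddBelow (V x) := fun x => ⟨_, fun r hr => hlow x r hr⟩
  obtain ⟨k, hk⟩ := exists_linearMap_of_cone (fun x => sInf (V x)) (by
    intro x y hx hy
    apply le_antisymm
    · refine le_of_forall_pos_lt_add fun ε hε => ?_
      obtain ⟨r, ⟨y₁, z₁, hy₁, hz₁, rfl, rfl⟩, hr⟩ :=
        exists_lt_of_csInf_lt (hne x hx) (lt_add_of_pos_right _ (half_pos hε))
      obtain ⟨s, ⟨y₂, z₂, hy₂, hz₂, rfl, rfl⟩, hs⟩ :=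
        exists_lt_of_csInf_lt (hne y hy) (lt_add_of_pos_right _ (half_pos hε))
      have := csInf_le (hbdd (y₁ + z₁ + (y₂ + z₂)))
        ⟨y₁ + y₂, z₁ + z₂, add_nonneg hy₁ hy₂, add_nonneg hz₁ hz₂, by abel, rfl⟩
      simp only [map_add] at this
      linarith
    · refine le_csInf (hne _ (add_nonneg hx hy)) ?_
      rintro r ⟨u, v, hu, hv, huv, rfl⟩
      obtain ⟨a, b, ha, hax, hb, hby, rfl⟩ :=
        riesz_decomposition hu hx hy (by rw [← huv]; exact le_add_of_nonneg_right hv)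
      have h1 := csInf_le (hbdd x) ⟨a, x - a, ha, sub_nonneg.2 hax, add_sub_cancel _ _, rfl⟩
      have h2 := csInf_le (hbdd y) ⟨b, y - b, hb, sub_nonneg.2 hby, add_sub_cancel _ _, rfl⟩
      have h3 : v = (x - a) + (y - b) := by
        rw [eq_sub_of_add_eq' huv]; abel
      rw [h3]
      simp only [map_add] at h1 h2 ⊢
      linarith) (by
    have hle : ∀ (c : ℝ) x, 0 < c → 0 ≤ x → sInf (V (c • x)) ≤ c * sInf (V x) := by
      intro c x hc hx
      rw [← div_le_iff₀' hc]
      refine le_csInf (hne x hx) ?_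
      rintro r ⟨y, z, hy, hz, rfl, rfl⟩
      rw [div_le_iff₀' hc]
      refine csInf_le (hbdd _) ⟨c • y, c • z, smul_nonneg hc.le hy, smul_nonneg hc.le hz,
        (smul_add _ _ _).symm, ?_⟩
      simp only [map_smul, smul_eq_mul]
      ring
    intro c x hc hx
    rcases hc.eq_or_lt with rfl | hc
    · rw [zero_smul, zero_mul]
      refine le_antisymm (csInf_le (hbdd _) ⟨0, 0, le_rfl, le_rfl, add_zero _, by simp⟩) ?_
      refine le_csInf (hne 0 le_rfl) fun r hr => ?_
      simpa using hlow 0 r hr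
    · refine le_antisymm (hle c x hc hx) ?_
      have := hle c⁻¹ (c • x) (inv_pos.2 hc) (smul_nonneg hc.le hx)
      rw [inv_smul_smul₀ hc.ne'] at this
      calc c * sInf (V x) ≤ c * (c⁻¹ * sInf (V (c • x))) :=
            mul_le_mul_of_nonneg_left this hc.le
        _ = _ := by field_simp)
  have hkf : ∀ x, 0 ≤ x → k x ≤ P f x := fun x hx => by
    rw [hk x hx]; exact csInf_le (hbdd x) ⟨x, 0, hx, le_rfl, add_zero x, by simp⟩
  have hkg : ∀ x, 0 ≤ x → k x ≤ P g x := fun x hx => by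
    rw [hk x hx]; exact csInf_le (hbdd x) ⟨0, x, le_rfl, hx, zero_add x, by simp⟩
  obtain ⟨l, hl⟩ := h.exists_of_le k (P |f|) (fun x hx => h.apply_nonneg (abs_nonneg f) hx)
    fun x hx => (hkf x hx).trans (h.mono_left (le_abs_self f) hx)
  have hlfg : l ≤ f ⊓ g := le_inf
    ((h.le_iff l f).2 fun x hx => by simpa [hl] using hkf x hx)
    ((h.le_iff l g).2 fun x hx => by simpa [hl] using hkg x hx)
  have h1 := h.mono_left hlfg hx
  rw [hl, hk x hx] at h1
  obtain ⟨r, ⟨y, z, hy, hz, hyz, rfl⟩, hr⟩ :=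
    exists_lt_of_csInf_lt (hne x hx) (lt_add_of_pos_right _ hε)
  exact ⟨y, z, hy, hz, hyz, hr.trans_le (by linarith)⟩

theorem abs_apply_le_of_forall_le (h : IsOrderDual E D (fun f x => P f x)) (f : D) {x : E}
    (hx : 0 ≤ x) {C : ℝ} (hC : ∀ y, -x ≤ y → y ≤ x → P f y ≤ C) : P |f| x ≤ C := by
  refine le_of_forall_pos_lt_add fun ε hε => ?_
  obtain ⟨y, z, hy, hz, rfl, hlt⟩ := h.exists_add_lt_inf (-f) f hx (half_pos hε)
  have hmeet : -f ⊓ f = -|f| := by rw [abs, neg_sup, neg_neg, inf_comm]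
  have hCyz := hC (y - z) (by
      rw [neg_add, sub_eq_add_neg]; gcongr; exact neg_le_self hy)
    (by rw [sub_eq_add_neg]; gcongr; exact neg_le_self hz)
  simp only [hmeet, map_neg, map_sub, LinearMap.neg_apply] at hlt hCyz
  linarith

/-- A bounded increasing net in an order dual converges pointwise to its supremum. -/
theorem exists_isLUB_of_directed (h : IsOrderDual E D (fun f x => P f x)) {ι : Type*}
    [Preorder ι] [Nonempty ι] [IsDirectedOrder ι] {θ : ι → D} (hθ : Monotone θ) {u : D}
    (hu : ∀ i, θ i ≤ u) :
    ∃ ξ : D, IsLUB (range θ) ξ ∧ ∀ x, Tendsto (fun i => P (θ i) x) atTop (𝓝 (P ξ x)) := by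
  have hpos : ∀ x, 0 ≤ x → ∃ r, Tendsto (fun i => P (θ i) x) atTop (𝓝 r) := fun x hx =>
    ⟨_, tendsto_atTop_ciSup (fun i j hij => h.mono_left (hθ hij) hx)
      ⟨P u x, by rintro _ ⟨i, rfl⟩; exact h.mono_left (hu i) hx⟩⟩
  have hall : ∀ x, ∃ r, Tendsto (fun i => P (θ i) x) atTop (𝓝 r) := fun x => by
    obtain ⟨r, hr⟩ := hpos x⁺ (posPart_nonneg x)
    obtain ⟨s, hs⟩ := hpos x⁻ (negPart_nonneg x)
    refine ⟨r - s, (hr.sub hs).congr fun i => ?_⟩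
    rw [← map_sub, posPart_sub_negPart]
  choose L hL using hall
  let φ : E →ₗ[ℝ] ℝ :=
    { toFun := L
      map_add' := fun x y => tendsto_nhds_unique (hL (x + y))
        (((hL x).add (hL y)).congr fun i => (map_add _ _ _).symm)
      map_smul' := fun c x => tendsto_nhds_unique (hL (c • x))
        (((hL x).const_mul c).congr fun i => by simp) }
  have hle : ∀ x, 0 ≤ x → ∀ i, P (θ i) x ≤ L x := fun x hx i =>
    ge_of_tendsto (hL x) ((eventually_ge_atTop i).mono fun j hij => h.mono_left (hθ hij) hx)
  have hge : ∀ (v : D), (∀ i, θ i ≤ v) → ∀ x, 0 ≤ x → L x ≤ P v x := fun v hv x hx =>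
    le_of_tendsto (hL x) (Eventually.of_forall fun i => h.mono_left (hv i) hx)
  obtain ⟨ξ, hξ⟩ := h.exists_of_le φ (P |u|) (fun x hx => h.apply_nonneg (abs_nonneg u) hx)
    fun x hx => (hge u hu x hx).trans (h.mono_left (le_abs_self u) hx)
  have hξL : ∀ x, P ξ x = L x := hξ
  refine ⟨ξ, ⟨?_, fun v hv => (h.le_iff _ _).2 fun x hx => ?_⟩, fun x => by
    rw [hξL]; exact hL x⟩
  · rintro _ ⟨i, rfl⟩
    exact (h.le_iff _ _).2 fun x hx => (hle x hx i).trans (hξL x).ge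
  · exact (hξL x).le.trans (hge v (fun i => hv (mem_range_self i)) x hx)

theorem exists_isLUB (h : IsOrderDual E D (fun f x => P f x)) {s : Set D} (hs : s.Nonempty)
    (hb : BddAbove s) : ∃ ξ, IsLUB s ξ := by
  obtain ⟨u, hu⟩ := hb
  have : Nonempty (supClosure s) := (hs.mono subset_supClosure).to_subtype
  have : IsDirectedOrder (supClosure s) := ⟨fun a b =>
    ⟨⟨a ⊔ b, supClosed_supClosure a.2 b.2⟩, le_sup_left (a := (a : D)),
      le_sup_right (a := (a : D))⟩⟩
  rw [← upperBounds_supClosure] at hu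
  obtain ⟨ξ, hξ, -⟩ := h.exists_isLUB_of_directed (θ := ((↑) : supClosure s → D))
    (fun _ _ hab => hab) fun i => hu i.2
  rw [Subtype.range_coe, isLUB_supClosure] at hξ
  exact ⟨ξ, hξ⟩

end IsOrderDual

end OrderDual

section HahnBanach

variable {D : Type*} [Lattice D] [AddCommGroup D] [IsOrderedAddMonoid D] [Module ℝ D]
  [PosSMulMono ℝ D]

theorem exists_lt_linearPMap_of_le_abs
    (hlub : ∀ s : Set D, s.Nonempty → BddAbove s → ∃ ξ, IsLUB s ξ) (f : D →ₗ.[ℝ] D)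
    (hf : ∀ x : f.domain, f x ≤ |(x : D)|) (hdom : f.domain ≠ ⊤) :
    ∃ g, f < g ∧ ∀ x : g.domain, g x ≤ |(x : D)| := by
  obtain ⟨y, -, hy⟩ : ∃ y ∈ ⊤, y ∉ f.domain := SetLike.exists_of_lt (lt_top_iff_ne_top.2 hdom)
  have hub : ∀ x x' : f.domain, f x' - |(x' : D) - y| ≤ |(x : D) + y| - f x := by
    intro x x'
    have h1 := hf (x' + x)
    rw [f.map_add] at h1
    have h2 : |((x' + x : f.domain) : D)| ≤ |(x : D) + y| + |(x' : D) - y| := by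
      rw [Submodule.coe_add, show (x' : D) + x = ((x : D) + y) + ((x' : D) - y) by abel]
      exact abs_add_le _ _
    rw [sub_le_iff_le_add, sub_add_eq_add_sub, le_sub_iff_add_le]
    exact h1.trans h2
  obtain ⟨d, hd⟩ := hlub (Set.range fun x' : f.domain => f x' - |(x' : D) - y|)
    (Set.range_nonempty _) ⟨_, by rintro _ ⟨x', rfl⟩; exact hub 0 x'⟩
  have hd1 : ∀ x : f.domain, f x - d ≤ |(x : D) - y| := fun x =>
    sub_le_comm.1 (hd.1 ⟨x, rfl⟩)
  have hd2 : ∀ x : f.domain, f x + d ≤ |(x : D) + y| := fun x =>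
    le_sub_iff_add_le'.1 (hd.2 (by rintro _ ⟨x', rfl⟩; exact hub x x'))
  refine ⟨f.supSpanSingleton y d hy, ?_, ?_⟩
  · refine lt_iff_le_not_ge.2 ⟨f.left_le_sup _ _, fun H => ?_⟩
    replace H := LinearPMap.domain_mono.monotone H
    rw [LinearPMap.domain_supSpanSingleton, sup_le_iff, Submodule.span_le,
      Set.singleton_subset_iff] at H
    exact hy H.2
  · rintro ⟨z, hz⟩
    rcases Submodule.mem_sup.1 hz with ⟨x, hx, y', hy', rfl⟩
    rcases Submodule.mem_span_singleton.1 hy' with ⟨r, rfl⟩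
    rw [LinearPMap.supSpanSingleton_apply_mk _ _ _ _ _ hx, RingHom.id_apply]
    change f ⟨x, hx⟩ + r • d ≤ |x + r • y|
    rcases lt_trichotomy r 0 with hr | rfl | hr
    · have h1 := smul_le_smul_of_nonneg_left (hd1 ((-r)⁻¹ • ⟨x, hx⟩)) (neg_pos.2 hr).le
      have h2 : -r • |(((-r)⁻¹ • (⟨x, hx⟩ : f.domain) : f.domain) : D) - y| = |x + r • y| := by
        rw [← abs_of_pos (neg_pos.2 hr), ← abs_real_smul, abs_of_pos (neg_pos.2 hr), smul_sub,
          Submodule.coe_smul, smul_inv_smul₀ (neg_pos.2 hr).ne', neg_smul, sub_neg_eq_add]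
      rwa [h2, f.map_smul, smul_sub, smul_inv_smul₀ (neg_pos.2 hr).ne', neg_smul,
        sub_neg_eq_add] at h1
    · simpa using hf ⟨x, hx⟩
    · have h1 := smul_le_smul_of_nonneg_left (hd2 (r⁻¹ • ⟨x, hx⟩)) hr.le
      have h2 : r • |((r⁻¹ • (⟨x, hx⟩ : f.domain) : f.domain) : D) + y| = |x + r • y| := by
        rw [← abs_of_pos hr, ← abs_real_smul, abs_of_pos hr, smul_add,
          Submodule.coe_smul, smul_inv_smul₀ hr.ne']
      rwa [h2, f.map_smul, smul_add, smul_inv_smul₀ hr.ne'] at h1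

/-- Kantorovich's extension theorem for the sublinear map `|·|` of a Dedekind complete Riesz
space. -/
theorem exists_extension_le_abs
    (hlub : ∀ s : Set D, s.Nonempty → BddAbove s → ∃ ξ, IsLUB s ξ) (p : D →ₗ.[ℝ] D)
    (hp : ∀ x : p.domain, p x ≤ |(x : D)|) :
    ∃ U : D →ₗ[ℝ] D, (∀ x : p.domain, U x = p x) ∧ ∀ x, U x ≤ |x| := by
  set S := {p : D →ₗ.[ℝ] D | ∀ x : p.domain, p x ≤ |(x : D)|}
  have hSc : ∀ c, c ⊆ S → IsChain (· ≤ ·) c → ∀ y ∈ c, ∃ ub ∈ S, ∀ z ∈ c, z ≤ ub := by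
    intro c hcs c_chain y hy
    have cne : c.Nonempty := ⟨y, hy⟩
    have hcd : DirectedOn (· ≤ ·) c := c_chain.directedOn
    refine ⟨LinearPMap.sSup c hcd, ?_, fun _ ↦ LinearPMap.le_sSup hcd⟩
    rintro ⟨x, hx⟩
    have hdir : DirectedOn (· ≤ ·) (LinearPMap.domain '' c) :=
      directedOn_image.2 (hcd.mono LinearPMap.domain_mono.monotone)
    rcases (Submodule.mem_sSup_of_directed (cne.image _) hdir).1 hx with ⟨_, ⟨f, hfc, rfl⟩, hfx⟩
    have h1 : f ≤ LinearPMap.sSup c hcd := LinearPMap.le_sSup _ hfc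
    have h2 : f ⟨x, hfx⟩ = LinearPMap.sSup c hcd ⟨x, hx⟩ := h1.2 rfl
    rw [← h2]
    exact hcs hfc ⟨x, hfx⟩
  obtain ⟨q, hpq, hqs, hq⟩ := zorn_le_nonempty₀ S hSc p hp
  have hdom : q.domain = ⊤ := by
    by_contra hdom
    obtain ⟨r, hqr, hr⟩ := exists_lt_linearPMap_of_le_abs hlub q hqs hdom
    exact hqr.not_ge (hq hr hqr.le)
  rcases q with ⟨q_dom, q⟩
  obtain rfl : q_dom = ⊤ := hdom
  refine ⟨q.comp (LinearMap.id.codRestrict ⊤ fun _ => trivial), fun x => ?_, fun x => hqs ⟨x, _⟩⟩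
  exact (hpq.2 (show (x : D) = _ from rfl)).symm

/-- If `|S f| ≤ |T f|` pointwise then `S` factors through `T` by a contraction. -/
theorem exists_factor_of_abs_le
    (hlub : ∀ s : Set D, s.Nonempty → BddAbove s → ∃ ξ, IsLUB s ξ) (T S : D →ₗ[ℝ] D)
    (hST : ∀ f, |S f| ≤ |T f|) :
    ∃ U : D →ₗ[ℝ] D, (∀ g, |U g| ≤ |g|) ∧ ∀ f, U (T f) = S f := by
  obtain ⟨σ, hσ⟩ := T.rangeRestrict.exists_rightInverse_of_surjective T.range_rangeRestrict
  have hσ' : ∀ x : LinearMap.range T, T (σ x) = x := fun x =>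
    congrArg Subtype.val (LinearMap.congr_fun hσ x)
  obtain ⟨U, hU, hUabs⟩ := exists_extension_le_abs hlub ⟨LinearMap.range T, S ∘ₗ σ⟩ fun x =>
    (le_abs_self _).trans ((hST (σ x)).trans_eq (by rw [hσ']))
  refine ⟨U, fun g => sup_le (hUabs g) ?_, fun f => ?_⟩
  · simpa using hUabs (-g)
  · have h1 : U (T f) = S (σ ⟨T f, f, rfl⟩) := hU ⟨T f, f, rfl⟩
    have h2 := hST (σ ⟨T f, f, rfl⟩ - f)
    rw [map_sub, map_sub, hσ', sub_self, abs_zero] at h2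
    rw [h1, ← sub_eq_zero]
    exact le_antisymm ((le_abs_self _).trans h2) (neg_nonpos.1 ((neg_le_abs _).trans h2))

end HahnBanach

section BandPreserving

variable {E : Type*} [Lattice E] [AddCommGroup E] [IsOrderedAddMonoid E] [Module ℝ E]
  [PosSMulMono ℝ E]

theorem eq_zero_of_nonneg_of_le_of_disjoint {d r : E} (hd : 0 ≤ d) (hdr : d ≤ r)
    (h : |r| ⊓ |d| = 0) : d = 0 := by
  refine eq_zero_of_disjoint_abs_self (disjoint_abs_of_abs_le h ?_)
  rw [abs_of_nonneg hd, abs_of_nonneg (hd.trans hdr)]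
  exact hdr

theorem posPart_inf_negPart_eq_zero_of_bandPres
    (harch : ∀ w z : E, 0 ≤ w → (∀ δ : ℝ, 0 < δ → w ≤ δ • z) → w = 0)
    {T c : E →ₗ[ℝ] E} (hT : IsBandPres T) (hc : IsBandPres c)
    (hTc : ∀ x, 0 ≤ x → |T x| ≤ c x) {x y : E} (hx : 0 ≤ x) (hy : 0 ≤ y) :
    (T x)⁺ ⊓ (T y)⁻ = 0 := by
  have hc0 : ∀ z, 0 ≤ z → 0 ≤ c z := fun z hz => (abs_nonneg _).trans (hTc z hz)
  have hcmono : ∀ u v, u ≤ v → c u ≤ c v := fun u v huv => by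
    have := hc0 _ (sub_nonneg.2 huv)
    rwa [map_sub, sub_nonneg] at this
  set w := (T x)⁺ ⊓ (T y)⁻ with hw
  have hw0 : 0 ≤ w := le_inf (posPart_nonneg _) (negPart_nonneg _)
  refine harch w (c x) hw0 fun δ hδ => ?_
  have hδc : 0 ≤ δ • c x := smul_nonneg hδ.le (hc0 x hx)
  set a := (w - δ • c x)⁺ with ha
  have ha0 : 0 ≤ a := posPart_nonneg _
  have haw : a ≤ w := sup_le (sub_le_self _ hδc) hw0
  have hax : a ≤ (T x)⁺ := haw.trans inf_le_left
  have hstep : ∀ k : ℕ, |((k * δ) • x - y)⁺| ⊓ |a| = 0 := by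
    intro k
    induction k with
    | zero =>
      rw [Nat.cast_zero, zero_mul, zero_smul, zero_sub, posPart_of_nonpos (neg_nonpos.2 hy)]
      simp
    | succ k ih =>
      set s : ℝ := k * δ with hs
      have hs0 : 0 ≤ s := by positivity
      have hs1 : ((k + 1 : ℕ) : ℝ) * δ = s + δ := by push_cast; ring
      rw [hs1]
      set v := ((s + δ) • x - y)⁺ with hv
      set u := ((s + δ) • x - y)⁻ with hu
      have hv0 : 0 ≤ v := posPart_nonneg _
      set d := v ⊓ a with hd
      have hd0 : 0 ≤ d := le_inf hv0 ha0
      have hda : |d| ≤ |a| := by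
        rw [abs_of_nonneg hd0, abs_of_nonneg ha0]; exact inf_le_right
      have hdv : |d| ≤ |v| := by
        rw [abs_of_nonneg hd0, abs_of_nonneg hv0]; exact inf_le_left
      have hdisj : ∀ {p q : E}, |p| ⊓ |q| = 0 → |d| ≤ |q| → |p| ⊓ |d| = 0 := by
        intro p q hpq hdq
        rw [inf_comm] at hpq ⊢
        exact disjoint_abs_of_abs_le hpq hdq
      have hud : |c u| ⊓ |d| = 0 := by
        refine hc _ _ (hdisj ?_ hdv)
        rw [inf_comm]
        exact posPart_disjoint_negPart _
      have hvd : |(|T (s • x - y)⁺|)| ⊓ |d| = 0 := by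
        rw [abs_abs]
        exact hT _ _ (hdisj ih hda)
      have hxd : |s • (T x)⁻| ⊓ |d| = 0 := by
        refine disjoint_abs_smul s (hdisj ?_ (hda.trans ?_) (q := (T x)⁺))
        · rw [inf_comm]
          exact posPart_disjoint_negPart _
        · rw [abs_of_nonneg ha0, abs_of_nonneg (posPart_nonneg _)]
          exact hax
      have hr := disjoint_abs_add (disjoint_abs_add hxd hud) hvd
      set r := s • (T x)⁻ + c u + |T (s • x - y)⁺| with hrdef
      have hr0 : 0 ≤ r := add_nonneg (add_nonneg (smul_nonneg hs0 (negPart_nonneg _))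
        (hc0 _ (negPart_nonneg _))) (abs_nonneg _)
      have hle : (T y)⁻ ≤ r + δ • c x := by
        refine sup_le ?_ (add_nonneg hr0 hδc)
        have h1 : T y = s • T x + T (s • x - y)⁻ - T (s • x - y)⁺ := by
          rw [← map_smul, ← map_add, ← map_sub, add_sub_assoc,
            ← neg_sub (s • x - y)⁺, posPart_sub_negPart, ← sub_eq_add_neg, sub_sub_cancel]
        have h2 : (s • x - y)⁻ ≤ u + δ • x := by
          refine sup_le ?_ (add_nonneg (negPart_nonneg _) (smul_nonneg hδ.le hx))
          have h3 : -((s + δ) • x - y) ≤ u := neg_le_negPart _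
          have h4 : -(s • x - y) = -((s + δ) • x - y) + δ • x := by
            rw [add_smul]; abel
          rw [h4]
          exact add_le_add_left h3 _
        have h5 : -T (s • x - y)⁻ ≤ c u + δ • c x := by
          rw [← map_smul, ← map_add]
          exact (neg_le_abs _).trans ((hTc _ (negPart_nonneg _)).trans (hcmono _ _ h2))
        have h6 : -(s • T x) ≤ s • (T x)⁻ := by
          rw [← smul_neg]
          exact smul_le_smul_of_nonneg_left (neg_le_negPart _) hs0
        calc -T y = -(s • T x) + -T (s • x - y)⁻ + T (s • x - y)⁺ := by rw [h1]; abel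
          _ ≤ s • (T x)⁻ + (c u + δ • c x) + |T (s • x - y)⁺| :=
            add_le_add (add_le_add h6 h5) (le_abs_self _)
          _ = r + δ • c x := by rw [hrdef]; abel
      have har : a ≤ r := sup_le (sub_le_iff_le_add.2 (inf_le_right.trans hle)) hr0
      rw [abs_of_nonneg hv0, abs_of_nonneg ha0]
      exact eq_zero_of_nonneg_of_le_of_disjoint hd0 (inf_le_right.trans har) hr
  have hax0 : x ⊓ a = 0 := by
    set e := x ⊓ a with he
    have he0 : 0 ≤ e := le_inf hx ha0
    have hey : ∀ k : ℕ, ((k : ℝ) * δ) • e ≤ y := by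
      intro k
      have hk0 : (0 : ℝ) ≤ k * δ := by positivity
      set v := ((k * δ) • x - y)⁺ with hv
      have hv0 : 0 ≤ v := posPart_nonneg _
      have h1 : |((k : ℝ) * δ) • e| ⊓ |v| = 0 := by
        refine disjoint_abs_smul _ (disjoint_abs_of_abs_le (v := a) ?_ ?_)
        · rw [inf_comm]
          exact hstep k
        · rw [abs_of_nonneg he0, abs_of_nonneg ha0]
          exact inf_le_right
      have hke := smul_nonneg hk0 he0
      rw [abs_of_nonneg hke, abs_of_nonneg hv0, inf_comm] at h1
      have h2 : ((k : ℝ) * δ) • e ≤ y + v :=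
        (smul_le_smul_of_nonneg_left inf_le_left hk0).trans
          (sub_le_iff_le_add'.1 (le_posPart _))
      calc ((k : ℝ) * δ) • e = (y + v) ⊓ ((k : ℝ) * δ) • e := (inf_eq_right.2 h2).symm
        _ ≤ y ⊓ ((k : ℝ) * δ) • e + v ⊓ ((k : ℝ) * δ) • e := add_inf_le_inf_add_inf hy hv0 hke
        _ ≤ y := by rw [h1, add_zero]; exact inf_le_left
    refine harch e y he0 fun δ' hδ' => ?_
    obtain ⟨k, hk⟩ := exists_nat_gt (δ' * δ)⁻¹
    have hk1 : 1 ≤ δ' * (k * δ) := by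
      have h1 := (inv_lt_iff_one_lt_mul₀ (mul_pos hδ' hδ)).1 hk
      nlinarith
    calc e = (1 : ℝ) • e := (one_smul _ _).symm
      _ ≤ (δ' * (k * δ)) • e := real_smul_le_of_le hk1 he0
      _ = δ' • ((k : ℝ) * δ) • e := mul_smul _ _ _
      _ ≤ δ' • y := smul_le_smul_of_nonneg_left (hey k) hδ'.le
  have ha' : a = 0 := by
    refine eq_zero_of_nonneg_of_le_of_disjoint ha0 (hax.trans (posPart_le_abs' _)) ?_
    rw [abs_abs]
    exact hT _ _ (by rw [abs_of_nonneg hx, abs_of_nonneg ha0, hax0])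
  exact sub_nonpos.1 (posPart_eq_zero.1 ha')

theorem apply_apply_nonneg_of_bandPres
    (harch : ∀ w z : E, 0 ≤ w → (∀ δ : ℝ, 0 < δ → w ≤ δ • z) → w = 0)
    {T c : E →ₗ[ℝ] E} (hT : IsBandPres T) (hc : IsBandPres c)
    (hTc : ∀ x, 0 ≤ x → |T x| ≤ c x) {x : E} (hx : 0 ≤ x) : 0 ≤ T (T x) := by
  have key : ∀ S : E →ₗ[ℝ] E, IsBandPres S → (∀ x, 0 ≤ x → |S x| ≤ c x) →
      0 ≤ S (S x)⁺ := by
    intro S hS hSc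
    set p := (S x)⁺ with hp
    have hp0 : 0 ≤ p := posPart_nonneg _
    have h1 : |p| ⊓ |(S p)⁻| = 0 := by
      rw [abs_of_nonneg hp0, abs_of_nonneg (negPart_nonneg _)]
      exact posPart_inf_negPart_eq_zero_of_bandPres harch hS hc hSc hx hp0
    have h2 : (S p)⁻ = 0 := by
      refine eq_zero_of_nonneg_of_le_of_disjoint (negPart_nonneg _) (negPart_le_abs' _) ?_
      rw [abs_abs]
      exact hS _ _ h1
    exact negPart_eq_zero.1 h2
  have h1 := key T hT hTc
  have h2 := key (-T) (fun x y hxy => by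
    rw [LinearMap.neg_apply, abs_neg]; exact hT x y hxy) (fun x hx => by
    rw [LinearMap.neg_apply, abs_neg]; exact hTc x hx)
  rw [LinearMap.neg_apply, LinearMap.neg_apply, posPart_neg] at h2
  calc 0 ≤ T (T x)⁺ + -T (T x)⁻ := add_nonneg h1 h2
    _ = T (T x) := by rw [← sub_eq_add_neg, ← map_sub, posPart_sub_negPart]

end BandPreserving

section Archimedean

variable {E D O : Type*} [Lattice E] [AddCommGroup E] [IsOrderedAddMonoid E] [Module ℝ E]
  [PosSMulMono ℝ E] [Lattice D] [AddCommGroup D] [IsOrderedAddMonoid D] [Module ℝ D]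
  [PosSMulMono ℝ D] [Lattice O] [Ring O] [Module ℝ O]
  {P : D →ₗ[ℝ] E →ₗ[ℝ] ℝ} {ρ : O →ₗ[ℝ] E →ₗ[ℝ] E}

theorem IsOrderDual.eq_zero_of_forall_le_smul (h : IsOrderDual E D (fun f x => P f x))
    (hsep : SepPoints (fun f x => P f x)) (w z : E) (hw : 0 ≤ w)
    (hwz : ∀ δ : ℝ, 0 < δ → w ≤ δ • z) : w = 0 := by
  have hpos : ∀ f : D, 0 ≤ f → P f w = 0 := by
    intro f hf
    have hz : 0 ≤ z := by simpa using hw.trans (hwz 1 one_pos)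
    have hfz := h.apply_nonneg hf hz
    refine le_antisymm (le_of_forall_pos_le_add fun ε hε => ?_) (h.apply_nonneg hf hw)
    have h1 := h.mono_right hf (hwz (ε / (P f z + 1)) (by positivity))
    rw [map_smul, smul_eq_mul] at h1
    refine h1.trans ?_
    rw [zero_add, div_mul_eq_mul_div, div_le_iff₀ (by positivity)]
    nlinarith
  refine hsep w fun f => ?_
  have h1 : P f w = P f⁺ w - P f⁻ w := by
    rw [← LinearMap.sub_apply, ← map_sub, posPart_sub_negPart]
  change P f w = 0
  rw [h1, hpos _ (posPart_nonneg _), hpos _ (negPart_nonneg _), sub_zero]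

theorem IsOrthAlg.abs_apply_le (h : IsOrthAlg E O (fun a x => ρ a x)) (a : O) {x : E}
    (hx : 0 ≤ x) : |ρ a x| ≤ ρ |a| x := by
  refine sup_le ((h.le_iff _ _).1 (le_abs_self a) x hx) ?_
  simpa using (h.le_iff _ _).1 (neg_le_abs a) x hx

theorem IsOrthAlg.square_nonneg (h : IsOrthAlg E O (fun a x => ρ a x))
    (harch : ∀ w z : E, 0 ≤ w → (∀ δ : ℝ, 0 < δ → w ≤ δ • z) → w = 0) (b : O) (t : ℝ) :
    0 ≤ b * b + (2 * t) • b + t ^ 2 • (1 : O) := by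
  refine (h.le_iff _ _).2 fun x hx => ?_
  have h1 := apply_apply_nonneg_of_bandPres harch (h.ortho (b + t • 1)).2.2
    (h.ortho |b + t • 1|).2.2 (fun x hx => h.abs_apply_le _ hx) hx
  have hone : ∀ x, ρ 1 x = x := h.map_one
  have hmul : ρ (b * b) x = ρ b (ρ b x) := h.map_mul b b x
  simp only [map_add, map_smul, LinearMap.add_apply, LinearMap.smul_apply, hone, hmul, map_zero,
    LinearMap.zero_apply] at h1 ⊢
  refine h1.trans_eq ?_
  module

end Archimedean

section OrderContinuousDual

open Set Filter Topology

variable {O X B : Type*} [Lattice O] [AddCommGroup O] [IsOrderedAddMonoid O] [Module ℝ O]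
  [PosSMulMono ℝ O] [Lattice X] [AddCommGroup X] [IsOrderedAddMonoid X] [Module ℝ X]
  [PosSMulMono ℝ X] [Lattice B] [AddCommGroup B] [IsOrderedAddMonoid B] [Module ℝ B]
  {P : X →ₗ[ℝ] O →ₗ[ℝ] ℝ} {Q : B →ₗ[ℝ] X →ₗ[ℝ] ℝ}

namespace IsOrderContinuousDual

theorem apply_nonneg (hB : IsOrderContinuousDual X B (fun F φ => Q F φ)) {F : B} {φ : X}
    (hF : 0 ≤ F) (hφ : 0 ≤ φ) : 0 ≤ Q F φ := by
  simpa using (hB.le_iff 0 F).1 hF φ hφ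

theorem mono_right (hB : IsOrderContinuousDual X B (fun F φ => Q F φ)) {F : B} {φ χ : X}
    (hF : 0 ≤ F) (hφχ : φ ≤ χ) : Q F φ ≤ Q F χ := by
  have := hB.apply_nonneg hF (sub_nonneg.2 hφχ)
  rwa [map_sub, sub_nonneg] at this

theorem abs_apply_le_of_nonneg (hB : IsOrderContinuousDual X B (fun F φ => Q F φ)) (F : B)
    {φ : X} (hφ : 0 ≤ φ) : |Q F φ| ≤ Q |F| φ := by
  refine abs_le.2 ⟨?_, (hB.le_iff _ _).1 (le_abs_self F) φ hφ⟩
  have h1 : Q (-F) φ ≤ Q |F| φ := (hB.le_iff _ _).1 (neg_le_abs F) φ hφ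
  rw [map_neg, LinearMap.neg_apply] at h1
  linarith

theorem abs_apply_le_of_abs_le (hB : IsOrderContinuousDual X B (fun F φ => Q F φ)) (F : B)
    {φ χ : X} (hφχ : |φ| ≤ χ) : |Q F φ| ≤ Q |F| χ := by
  have h1 := abs_le.1 (hB.abs_apply_le_of_nonneg F (posPart_nonneg φ))
  have h2 := abs_le.1 (hB.abs_apply_le_of_nonneg F (negPart_nonneg φ))
  have h3 : Q F φ = Q F φ⁺ - Q F φ⁻ := by rw [← map_sub, posPart_sub_negPart]
  have h4 : Q |F| |φ| = Q |F| φ⁺ + Q |F| φ⁻ := by rw [← map_add, posPart_add_negPart]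
  have h5 := hB.mono_right (abs_nonneg F) hφχ
  rw [abs_le]
  constructor <;> linarith [h1.1, h1.2, h2.1, h2.2]

theorem exists_of_abs_le (hB : IsOrderContinuousDual X B (fun F φ => Q F φ)) {G : B}
    (hG : 0 ≤ G) (Φ : X →ₗ[ℝ] ℝ) (hΦ : ∀ φ, |Φ φ| ≤ Q G |φ|) : ∃ F : B, ∀ φ, Q F φ = Φ φ := by
  refine hB.surj Φ Φ.isLinear (fun a b => ⟨-Q G (|a| + |b|), Q G (|a| + |b|),
    fun x hax hxb => ?_⟩) fun s hs hdir hglb ε hε => ?_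
  · refine abs_le.1 ((hΦ x).trans (hB.mono_right hG (sup_le ?_ ?_)))
    · exact hxb.trans ((le_abs_self b).trans (le_add_of_nonneg_left (abs_nonneg a)))
    · exact (neg_le_neg hax).trans
        ((neg_le_abs a).trans (le_add_of_nonneg_right (abs_nonneg b)))
  · obtain ⟨x, hxs, hx⟩ := hB.cont G s hs hdir hglb ε hε
    refine ⟨x, hxs, fun y hys hyx => lt_of_le_of_lt ?_ (hx y hys hyx)⟩
    have h1 := hΦ y
    rw [abs_of_nonneg (hglb.1 hys)] at h1
    exact h1.trans (le_abs_self _)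

end IsOrderContinuousDual

theorem IsOrderDual.exists_eval (h : IsOrderDual O X (fun φ a => P φ a))
    (hB : IsOrderContinuousDual X B (fun F φ => Q F φ)) {e : O} (he : 0 ≤ e) :
    ∃ G : B, ∀ φ, Q G φ = P φ e := by
  refine hB.surj _ (P.flip e).isLinear (fun a b => ⟨P a e, P b e, fun x hax hxb =>
    ⟨h.mono_left hax he, h.mono_left hxb he⟩⟩) fun s hs hdir hglb ε hε => ?_
  have : Nonempty (s)ᵒᵈ := hs.to_subtype
  have : IsDirectedOrder (s)ᵒᵈ := ⟨fun a b => by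
    obtain ⟨c, hc, hca, hcb⟩ := hdir _ a.2 _ b.2
    exact ⟨OrderDual.toDual ⟨c, hc⟩, hca, hcb⟩⟩
  obtain ⟨ξ, hξ, hlim⟩ := h.exists_isLUB_of_directed
    (θ := fun i : (s)ᵒᵈ => -((OrderDual.ofDual i : s) : X))
    (fun i j hij => neg_le_neg hij) (u := 0)
    fun i => neg_nonpos.2 (hglb.1 (OrderDual.ofDual i).2)
  have hξ0 : ξ = 0 := by
    refine le_antisymm (hξ.2 ?_) (neg_nonpos.1 (hglb.2 fun y hy => ?_))
    · rintro _ ⟨i, rfl⟩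
      exact neg_nonpos.2 (hglb.1 (OrderDual.ofDual i).2)
    · exact neg_le.1 (hξ.1 ⟨OrderDual.toDual ⟨y, hy⟩, rfl⟩)
  have h0 := hlim e
  rw [hξ0, map_zero, LinearMap.zero_apply] at h0
  obtain ⟨i, hi⟩ := eventually_atTop.1 (h0.eventually (Metric.ball_mem_nhds 0 hε))
  refine ⟨_, (OrderDual.ofDual i).2, fun y hy hyi => ?_⟩
  simpa using hi (OrderDual.toDual ⟨y, hy⟩) hyi

theorem IsOrderDual.eq_zero_of_apply_eq_zero (h : IsOrderDual O X (fun φ a => P φ a)) {e : O}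
    (hsq : ∀ b : O, ∃ c : O, ∀ t : ℝ, 0 ≤ c + (2 * t) • b + t ^ 2 • e) {φ : X} (hφ : 0 ≤ φ)
    (hφe : P φ e = 0) : φ = 0 := by
  refine h.inj φ 0 fun b => ?_
  obtain ⟨c, hc⟩ := hsq b
  have key : ∀ t : ℝ, 0 ≤ P φ c + 2 * t * P φ b := fun t => by
    simpa [hφe] using h.apply_nonneg hφ (hc t)
  change P φ b = P 0 b
  rw [map_zero, LinearMap.zero_apply]
  by_contra hb
  have h1 := key (-(P φ c + 1) / (2 * P φ b))
  rw [show 2 * (-(P φ c + 1) / (2 * P φ b)) * P φ b = -(P φ c + 1) by field_simp] at h1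
  linarith

/-- On order intervals, order continuous functionals are absolutely continuous with respect to
the evaluation at a unit. -/
theorem IsOrderContinuousDual.exists_pos_forall_abs_lt
    (hB : IsOrderContinuousDual X B (fun F φ => Q F φ))
    (h : IsOrderDual O X (fun φ a => P φ a)) {e : O} (he : 0 ≤ e)
    (hsq : ∀ b : O, ∃ c : O, ∀ t : ℝ, 0 ≤ c + (2 * t) • b + t ^ 2 • e) (F : B) (ψ : X)
    {ε : ℝ} (hε : 0 < ε) :
    ∃ δ : ℝ, 0 < δ ∧ ∀ φ, |φ| ≤ ψ → P |φ| e < δ → |Q F φ| < ε := by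
  by_contra! hcon
  choose φ hφψ hφe hφF using fun n : ℕ => hcon ((1 / 2) ^ n) (by positivity)
  set a : ℕ → X := fun n => |φ n| with ha
  have ha0 : ∀ n, 0 ≤ a n := fun n => abs_nonneg _
  have haF : ∀ n, ε ≤ Q |F| (a n) := fun n =>
    (hφF n).trans (hB.abs_apply_le_of_abs_le F le_rfl)
  set s : Set X := {θ | ∃ n, ∀ k, n ≤ k → a k ≤ θ} with hs
  have hs0 : ∀ θ ∈ s, 0 ≤ θ := by
    rintro θ ⟨n, hn⟩
    exact (ha0 n).trans (hn n le_rfl)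
  have hdir : DirectedOn (· ≥ ·) s := by
    rintro θ₁ ⟨n₁, h₁⟩ θ₂ ⟨n₂, h₂⟩
    exact ⟨θ₁ ⊓ θ₂, ⟨max n₁ n₂, fun k hk => le_inf (h₁ k ((le_max_left _ _).trans hk))
      (h₂ k ((le_max_right _ _).trans hk))⟩, inf_le_left, inf_le_right⟩
  have hglb : IsGLB s 0 := by
    refine ⟨hs0, fun l hl => ?_⟩
    have hle : ∀ n : ℕ, P l⁺ e ≤ 2 * (1 / 2) ^ n := by
      intro n
      have hsum : ∀ j, partialSups (fun i => a (n + i)) j ≤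
          ∑ i ∈ Finset.range (j + 1), a (n + i) := by
        intro j
        refine partialSups_le _ _ _ fun i hi => ?_
        exact Finset.single_le_sum (f := fun i => a (n + i)) (fun i _ => ha0 _)
          (Finset.mem_range.2 (Nat.lt_succ_of_le hi))
      obtain ⟨ξ, hξ, hlim⟩ := h.exists_isLUB_of_directed
        (partialSups fun i => a (n + i)).monotone (u := ψ)
        fun j => partialSups_le _ _ _ fun i _ => hφψ (n + i)
      have hξs : ξ ∈ s := ⟨n, fun k hk => by
        obtain ⟨i, rfl⟩ := Nat.exists_eq_add_of_le hk
        exact (le_partialSups (fun i => a (n + i)) i).trans (hξ.1 ⟨i, rfl⟩)⟩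
      refine (h.mono_left (sup_le (hl hξs) (hs0 ξ hξs)) he).trans ?_
      refine le_of_tendsto (hlim e) (Eventually.of_forall fun j => ?_)
      refine (h.mono_left (hsum j) he).trans ?_
      rw [map_sum, LinearMap.sum_apply]
      calc ∑ i ∈ Finset.range (j + 1), P (a (n + i)) e
          ≤ ∑ i ∈ Finset.range (j + 1), (1 / 2 : ℝ) ^ n * (1 / 2) ^ i :=
            Finset.sum_le_sum fun i _ => by rw [← pow_add]; exact (hφe (n + i)).le
        _ = (∑ i ∈ Finset.range (j + 1), (1 / 2 : ℝ) ^ i) * (1 / 2) ^ n := by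
            rw [← Finset.mul_sum, mul_comm]
        _ ≤ 2 * (1 / 2) ^ n := by
            gcongr
            exact sum_geometric_two_le _
    have hlim : Tendsto (fun n : ℕ => 2 * (1 / 2 : ℝ) ^ n) atTop (𝓝 0) := by
      simpa using (tendsto_pow_atTop_nhds_zero_of_lt_one (r := (1 / 2 : ℝ)) (by norm_num)
        (by norm_num)).const_mul 2
    have hl0 := h.eq_zero_of_apply_eq_zero hsq (posPart_nonneg l)
      (le_antisymm (ge_of_tendsto' hlim hle) (h.apply_nonneg (posPart_nonneg l) he))
    exact posPart_eq_zero.1 hl0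
  obtain ⟨x, ⟨n, hn⟩, hx⟩ := hB.cont |F| s ⟨ψ, 0, fun k _ => hφψ k⟩ hdir hglb ε hε
  have h1 := hx x ⟨n, hn⟩ le_rfl
  have h2 := hB.mono_right (abs_nonneg F) (hn n le_rfl)
  exact absurd ((haF n).trans (h2.trans (le_abs_self _))) h1.not_ge

end OrderContinuousDual

section Center

variable {E Z : Type*} [Lattice E] [AddCommGroup E] [IsOrderedAddMonoid E] [Module ℝ E]
  [PosSMulMono ℝ E] [Lattice Z] [NormedRing Z] [NormedAlgebra ℝ Z] [IsOrderedAddMonoid Z]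
  [PosSMulMono ℝ Z] {R : Z →ₗ[ℝ] E →ₗ[ℝ] E}

namespace IsCenterOf

theorem apply_nonneg (h : IsCenterOf E Z (fun a x => R a x)) {a : Z} {x : E} (ha : 0 ≤ a)
    (hx : 0 ≤ x) : 0 ≤ R a x := by
  simpa using (h.le_iff 0 a).1 ha x hx

theorem one_apply (h : IsCenterOf E Z (fun a x => R a x)) (x : E) : R 1 x = x := h.map_one x

theorem mul_apply (h : IsCenterOf E Z (fun a x => R a x)) (a b : Z) (x : E) :
    R (a * b) x = R a (R b x) := h.map_mul a b x

theorem one_nonneg (h : IsCenterOf E Z (fun a x => R a x)) : (0 : Z) ≤ 1 :=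
  (h.le_iff 0 1).2 fun x hx => by simpa [h.one_apply] using hx

theorem mul_nonneg (h : IsCenterOf E Z (fun a x => R a x)) {a b : Z} (ha : 0 ≤ a)
    (hb : 0 ≤ b) : 0 ≤ a * b :=
  (h.le_iff 0 _).2 fun x hx => by
    simpa [h.mul_apply] using h.apply_nonneg ha (h.apply_nonneg hb hx)

theorem abs_le_norm_smul_one (h : IsCenterOf E Z (fun a x => R a x)) (a : Z) :
    |a| ≤ ‖a‖ • (1 : Z) := by
  have h1 := (h.norm_le_iff a ‖a‖ (norm_nonneg a)).1 le_rfl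
  refine sup_le ((h.le_iff _ _).2 fun x hx => ?_) ((h.le_iff _ _).2 fun x hx => ?_)
  · simpa [h.one_apply] using (h1 x hx).2
  · simpa [h.one_apply] using neg_le.1 (h1 x hx).1

theorem norm_le_one (h : IsCenterOf E Z (fun a x => R a x)) {a : Z} (h₁ : -1 ≤ a)
    (h₂ : a ≤ 1) : ‖a‖ ≤ 1 := by
  refine (h.norm_le_iff a 1 zero_le_one).2 fun x hx => ⟨?_, ?_⟩
  · simpa [h.one_apply] using (h.le_iff _ _).1 h₁ x hx
  · simpa [h.one_apply] using (h.le_iff _ _).1 h₂ x hx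

theorem mul_eq_zero_of_inf_eq_zero (h : IsCenterOf E Z (fun a x => R a x)) {u v : Z}
    (hu : 0 ≤ u) (hv : 0 ≤ v) (huv : u ⊓ v = 0) : u * v = 0 := by
  have h1 : u * v ≤ ‖u‖ • v := by
    have := h.mul_nonneg (sub_nonneg.2 ((le_abs_self u).trans (h.abs_le_norm_smul_one u))) hv
    rwa [sub_mul, sub_nonneg, smul_mul_assoc, one_mul] at this
  have h2 : u * v ≤ ‖v‖ • u := by
    have := h.mul_nonneg hu (sub_nonneg.2 ((le_abs_self v).trans (h.abs_le_norm_smul_one v)))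
    rwa [mul_sub, sub_nonneg, mul_smul_comm, mul_one] at this
  have h3 : |‖v‖ • u| ⊓ |‖u‖ • v| = 0 := by
    refine disjoint_abs_smul _ ?_
    rw [inf_comm]
    refine disjoint_abs_smul _ ?_
    rwa [inf_comm, abs_of_nonneg hu, abs_of_nonneg hv]
  rw [abs_of_nonneg (smul_nonneg (norm_nonneg v) hu),
    abs_of_nonneg (smul_nonneg (norm_nonneg u) hv)] at h3
  exact le_antisymm ((le_inf h2 h1).trans h3.le) (h.mul_nonneg hu hv)

theorem mul_self_eq (h : IsCenterOf E Z (fun a x => R a x)) (a : Z) :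
    a * a = a⁺ * a⁺ + a⁻ * a⁻ := by
  have h1 := h.mul_eq_zero_of_inf_eq_zero (posPart_nonneg a) (negPart_nonneg a)
    (posPart_inf_negPart_eq_zero a)
  have h2 := h.mul_eq_zero_of_inf_eq_zero (negPart_nonneg a) (posPart_nonneg a)
    (by rw [inf_comm]; exact posPart_inf_negPart_eq_zero a)
  calc a * a = (a⁺ - a⁻) * (a⁺ - a⁻) := by rw [posPart_sub_negPart]
    _ = a⁺ * a⁺ + a⁻ * a⁻ := by rw [sub_mul, mul_sub, mul_sub, h1, h2]; abel

theorem mul_self_nonneg (h : IsCenterOf E Z (fun a x => R a x)) (a : Z) : 0 ≤ a * a := by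
  rw [h.mul_self_eq]
  exact add_nonneg (h.mul_nonneg (posPart_nonneg a) (posPart_nonneg a))
    (h.mul_nonneg (negPart_nonneg a) (negPart_nonneg a))

/-- A Radon-Nikodym type approximation for positive functionals on the center, obtained by
minimizing `a ↦ ψ (a * a) - 2 φ a`. -/
theorem exists_approx (h : IsCenterOf E Z (fun a x => R a x)) (φ ψ : Z →ₗ[ℝ] ℝ)
    (hφ : ∀ a, 0 ≤ a → 0 ≤ φ a) (hφψ : ∀ a, 0 ≤ a → φ a ≤ ψ a) {ε : ℝ} (hε : 0 < ε) :
    ∃ a : Z, 0 ≤ a ∧ a ≤ 1 ∧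
      ∀ b, -1 ≤ b → b ≤ 1 → |ψ (a * b + b * a) / 2 - φ b| ≤ ε := by
  have hψ : ∀ a, 0 ≤ a → 0 ≤ ψ a := fun a ha => (hφ a ha).trans (hφψ a ha)
  set q : Z → ℝ := fun a => ψ (a * a) - 2 * φ a with hq
  have hbdd : BddBelow (Set.range q) := by
    refine ⟨-φ 1, ?_⟩
    rintro _ ⟨a, rfl⟩
    have h1 := hφ _ (h.mul_self_nonneg (a - 1))
    have h2 := hφψ _ (h.mul_self_nonneg a)
    rw [sub_mul, mul_sub, mul_sub, mul_one, one_mul, mul_one] at h1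
    simp only [map_sub] at h1
    simp only [hq]
    linarith
  obtain ⟨κ, hκ, hκε⟩ : ∃ κ : ℝ, 0 < κ ∧ κ * ψ 1 ≤ ε ^ 2 := by
    have := hψ 1 h.one_nonneg
    refine ⟨ε ^ 2 / (ψ 1 + 1), by positivity, ?_⟩
    rw [div_mul_eq_mul_div, div_le_iff₀ (by positivity)]
    nlinarith [sq_nonneg ε]
  obtain ⟨_, ⟨a, rfl⟩, ha⟩ :=
    exists_lt_of_csInf_lt (Set.range_nonempty q) (lt_add_of_pos_right (sInf (Set.range q)) hκ)
  have ha1 : q a⁺ ≤ q a := by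
    have h1 := hψ _ (h.mul_nonneg (negPart_nonneg a) (negPart_nonneg a))
    have h2 := hφ _ (negPart_nonneg a)
    have h3 : φ a = φ a⁺ - φ a⁻ := by rw [← map_sub, posPart_sub_negPart]
    simp only [hq]
    rw [h.mul_self_eq a, map_add, h3]
    linarith
  set p := a⁺ with hp
  have hp0 : 0 ≤ p := posPart_nonneg a
  set d := (p - 1)⁺ with hd
  set e := (p - 1)⁻ with he
  have hde : d * e = 0 := h.mul_eq_zero_of_inf_eq_zero (posPart_nonneg _) (negPart_nonneg _)
    (posPart_inf_negPart_eq_zero _)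
  have hed : e * d = 0 := h.mul_eq_zero_of_inf_eq_zero (negPart_nonneg _) (posPart_nonneg _)
    (by rw [inf_comm]; exact posPart_inf_negPart_eq_zero _)
  have hpde : p = (1 - e) + d := by
    have : d - e = p - 1 := posPart_sub_negPart _
    rw [eq_comm, sub_add_eq_add_sub, add_sub_assoc, this, add_sub_cancel]
  have ha2 : q (1 - e) ≤ q p := by
    have h1 := hψ _ (h.mul_nonneg (posPart_nonneg (p - 1)) (posPart_nonneg (p - 1)))
    have h2 := hφψ _ (posPart_nonneg (p - 1))
    have h3 : p * p = (1 - e) * (1 - e) + (2 : ℝ) • d + d * d := by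
      rw [two_smul]
      calc p * p = ((1 - e) + d) * ((1 - e) + d) := by rw [← hpde]
        _ = (1 - e) * (1 - e) + (d + d) + d * d - e * d - d * e := by noncomm_ring
        _ = _ := by rw [hde, hed, sub_zero, sub_zero]
    have h4 : φ p = φ (1 - e) + φ d := by rw [← map_add, ← hpde]
    simp only [hq]
    rw [h3, h4, map_add, map_add, map_smul, smul_eq_mul]
    linarith
  have he1 : e ≤ 1 := by
    refine sup_le ?_ h.one_nonneg
    rw [neg_sub]
    exact sub_le_self _ hp0
  refine ⟨1 - e, sub_nonneg.2 he1, sub_le_self _ (negPart_nonneg _), fun b hb1 hb2 => ?_⟩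
  set r := 1 - e
  have hbb : ψ (b * b) ≤ ψ 1 := by
    have h1 := hψ _ (h.mul_nonneg (sub_nonneg.2 hb2) (neg_le_iff_add_nonneg.1 hb1))
    have h2 : (1 - b) * (b + 1) = 1 - b * b := by noncomm_ring
    rwa [h2, map_sub, sub_nonneg] at h1
  have hvar : ∀ t : ℝ, 0 ≤ ψ 1 * (t * t) + (ψ (r * b + b * r) - 2 * φ b) * t + κ := by
    intro t
    have h1 : sInf (Set.range q) ≤ q (r + t • b) := csInf_le hbdd ⟨_, rfl⟩
    have h2 : q (r + t • b) =
        q r + (ψ (r * b + b * r) - 2 * φ b) * t + ψ (b * b) * (t * t) := by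
      simp only [hq, add_mul, mul_add, smul_mul_assoc, mul_smul_comm, map_add, map_smul,
        smul_eq_mul]
      ring
    have h3 := mul_le_mul_of_nonneg_right hbb (_root_.mul_self_nonneg t)
    linarith
  have hdisc := discrim_le_zero hvar
  rw [discrim] at hdisc
  refine abs_le_of_sq_le_sq ?_ hε.le
  nlinarith

end IsCenterOf

end Center

section Orthomorphism

variable {E D O X Z : Type*} [Lattice E] [AddCommGroup E] [IsOrderedAddMonoid E] [Module ℝ E]
  [PosSMulMono ℝ E] [Lattice D] [AddCommGroup D] [IsOrderedAddMonoid D] [Module ℝ D]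
  [PosSMulMono ℝ D] [Lattice O] [Ring O] [IsOrderedAddMonoid O] [Module ℝ O] [PosSMulMono ℝ O]
  [Lattice X] [AddCommGroup X] [IsOrderedAddMonoid X] [Module ℝ X] [PosSMulMono ℝ X]
  [Lattice Z] [NormedRing Z] [NormedAlgebra ℝ Z] [IsOrderedAddMonoid Z] [PosSMulMono ℝ Z]
  {P : D →ₗ[ℝ] E →ₗ[ℝ] ℝ} {ρ : O →ₗ[ℝ] E →ₗ[ℝ] E} {W : X →ₗ[ℝ] O →ₗ[ℝ] ℝ}
  {R : Z →ₗ[ℝ] E →ₗ[ℝ] E} {Ψ : E →ₗ[ℝ] D →ₗ[ℝ] X} {J : Z →ₗ[ℝ] O}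

namespace IsOrthAlg

theorem apply_nonneg (h : IsOrthAlg E O (fun a x => ρ a x)) {a : O} {x : E} (ha : 0 ≤ a)
    (hx : 0 ≤ x) : 0 ≤ ρ a x := by
  simpa using (h.le_iff 0 a).1 ha x hx

theorem one_apply (h : IsOrthAlg E O (fun a x => ρ a x)) (x : E) : ρ 1 x = x := h.map_one x

theorem mul_apply (h : IsOrthAlg E O (fun a x => ρ a x)) (a b : O) (x : E) :
    ρ (a * b) x = ρ a (ρ b x) := h.map_mul a b x

theorem one_nonneg (h : IsOrthAlg E O (fun a x => ρ a x)) : (0 : O) ≤ 1 :=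
  (h.le_iff 0 1).2 fun x hx => by simpa [h.one_apply] using hx

theorem ext (h : IsOrthAlg E O (fun a x => ρ a x)) {a b : O} (hab : ∀ x, ρ a x = ρ b x) :
    a = b := h.inj a b hab

theorem abs_apply_le_apply_abs (h : IsOrthAlg E O (fun a x => ρ a x)) {a : O} (ha : 0 ≤ a)
    (x : E) : |ρ a x| ≤ ρ a |x| := by
  have h1 := h.apply_nonneg ha (sub_nonneg.2 (le_abs_self x))
  have h2 := h.apply_nonneg ha (sub_nonneg.2 (neg_le_abs x))
  rw [map_sub, sub_nonneg] at h1 h2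
  rw [map_neg] at h2
  exact sup_le h1 h2

/-- The functionals `ψ_{x,f}`, bundled as a bilinear map. -/
theorem exists_bilinear (h : IsOrthAlg E O (fun a x => ρ a x))
    (hD : IsOrderDual E D (fun f x => P f x)) (hX : IsOrderDual O X (fun φ a => W φ a)) :
    ∃ Ψ : E →ₗ[ℝ] D →ₗ[ℝ] X, ∀ x f a, W (Ψ x f) a = P f (ρ a x) := by
  have hex : ∀ x f, ∃ ψ : X, ∀ a, W ψ a = P f (ρ a x) := fun x f =>
    hX.exists_of_le (P f ∘ₗ ρ.flip x) (P |f| ∘ₗ ρ.flip |x|)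
      (fun a ha => hD.apply_nonneg (abs_nonneg f) (h.apply_nonneg ha (abs_nonneg x)))
      fun a ha => (le_abs_self _).trans
        (hD.abs_apply_le_of_abs_le f (h.abs_apply_le_apply_abs ha x))
  choose ψ hψ using hex
  refine ⟨LinearMap.mk₂ ℝ ψ ?_ ?_ ?_ ?_, hψ⟩
  all_goals
    intros
    refine hX.inj _ _ fun a => ?_
    simp [hψ]

/-- The inclusion of the center into the algebra of orthomorphisms. -/
theorem exists_inclusion (h : IsOrthAlg E O (fun a x => ρ a x))
    (hZ : IsCenterOf E Z (fun a x => R a x)) :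
    ∃ J : Z →ₗ[ℝ] O, ∀ a x, ρ (J a) x = R a x := by
  choose J hJ using fun a : Z => h.surj (R a) (hZ.central a).1
  have hJ' : ∀ a x, ρ (J a) x = R a x := hJ
  refine ⟨{ toFun := J, map_add' := fun a b => ?_, map_smul' := fun c a => ?_ }, hJ⟩
  all_goals
    refine h.ext fun x => ?_
    simp [hJ']

theorem exists_eq_inclusion (h : IsOrthAlg E O (fun a x => ρ a x))
    (hZ : IsCenterOf E Z (fun a x => R a x)) (hJ : ∀ a x, ρ (J a) x = R a x) {b : O}
    (h₁ : -1 ≤ b) (h₂ : b ≤ 1) : ∃ b' : Z, -1 ≤ b' ∧ b' ≤ 1 ∧ J b' = b := by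
  have hb : ∀ x, 0 ≤ x → -((1 : ℝ) • x) ≤ ρ b x ∧ ρ b x ≤ (1 : ℝ) • x := fun x hx => by
    rw [one_smul]
    constructor
    · simpa [h.one_apply] using (h.le_iff _ _).1 h₁ x hx
    · simpa [h.one_apply] using (h.le_iff _ _).1 h₂ x hx
  obtain ⟨b', hb'⟩ := hZ.surj (ρ b) ⟨h.ortho b, 1, hb⟩
  have hb'' : ∀ x, R b' x = ρ b x := hb'
  refine ⟨b', (hZ.le_iff _ _).2 fun x hx => ?_, (hZ.le_iff _ _).2 fun x hx => ?_,
    h.ext fun x => (hJ b' x).trans (hb'' x)⟩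
  · simpa [hb'', hZ.one_apply] using (hb x hx).1
  · simpa [hb'', hZ.one_apply] using (hb x hx).2

theorem inclusion_nonneg (h : IsOrthAlg E O (fun a x => ρ a x))
    (hZ : IsCenterOf E Z (fun a x => R a x)) (hJ : ∀ a x, ρ (J a) x = R a x) {a : Z}
    (ha : 0 ≤ a) : 0 ≤ J a :=
  (h.le_iff _ _).2 fun x hx => by simpa [hJ] using hZ.apply_nonneg ha hx

theorem inclusion_one (h : IsOrthAlg E O (fun a x => ρ a x))
    (hZ : IsCenterOf E Z (fun a x => R a x)) (hJ : ∀ a x, ρ (J a) x = R a x) : J 1 = 1 :=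
  h.ext fun x => by rw [hJ, hZ.one_apply, h.one_apply]

theorem abs_inclusion_le (h : IsOrthAlg E O (fun a x => ρ a x))
    (hZ : IsCenterOf E Z (fun a x => R a x)) (hJ : ∀ a x, ρ (J a) x = R a x) (a : Z) :
    |J a| ≤ ‖a‖ • (1 : O) := by
  have h1 := abs_le'.1 (hZ.abs_le_norm_smul_one a)
  have h2 := h.inclusion_nonneg hZ hJ (sub_nonneg.2 h1.1)
  have h3 := h.inclusion_nonneg hZ hJ (sub_nonneg.2 h1.2)
  rw [map_sub, map_smul, h.inclusion_one hZ hJ, sub_nonneg] at h2 h3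
  rw [map_neg] at h3
  exact sup_le h2 h3

end IsOrthAlg

namespace IsOrderDual

theorem bilinear_nonneg (hX : IsOrderDual O X (fun φ a => W φ a))
    (hD : IsOrderDual E D (fun f x => P f x)) (hO : IsOrthAlg E O (fun a x => ρ a x))
    (hΨ : ∀ x f a, W (Ψ x f) a = P f (ρ a x)) {x : E} {f : D} (hx : 0 ≤ x) (hf : 0 ≤ f) :
    0 ≤ Ψ x f :=
  (hX.le_iff _ _).2 fun a ha => by
    simpa [hΨ] using hD.apply_nonneg hf (hO.apply_nonneg ha hx)

theorem abs_bilinear_le (hX : IsOrderDual O X (fun φ a => W φ a))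
    (hD : IsOrderDual E D (fun f x => P f x)) (hO : IsOrthAlg E O (fun a x => ρ a x))
    (hΨ : ∀ x f a, W (Ψ x f) a = P f (ρ a x)) (x : E) (f : D) : |Ψ x f| ≤ Ψ |x| |f| := by
  have key : ∀ a, 0 ≤ a → |W (Ψ x f) a| ≤ W (Ψ |x| |f|) a := fun a ha => by
    rw [hΨ, hΨ]
    exact hD.abs_apply_le_of_abs_le f (hO.abs_apply_le_apply_abs ha x)
  refine sup_le ((hX.le_iff _ _).2 fun a ha => (le_abs_self _).trans (key a ha))
    ((hX.le_iff _ _).2 fun a ha => ?_)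
  rw [map_neg, LinearMap.neg_apply]
  exact (neg_le_abs _).trans (key a ha)

/-- The restriction of functionals on the orthomorphisms to the center. -/
theorem exists_restrict (hX : IsOrderDual O X (fun φ a => W φ a))
    (hO : IsOrthAlg E O (fun a x => ρ a x)) (hZ : IsCenterOf E Z (fun a x => R a x))
    (hJ : ∀ a x, ρ (J a) x = R a x) :
    ∃ A : X →ₗ[ℝ] Z →L[ℝ] ℝ, (∀ φ a, A φ a = W φ (J a)) ∧ ∀ φ, W |φ| 1 ≤ ‖A φ‖ := by
  have hb : ∀ φ a, ‖(W φ ∘ₗ J) a‖ ≤ W |φ| 1 * ‖a‖ := fun φ a => by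
    have := hX.abs_apply_le_of_abs_le φ (hO.abs_inclusion_le hZ hJ a)
    rwa [map_smul, smul_eq_mul, mul_comm] at this
  refine ⟨{ toFun := fun φ => (W φ ∘ₗ J).mkContinuous _ (hb φ), map_add' := fun φ χ => ?_,
            map_smul' := fun c φ => ?_ }, fun φ a => rfl, fun φ => ?_⟩
  · ext a; simp
  · ext a; simp
  · refine hX.abs_apply_le_of_forall_le φ hO.one_nonneg fun b hb1 hb2 => ?_
    obtain ⟨b, h1, h2, rfl⟩ := hO.exists_eq_inclusion hZ hJ hb1 hb2
    refine (le_abs_self _).trans ((((W φ ∘ₗ J).mkContinuous _ (hb φ)).le_opNorm b).trans ?_)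
    exact mul_le_of_le_one_right (norm_nonneg _) (hZ.norm_le_one h1 h2)

end IsOrderDual

theorem exists_continuousLinearMap_factor {V N : Type*} [AddCommGroup V] [Module ℝ V]
    [NormedAddCommGroup N] [NormedSpace ℝ N] (A : V →ₗ[ℝ] N) (s : V →ₗ[ℝ] ℝ) (K : ℝ)
    (hs : ∀ v, |s v| ≤ K * ‖A v‖) : ∃ H : N →L[ℝ] ℝ, ∀ v, H (A v) = s v := by
  obtain ⟨σ, hσ⟩ := A.rangeRestrict.exists_rightInverse_of_surjective A.range_rangeRestrict
  have hσ' : ∀ x : LinearMap.range A, A (σ x) = x := fun x =>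
    congrArg Subtype.val (LinearMap.congr_fun hσ x)
  obtain ⟨H, hH, -⟩ := exists_extension_norm_eq (LinearMap.range A)
    ((s ∘ₗ σ).mkContinuous K fun x => (hs (σ x)).trans_eq (by rw [hσ']; rfl))
  refine ⟨H, fun v => ?_⟩
  have h1 : H (A v) = s (σ ⟨A v, v, rfl⟩) := hH ⟨A v, v, rfl⟩
  have h2 := hs (σ ⟨A v, v, rfl⟩ - v)
  rw [map_sub A, hσ', sub_self, norm_zero, mul_zero, map_sub] at h2
  rw [h1, ← sub_eq_zero]
  exact abs_nonpos_iff.1 h2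

end Orthomorphism

section Forward

variable {E D O X B Z : Type*} [Lattice E] [AddCommGroup E] [IsOrderedAddMonoid E]
  [Module ℝ E] [PosSMulMono ℝ E] [Lattice D] [AddCommGroup D] [IsOrderedAddMonoid D]
  [Module ℝ D] [PosSMulMono ℝ D] [Lattice O] [Ring O] [IsOrderedAddMonoid O] [Module ℝ O]
  [PosSMulMono ℝ O] [Lattice X] [AddCommGroup X] [IsOrderedAddMonoid X] [Module ℝ X]
  [PosSMulMono ℝ X] [Lattice B] [AddCommGroup B] [IsOrderedAddMonoid B] [Module ℝ B]
  [Lattice Z] [NormedRing Z] [NormedAlgebra ℝ Z] [IsOrderedAddMonoid Z] [PosSMulMono ℝ Z]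
  {P : D →ₗ[ℝ] E →ₗ[ℝ] ℝ} {ρ : O →ₗ[ℝ] E →ₗ[ℝ] E} {W : X →ₗ[ℝ] O →ₗ[ℝ] ℝ}
  {Q : B →ₗ[ℝ] X →ₗ[ℝ] ℝ} {R : Z →ₗ[ℝ] E →ₗ[ℝ] E} {Ψ : E →ₗ[ℝ] D →ₗ[ℝ] X} {J : Z →ₗ[ℝ] O}

theorem abs_sub_le_of_mem_Icc {u v w : X} (hu : 0 ≤ u) (huw : u ≤ w) (hv : 0 ≤ v)
    (hvw : v ≤ w) : |u - v| ≤ w := by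
  refine sup_le ((sub_le_self _ hv).trans huw) ?_
  rw [neg_sub]
  exact (sub_le_self _ hu).trans hvw

/-- Functionals below `ψ_{x,f}` are approximated by functionals `(ψ_{a x, f} + ψ_{x, f ∘ a}) / 2`
with `0 ≤ a ≤ 1` in the center. -/
theorem IsOrderDual.exists_bilinear_approx (hX : IsOrderDual O X (fun φ a => W φ a))
    (hD : IsOrderDual E D (fun f x => P f x)) (hO : IsOrthAlg E O (fun a x => ρ a x))
    (hZ : IsCenterOf E Z (fun a x => R a x)) (hJ : ∀ a x, ρ (J a) x = R a x)
    (hΨ : ∀ x f a, W (Ψ x f) a = P f (ρ a x)) {x : E} {f : D} (hx : 0 ≤ x) (hf : 0 ≤ f)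
    {φ : X} (hφ : 0 ≤ φ) (hφΨ : φ ≤ Ψ x f) {ε : ℝ} (hε : 0 < ε) :
    ∃ (y : E) (g : D), 0 ≤ y ∧ 0 ≤ g ∧ P g x = P f y ∧
      |φ - (2⁻¹ : ℝ) • (Ψ y f + Ψ x g)| ≤ Ψ x f ∧
      W |φ - (2⁻¹ : ℝ) • (Ψ y f + Ψ x g)| 1 ≤ ε := by
  have hJ0 : ∀ {a}, 0 ≤ a → 0 ≤ J a := fun ha => hO.inclusion_nonneg hZ hJ ha
  obtain ⟨a, ha0, ha1, ha⟩ := hZ.exists_approx (W φ ∘ₗ J) (W (Ψ x f) ∘ₗ J)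
    (fun a ha => hX.apply_nonneg hφ (hJ0 ha)) (fun a ha => hX.mono_left hφΨ (hJ0 ha)) hε
  have hale : ∀ z, 0 ≤ z → R a z ≤ z := fun z hz => by
    simpa [hZ.one_apply] using (hZ.le_iff a 1).1 ha1 z hz
  obtain ⟨g, hg0, hg⟩ := hD.exists_of_nonneg (P f ∘ₗ R a)
    fun z hz => hD.apply_nonneg hf (hZ.apply_nonneg ha0 hz)
  have hg' : ∀ z, P g z = P f (R a z) := hg
  have hy0 : 0 ≤ R a x := hZ.apply_nonneg ha0 hx
  set η := (2⁻¹ : ℝ) • (Ψ (R a x) f + Ψ x g) with hη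
  have hη0 : 0 ≤ η := smul_nonneg (by norm_num) (add_nonneg
    (hX.bilinear_nonneg hD hO hΨ hy0 hf) (hX.bilinear_nonneg hD hO hΨ hx hg0))
  have hWη : ∀ b, W η b = (P f (ρ b (R a x)) + P f (R a (ρ b x))) / 2 := fun b => by
    simp only [hη, map_smul, map_add, LinearMap.smul_apply, LinearMap.add_apply, hΨ, hg',
      smul_eq_mul]
    ring
  have hηΨ : η ≤ Ψ x f := (hX.le_iff _ _).2 fun b hb => by
    have h1 := hD.mono_right hf (sub_nonneg.1 (by
      simpa using hO.apply_nonneg hb (sub_nonneg.2 (hale x hx))))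
    have h2 := hD.mono_right hf (hale _ (hO.apply_nonneg hb hx))
    change W η b ≤ W (Ψ x f) b
    rw [hWη, hΨ]
    linarith
  refine ⟨R a x, g, hy0, hg0, hg' x, abs_sub_le_of_mem_Icc hφ hφΨ hη0 hηΨ, ?_⟩
  refine hX.abs_apply_le_of_forall_le _ hO.one_nonneg fun b hb1 hb2 => ?_
  obtain ⟨b, h1, h2, rfl⟩ := hO.exists_eq_inclusion hZ hJ hb1 hb2
  have h3 := (abs_le.1 (ha b h1 h2)).1
  simp only [LinearMap.comp_apply, hΨ, hJ, map_add, hZ.mul_apply] at h3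
  rw [map_sub, LinearMap.sub_apply, hWη, hJ, hJ]
  linarith

theorem IsOrderContinuousDual.abs_apply_le_of_le_bilinear
    (hB : IsOrderContinuousDual X B (fun F φ => Q F φ))
    (hX : IsOrderDual O X (fun φ a => W φ a))
    (hD : IsOrderDual E D (fun f x => P f x)) (hO : IsOrthAlg E O (fun a x => ρ a x))
    (hZ : IsCenterOf E Z (fun a x => R a x)) (hJ : ∀ a x, ρ (J a) x = R a x)
    (hΨ : ∀ x f a, W (Ψ x f) a = P f (ρ a x))
    (hsq : ∀ b : O, ∃ c : O, ∀ t : ℝ, 0 ≤ c + (2 * t) • b + t ^ 2 • (1 : O)) {F : B} {c : ℝ}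
    (hc : 0 ≤ c) (hF : ∀ x f, 0 ≤ x → 0 ≤ f → |Q F (Ψ x f)| ≤ c * P f x)
    {x : E} {f : D} (hx : 0 ≤ x) (hf : 0 ≤ f) {φ : X} (hφ : 0 ≤ φ) (hφΨ : φ ≤ Ψ x f) :
    |Q F φ| ≤ c * W φ 1 := by
  refine le_of_forall_pos_le_add fun ε hε => ?_
  obtain ⟨δ, hδ, hδF⟩ := hB.exists_pos_forall_abs_lt hX hO.one_nonneg hsq F (Ψ x f) (half_pos hε)
  set κ := min (δ / 2) (ε / (2 * (c + 1))) with hκ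
  have hκ0 : 0 < κ := lt_min (half_pos hδ) (by positivity)
  obtain ⟨y, g, hy, hg, hgx, hη, hη1⟩ :=
    hX.exists_bilinear_approx hD hO hZ hJ hΨ hx hf hφ hφΨ hκ0
  set η := (2⁻¹ : ℝ) • (Ψ y f + Ψ x g) with hηdef
  have h1 : |Q F (φ - η)| < ε / 2 :=
    hδF _ hη (hη1.trans_lt ((min_le_left _ _).trans_lt (half_lt_self hδ)))
  have h2 : |Q F η| ≤ c * W η 1 := by
    have h3 := hF y f hy hf
    have h4 := hF x g hx hg
    rw [hgx] at h4
    simp only [hηdef, map_smul, map_add, LinearMap.smul_apply, LinearMap.add_apply, hΨ,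
      hO.one_apply, smul_eq_mul, hgx, abs_mul]
    rw [abs_of_pos (by norm_num : (0 : ℝ) < 2⁻¹)]
    linarith [abs_add_le (Q F (Ψ y f)) (Q F (Ψ x g))]
  have h5 : W η 1 ≤ W φ 1 + κ := by
    have h6 := (abs_le.1 (hX.abs_apply_le_of_nonneg (φ - η) hO.one_nonneg)).1
    rw [map_sub, LinearMap.sub_apply] at h6
    linarith
  have h7 : c * κ ≤ ε / 2 := by
    have h8 : κ * (2 * (c + 1)) ≤ ε := (le_div_iff₀ (by positivity)).1 (min_le_right _ _)
    nlinarith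
  have h9 : Q F φ = Q F (φ - η) + Q F η := by rw [map_sub, sub_add_cancel]
  rw [h9]
  linarith [abs_add_le (Q F (φ - η)) (Q F η), mul_le_mul_of_nonneg_left h5 hc]

theorem IsOrderContinuousDual.abs_apply_le_of_mem_span
    (hB : IsOrderContinuousDual X B (fun F φ => Q F φ))
    (hX : IsOrderDual O X (fun φ a => W φ a))
    (hD : IsOrderDual E D (fun f x => P f x)) (hO : IsOrthAlg E O (fun a x => ρ a x))
    (hZ : IsCenterOf E Z (fun a x => R a x)) (hJ : ∀ a x, ρ (J a) x = R a x)
    (hΨ : ∀ x f a, W (Ψ x f) a = P f (ρ a x))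
    (hsq : ∀ b : O, ∃ c : O, ∀ t : ℝ, 0 ≤ c + (2 * t) • b + t ^ 2 • (1 : O)) {F : B} {c : ℝ}
    (hc : 0 ≤ c) (hF : ∀ x f, 0 ≤ x → 0 ≤ f → |Q F (Ψ x f)| ≤ c * P f x)
    {χ : X} (hχ : χ ∈ Submodule.span ℝ (Set.range fun q : E × D => Ψ q.1 q.2)) :
    |Q F χ| ≤ c * W |χ| 1 := by
  suffices H : ∀ φ, 0 ≤ φ → φ ≤ |χ| → |Q F φ| ≤ c * W φ 1 by
    have h1 := H _ (posPart_nonneg χ) (posPart_le_abs' χ)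
    have h2 := H _ (negPart_nonneg χ) (negPart_le_abs' χ)
    have h3 : Q F χ = Q F χ⁺ - Q F χ⁻ := by rw [← map_sub, posPart_sub_negPart]
    have h4 : W |χ| 1 = W χ⁺ 1 + W χ⁻ 1 := by
      rw [← LinearMap.add_apply, ← map_add, posPart_add_negPart]
    rw [h3, h4]
    linarith [abs_sub (Q F χ⁺) (Q F χ⁻)]
  have hgen : ∀ x f φ, 0 ≤ φ → φ ≤ |Ψ x f| → |Q F φ| ≤ c * W φ 1 := fun x f φ hφ hφΨ =>
    hB.abs_apply_le_of_le_bilinear hX hD hO hZ hJ hΨ hsq hc hF (abs_nonneg x) (abs_nonneg f) hφ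
      (hφΨ.trans (hX.abs_bilinear_le hD hO hΨ x f))
  induction hχ using Submodule.closure_induction with
  | zero =>
    intro φ hφ hφ0
    rw [le_antisymm (hφ0.trans_eq abs_zero) hφ]
    simp
  | add u v _ _ hu hv =>
    intro φ hφ hφuv
    obtain ⟨a, b, ha, hau, hb, hbv, rfl⟩ :=
      riesz_decomposition hφ (abs_nonneg u) (abs_nonneg v) (hφuv.trans (abs_add_le u v))
    have h1 := hu a ha hau
    have h2 := hv b hb hbv
    simp only [map_add, LinearMap.add_apply]
    linarith [abs_add_le (Q F a) (Q F b)]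
  | smul_mem r u hu =>
    obtain ⟨⟨x, f⟩, rfl⟩ := hu
    intro φ hφ hφu
    refine hgen (r • x) f φ hφ ?_
    rwa [map_smul, LinearMap.smul_apply]

theorem exists_bidual_of_range_isIdeal
    (hB : IsOrderContinuousDual X B (fun F φ => Q F φ))
    (hX : IsOrderDual O X (fun φ a => W φ a))
    (hD : IsOrderDual E D (fun f x => P f x)) (hO : IsOrthAlg E O (fun a x => ρ a x))
    (hZ : IsCenterOf E Z (fun a x => R a x)) (hJ : ∀ a x, ρ (J a) x = R a x)
    (hΨ : ∀ x f a, W (Ψ x f) a = P f (ρ a x))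
    (hsq : ∀ b : O, ∃ c : O, ∀ t : ℝ, 0 ≤ c + (2 * t) • b + t ^ 2 • (1 : O))
    {γ : B → D → D} (hγ : ∀ F f x, P (γ F f) x = Q F (Ψ x f))
    {m : ((Z →L[ℝ] ℝ) →L[ℝ] ℝ) → D → D}
    (hm : ∀ (H : (Z →L[ℝ] ℝ) →L[ℝ] ℝ) (f : D) (x : E) (μ : Z →L[ℝ] ℝ),
      (∀ T : Z, μ T = P f (R T x)) → P (m H f) x = H μ)
    (hsolid : ∀ S : D → D, IsOrtho S →
      (∃ F : B, ∀ f : D, 0 ≤ f → |S f| ≤ |γ F f|) → S ∈ Set.range γ)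
    {S : D → D} (hS : IsCentral S) :
    ∃ H : (Z →L[ℝ] ℝ) →L[ℝ] ℝ, ∀ f : D, m H f = S f := by
  obtain ⟨hSo, c, hc⟩ := hS
  have hc' : ∀ f, 0 ≤ f → |S f| ≤ |c| • f := fun f hf => by
    have h1 := real_smul_le_of_le (le_abs_self c) hf
    exact sup_le ((hc f hf).2.trans h1) ((neg_le.1 (hc f hf).1).trans h1)
  obtain ⟨G, hG⟩ := hX.exists_eval hB hO.one_nonneg
  have hγG : ∀ f, γ (|c| • G) f = |c| • f := fun f => by
    refine hD.inj _ _ fun x => ?_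
    rw [hγ, map_smul, LinearMap.smul_apply, hG, hΨ, hO.one_apply, map_smul, LinearMap.smul_apply]
  obtain ⟨F, rfl⟩ := hsolid S hSo ⟨|c| • G, fun f hf => by
    rw [hγG]
    exact (hc' f hf).trans (le_abs_self _)⟩
  have hF : ∀ x f, 0 ≤ x → 0 ≤ f → |Q F (Ψ x f)| ≤ |c| * P f x := fun x f hx hf => by
    rw [← hγ]
    refine (hD.abs_apply_le_of_nonneg _ hx).trans ((hD.mono_left (hc' f hf) hx).trans_eq ?_)
    simp
  obtain ⟨A, hA, hA1⟩ := hX.exists_restrict hO hZ hJ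
  set V := Submodule.span ℝ (Set.range fun q : E × D => Ψ q.1 q.2)
  obtain ⟨H, hH⟩ := exists_continuousLinearMap_factor (A ∘ₗ V.subtype) (Q F ∘ₗ V.subtype) |c|
    fun v => (hB.abs_apply_le_of_mem_span hX hD hO hZ hJ hΨ hsq (abs_nonneg c) hF v.2).trans
      (mul_le_mul_of_nonneg_left (hA1 v) (abs_nonneg c))
  refine ⟨H, fun f => hD.inj _ _ fun x => ?_⟩
  rw [hm H f x (A (Ψ x f)) fun T => by rw [hA, hΨ, hJ], hγ]
  exact hH ⟨Ψ x f, Submodule.subset_span ⟨(x, f), rfl⟩⟩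

end Forward

section Backward

variable {E D O X B Z : Type*} [Lattice E] [AddCommGroup E] [IsOrderedAddMonoid E]
  [Module ℝ E] [PosSMulMono ℝ E] [Lattice D] [AddCommGroup D] [IsOrderedAddMonoid D]
  [Module ℝ D] [PosSMulMono ℝ D] [Lattice O] [Ring O] [IsOrderedAddMonoid O] [Module ℝ O]
  [PosSMulMono ℝ O] [Lattice X] [AddCommGroup X] [IsOrderedAddMonoid X] [Module ℝ X]
  [PosSMulMono ℝ X] [Lattice B] [AddCommGroup B] [IsOrderedAddMonoid B] [Module ℝ B]
  [PosSMulMono ℝ B]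
  [Lattice Z] [NormedRing Z] [NormedAlgebra ℝ Z] [IsOrderedAddMonoid Z] [PosSMulMono ℝ Z]
  {P : D →ₗ[ℝ] E →ₗ[ℝ] ℝ} {ρ : O →ₗ[ℝ] E →ₗ[ℝ] E} {W : X →ₗ[ℝ] O →ₗ[ℝ] ℝ}
  {Q : B →ₗ[ℝ] X →ₗ[ℝ] ℝ} {R : Z →ₗ[ℝ] E →ₗ[ℝ] E} {Ψ : E →ₗ[ℝ] D →ₗ[ℝ] X} {J : Z →ₗ[ℝ] O}

theorem isCentral_of_abs_le (U : D →ₗ[ℝ] D) (hU : ∀ g, |U g| ≤ |g|) : IsCentral U := by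
  refine ⟨⟨U.isLinear, fun a b => ⟨-(|a| + |b|), |a| + |b|, fun x hax hxb => ?_⟩,
    fun x y hxy => disjoint_abs_of_abs_le hxy (hU x)⟩, 1, fun x hx => ?_⟩
  · have h1 : |x| ≤ |a| + |b| := sup_le
      (hxb.trans ((le_abs_self b).trans (le_add_of_nonneg_left (abs_nonneg a))))
      ((neg_le_neg hax).trans ((neg_le_abs a).trans (le_add_of_nonneg_right (abs_nonneg b))))
    have h2 := (hU x).trans h1
    exact ⟨neg_le.1 ((neg_le_abs _).trans h2), (le_abs_self _).trans h2⟩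
  · have h1 := hU x
    rw [abs_of_nonneg hx] at h1
    rw [one_smul]
    exact ⟨neg_le.1 ((neg_le_abs _).trans h1), (le_abs_self _).trans h1⟩

/-- The right action `(ψ ⬝ a)(b) = ψ (b a)` of the center on functionals on the
orthomorphisms. -/
theorem IsOrderDual.exists_centerAction (hX : IsOrderDual O X (fun φ a => W φ a))
    (hO : IsOrthAlg E O (fun a x => ρ a x)) (hZ : IsCenterOf E Z (fun a x => R a x))
    (hJ : ∀ a x, ρ (J a) x = R a x) :
    ∃ M : X →ₗ[ℝ] Z →ₗ[ℝ] X, (∀ ψ a b, W (M ψ a) b = W ψ (b * J a)) ∧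
      ∀ ψ a, |M ψ a| ≤ ‖a‖ • |ψ| := by
  have hmul_smul : ∀ (r : ℝ) (b c : O), b * (r • c) = r • (b * c) := fun r b c =>
    hO.ext fun x => by simp [hO.mul_apply]
  have hsmul_mul : ∀ (r : ℝ) (b c : O), (r • b) * c = r • (b * c) := fun r b c =>
    hO.ext fun x => by simp [hO.mul_apply]
  have hmul_nonneg : ∀ {b c : O}, 0 ≤ b → 0 ≤ c → 0 ≤ b * c := fun {b c} hb hc =>
    (hO.le_iff _ _).2 fun x hx => by
      simpa [hO.mul_apply] using hO.apply_nonneg hb (hO.apply_nonneg hc hx)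
  have habs : ∀ (a : Z) {b : O}, 0 ≤ b → |b * J a| ≤ ‖a‖ • b := by
    intro a b hb
    have h1 := abs_le'.1 (hO.abs_inclusion_le hZ hJ a)
    have h2 := hmul_nonneg hb (sub_nonneg.2 h1.1)
    have h3 := hmul_nonneg hb (sub_nonneg.2 h1.2)
    rw [mul_sub, hmul_smul, mul_one, sub_nonneg] at h2 h3
    rw [mul_neg] at h3
    exact sup_le h2 h3
  have hW : ∀ (ψ : X) (a : Z) {b : O}, 0 ≤ b → |W ψ (b * J a)| ≤ W (‖a‖ • |ψ|) b :=
    fun ψ a b hb => (hX.abs_apply_le_of_abs_le ψ (habs a hb)).trans_eq (by simp)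
  have hex : ∀ (ψ : X) (a : Z), ∃ χ : X, ∀ b, W χ b = W ψ (b * J a) := by
    intro ψ a
    let mulRight : O →ₗ[ℝ] O :=
      { toFun := fun b => b * J a
        map_add' := fun b c => add_mul b c _
        map_smul' := fun r b => hsmul_mul r b _ }
    exact hX.exists_of_le (W ψ ∘ₗ mulRight) (W (‖a‖ • |ψ|))
      (fun b hb => hX.apply_nonneg (smul_nonneg (norm_nonneg a) (abs_nonneg ψ)) hb)
      fun b hb => (le_abs_self _).trans (hW ψ a hb)
  choose μ hμ using hex
  refine ⟨LinearMap.mk₂ ℝ μ ?_ ?_ ?_ ?_, hμ, fun ψ a => ?_⟩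
  · exact fun ψ χ a => hX.inj _ _ fun b => by simp [hμ]
  · exact fun r ψ a => hX.inj _ _ fun b => by simp [hμ]
  · exact fun ψ a a' => hX.inj _ _ fun b => by simp [hμ, mul_add]
  · exact fun r ψ a => hX.inj _ _ fun b => by simp [hμ, hmul_smul]
  · rw [LinearMap.mk₂_apply]
    refine sup_le ((hX.le_iff _ _).2 fun b hb => ?_) ((hX.le_iff _ _).2 fun b hb => ?_)
    · rw [hμ]
      exact (le_abs_self _).trans (hW ψ a hb)
    · rw [map_neg, LinearMap.neg_apply, hμ]
      exact (neg_le_abs _).trans (hW ψ a hb)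

/-- The operator induced on `D` by a positive order continuous functional preserves
disjointness. -/
theorem IsOrderContinuousDual.inf_eq_zero_of_inf_eq_zero
    (hB : IsOrderContinuousDual X B (fun F φ => Q F φ))
    (hX : IsOrderDual O X (fun φ a => W φ a))
    (hD : IsOrderDual E D (fun f x => P f x)) (hO : IsOrthAlg E O (fun a x => ρ a x))
    (hΨ : ∀ x f a, W (Ψ x f) a = P f (ρ a x))
    (hsq : ∀ b : O, ∃ c : O, ∀ t : ℝ, 0 ≤ c + (2 * t) • b + t ^ 2 • (1 : O)) {G : B}
    (hG : 0 ≤ G) {T : D → D} (hT : ∀ f x, P (T f) x = Q G (Ψ x f)) {f g : D}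
    (hf : 0 ≤ f) (hg : 0 ≤ g) (hfg : f ⊓ g = 0) : T f ⊓ g = 0 := by
  have hTf : 0 ≤ T f := (hD.le_iff _ _).2 fun x hx => by
    simpa [hT] using hB.apply_nonneg hG (hX.bilinear_nonneg hD hO hΨ hx hf)
  refine le_antisymm ((hD.le_iff _ _).2 fun x hx => ?_) (le_inf hTf hg)
  rw [map_zero, LinearMap.zero_apply]
  refine le_of_forall_pos_le_add fun ε hε => ?_
  obtain ⟨δ, hδ, hδG⟩ := hB.exists_pos_forall_abs_lt hX hO.one_nonneg hsq G (Ψ x f) (half_pos hε)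
  obtain ⟨y, z, hy, hz, rfl, hyz⟩ := hD.exists_add_lt_inf f g hx (lt_min hδ (half_pos hε))
  rw [hfg, map_zero, LinearMap.zero_apply, zero_add] at hyz
  have h1 := hD.apply_nonneg hf hy
  have h2 := hD.apply_nonneg hg hz
  have hΨy : |Ψ y f| = Ψ y f := abs_of_nonneg (hX.bilinear_nonneg hD hO hΨ hy hf)
  have h3 : |Q G (Ψ y f)| < ε / 2 := by
    refine hδG _ ?_ ?_
    · rw [hΨy, map_add, LinearMap.add_apply]
      exact le_add_of_nonneg_right (hX.bilinear_nonneg hD hO hΨ hz hf)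
    · rw [hΨy, hΨ, hO.one_apply]
      linarith [min_le_left δ (ε / 2)]
  have h4 := hD.mono_left (inf_le_left : T f ⊓ g ≤ T f) hy
  have h5 := hD.mono_left (inf_le_right : T f ⊓ g ≤ g) hz
  rw [hT] at h4
  rw [map_add]
  linarith [le_abs_self (Q G (Ψ y f)), min_le_right δ (ε / 2)]

theorem mem_range_of_abs_le
    (hB : IsOrderContinuousDual X B (fun F φ => Q F φ))
    (hX : IsOrderDual O X (fun φ a => W φ a))
    (hD : IsOrderDual E D (fun f x => P f x)) (hO : IsOrthAlg E O (fun a x => ρ a x))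
    (hZ : IsCenterOf E Z (fun a x => R a x)) (hJ : ∀ a x, ρ (J a) x = R a x)
    (hΨ : ∀ x f a, W (Ψ x f) a = P f (ρ a x))
    (hsq : ∀ b : O, ∃ c : O, ∀ t : ℝ, 0 ≤ c + (2 * t) • b + t ^ 2 • (1 : O))
    {γ : B → D → D} (hγ : ∀ F f x, P (γ F f) x = Q F (Ψ x f))
    {m : ((Z →L[ℝ] ℝ) →L[ℝ] ℝ) → D → D}
    (hm : ∀ (H : (Z →L[ℝ] ℝ) →L[ℝ] ℝ) (f : D) (x : E) (μ : Z →L[ℝ] ℝ),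
      (∀ T : Z, μ T = P f (R T x)) → P (m H f) x = H μ)
    (hsurj : ∀ S : D → D, IsCentral S → ∃ H : (Z →L[ℝ] ℝ) →L[ℝ] ℝ, ∀ f : D, m H f = S f)
    (S : D →ₗ[ℝ] D) (F : B) (hSF : ∀ f : D, 0 ≤ f → |S f| ≤ |γ F f|) :
    ∃ F' : B, γ F' = S := by
  have hG : 0 ≤ |F| := abs_nonneg F
  obtain ⟨T, hT⟩ : ∃ T : D →ₗ[ℝ] D, ∀ f x, P (T f) x = Q |F| (Ψ x f) :=
    ⟨{ toFun := γ |F|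
       map_add' := fun f g => hD.inj _ _ fun x => by simp [hγ]
       map_smul' := fun c f => hD.inj _ _ fun x => by simp [hγ] }, hγ |F|⟩
  have hST : ∀ f, 0 ≤ f → |S f| ≤ T f := by
    intro f hf
    have key : ∀ x, 0 ≤ x → |P (γ F f) x| ≤ P (T f) x := fun x hx => by
      rw [hγ, hT]
      exact hB.abs_apply_le_of_nonneg F (hX.bilinear_nonneg hD hO hΨ hx hf)
    refine (hSF f hf).trans (sup_le ((hD.le_iff _ _).2 fun x hx => ?_)
      ((hD.le_iff _ _).2 fun x hx => ?_))
    · exact (le_abs_self _).trans (key x hx)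
    · rw [map_neg, LinearMap.neg_apply]
      exact (neg_le_abs _).trans (key x hx)
  have hT0 : ∀ f, 0 ≤ f → 0 ≤ T f := fun f hf => (abs_nonneg _).trans (hST f hf)
  have hSTabs : ∀ f, |S f| ≤ |T f| := by
    intro f
    have hf0 := posPart_nonneg f
    have hf1 := negPart_nonneg f
    have h1 : T f⁺ ⊓ f⁻ = 0 := hB.inf_eq_zero_of_inf_eq_zero hX hD hO hΨ hsq hG hT hf0 hf1
      (posPart_inf_negPart_eq_zero f)
    rw [inf_comm] at h1
    have h2 : T f⁻ ⊓ T f⁺ = 0 :=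
      hB.inf_eq_zero_of_inf_eq_zero hX hD hO hΨ hsq hG hT hf1 (hT0 _ hf0) h1
    have h3 : |T f| = T f⁻ + T f⁺ := by
      rw [← inf_add_sup, ← posPart_sub_negPart (f), map_sub, posPart_sub_negPart,
        ← sup_sub_inf_eq_abs_sub, h2, sub_zero, zero_add]
    calc |S f| = |S f⁺ - S f⁻| := by rw [← map_sub, posPart_sub_negPart]
      _ ≤ |S f⁺| + |S f⁻| := by
        rw [sub_eq_add_neg, ← abs_neg (S f⁻)]
        exact abs_add_le _ _
      _ ≤ T f⁺ + T f⁻ := add_le_add (hST _ hf0) (hST _ hf1)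
      _ = |T f| := by rw [h3, add_comm]
  obtain ⟨U, hU, hUT⟩ := exists_factor_of_abs_le (fun s hs hb => hD.exists_isLUB hs hb) T S hSTabs
  obtain ⟨H, hH⟩ := hsurj U (isCentral_of_abs_le U hU)
  obtain ⟨M, hM, hMabs⟩ := hX.exists_centerAction hO hZ hJ
  have hb : ∀ ψ a, ‖(Q |F| ∘ₗ M ψ) a‖ ≤ Q |F| |ψ| * ‖a‖ := fun ψ a => by
    have := hB.abs_apply_le_of_abs_le |F| (hMabs ψ a)
    rwa [abs_abs, map_smul, smul_eq_mul, mul_comm] at this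
  let L : X →ₗ[ℝ] Z →L[ℝ] ℝ :=
    { toFun := fun ψ => (Q |F| ∘ₗ M ψ).mkContinuous _ (hb ψ)
      map_add' := fun ψ χ => by ext a; simp
      map_smul' := fun c ψ => by ext a; simp }
  have hLapply : ∀ ψ a, L ψ a = Q |F| (M ψ a) := fun ψ a => rfl
  have hLnorm : ∀ ψ, ‖L ψ‖ ≤ Q |F| |ψ| := fun ψ =>
    LinearMap.mkContinuous_norm_le _ (hB.apply_nonneg hG (abs_nonneg ψ)) (hb ψ)
  obtain ⟨F', hF'⟩ := hB.exists_of_abs_le (G := ‖H‖ • |F|) (smul_nonneg (norm_nonneg H) hG)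
    ((H : (Z →L[ℝ] ℝ) →ₗ[ℝ] ℝ) ∘ₗ L) fun ψ => by
      rw [map_smul, LinearMap.smul_apply, smul_eq_mul]
      exact (H.le_opNorm (L ψ)).trans (mul_le_mul_of_nonneg_left (hLnorm ψ) (norm_nonneg H))
  refine ⟨F', funext fun f => hD.inj _ _ fun x => ?_⟩
  have hMΨ : ∀ a, M (Ψ x f) a = Ψ (R a x) f := fun a => hX.inj _ _ fun b => by
    simp [hM, hΨ, hO.mul_apply, hJ]
  have h1 := hm H (T f) x (L (Ψ x f)) fun a => by rw [hLapply, hMΨ, hT]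
  rw [hγ, hF', ← hUT, ← hH, h1]
  rfl

end Backward

theorem exists_bilinear_eq {V M N : Type*} [AddCommGroup V] [Module ℝ V] [AddCommGroup M]
    [Module ℝ M] [AddCommGroup N] [Module ℝ N] {p : V → M → N}
    (h₁ : ∀ v, IsLinearMap ℝ (p v)) (h₂ : ∀ x, IsLinearMap ℝ fun v => p v x) :
    ∃ P : V →ₗ[ℝ] M →ₗ[ℝ] N, (fun v x => P v x) = p :=
  ⟨LinearMap.mk₂ ℝ p (fun v w x => (h₂ x).map_add v w) (fun c v x => (h₂ x).map_smul c v)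
    (fun v => (h₁ v).map_add) (fun c v => (h₁ v).map_smul c), rfl⟩

/-- Corollary 2.  Let `E` be a Riesz space with point separating order
dual (realized as `D`).  Then the range `γ(((Orth E)^∼)ₙ^∼)` of the Arens homomorphism
`γ` is an order ideal in `Orth(E^∼)` (a subspace of `Orth(E^∼)` that is solid: the
lattice operations of orthomorphisms being pointwise on positive elements, solidity reads
via `|S f| ≤ |γ F f|` for all `0 ≤ f`) if and only if the Arens homomorphism
`m : Z(E)'' → Z(E^∼)` is surjective. -/
theorem statement6
    {E D Z O DO BO : Type*}
    [Lattice E] [AddCommGroup E] [Module ℝ E]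
    [CovariantClass E E (· + ·) (· ≤ ·)] [PosSMulMono ℝ E]
    [Lattice D] [AddCommGroup D] [Module ℝ D]
    [CovariantClass D D (· + ·) (· ≤ ·)] [PosSMulMono ℝ D]
    [Lattice Z] [NormedRing Z] [NormedAlgebra ℝ Z]
    [CovariantClass Z Z (· + ·) (· ≤ ·)] [PosSMulMono ℝ Z]
    [Lattice O] [Ring O] [Module ℝ O]
    [CovariantClass O O (· + ·) (· ≤ ·)] [PosSMulMono ℝ O]
    [Lattice DO] [AddCommGroup DO] [Module ℝ DO]
    [CovariantClass DO DO (· + ·) (· ≤ ·)] [PosSMulMono ℝ DO]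
    [Lattice BO] [AddCommGroup BO] [Module ℝ BO]
    [CovariantClass BO BO (· + ·) (· ≤ ·)] [PosSMulMono ℝ BO]
    (pE : D → E → ℝ) (hD : IsOrderDual E D pE) (hsep : SepPoints pE)
    (ρZ : Z → E → E) (hZ : IsCenterOf E Z ρZ)
    (ρO : O → E → E) (hO : IsOrthAlg E O ρO)
    (pO : DO → O → ℝ) (hDO : IsOrderDual O DO pO)
    (pB : BO → DO → ℝ) (hBO : IsOrderContinuousDual DO BO pB)
    -- the Arens homomorphism `γ : ((Orth E)^∼)ₙ^∼ → Orth(E^∼)`: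
    (γ : BO → D → D)
    (hγ : ∀ (F : BO) (f : D) (x : E) (ψ : DO),
      (∀ π : O, pO ψ π = pE f (ρO π x)) → pE (γ F f) x = pB F ψ)
    -- the Arens homomorphism `m : Z(E)'' → Z(E^∼)`:
    (m : ((Z →L[ℝ] ℝ) →L[ℝ] ℝ) → D → D)
    (hm : ∀ (F : (Z →L[ℝ] ℝ) →L[ℝ] ℝ) (f : D) (x : E) (μ : Z →L[ℝ] ℝ),
      (∀ T : Z, μ T = pE f (ρZ T x)) → pE (m F f) x = F μ) :
    -- `range γ` is an order ideal in `Orth(E^∼)` ↔ `m` is onto `Z(E^∼)`: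
    ((∀ S T : D → D, S ∈ Set.range γ → T ∈ Set.range γ → S + T ∈ Set.range γ) ∧
     (∀ (c : ℝ) (S : D → D), S ∈ Set.range γ → c • S ∈ Set.range γ) ∧
     (∀ S : D → D, IsOrtho S →
       (∃ F : BO, ∀ f : D, 0 ≤ f → |S f| ≤ |γ F f|) → S ∈ Set.range γ)) ↔
    (∀ S : D → D, IsCentral S → ∃ F : (Z →L[ℝ] ℝ) →L[ℝ] ℝ, ∀ f : D, m F f = S f) := by
  have : IsOrderedAddMonoid E := { add_le_add_left := fun _ _ h c => add_le_add_left h c }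
  have : IsOrderedAddMonoid D := { add_le_add_left := fun _ _ h c => add_le_add_left h c }
  have : IsOrderedAddMonoid Z := { add_le_add_left := fun _ _ h c => add_le_add_left h c }
  have : IsOrderedAddMonoid O := { add_le_add_left := fun _ _ h c => add_le_add_left h c }
  have : IsOrderedAddMonoid DO := { add_le_add_left := fun _ _ h c => add_le_add_left h c }
  have : IsOrderedAddMonoid BO := { add_le_add_left := fun _ _ h c => add_le_add_left h c }
  obtain ⟨P, rfl⟩ := exists_bilinear_eq hD.lin_fun hD.lin_vec
  obtain ⟨R, rfl⟩ := exists_bilinear_eq (fun a => (hZ.central a).1.1) hZ.lin_vec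
  obtain ⟨ρ, rfl⟩ := exists_bilinear_eq (fun a => (hO.ortho a).1) hO.lin_vec
  obtain ⟨W, rfl⟩ := exists_bilinear_eq hDO.lin_fun hDO.lin_vec
  obtain ⟨Q, rfl⟩ := exists_bilinear_eq hBO.lin_fun hBO.lin_vec
  have hsq : ∀ b : O, ∃ c : O, ∀ t : ℝ, 0 ≤ c + (2 * t) • b + t ^ 2 • (1 : O) := fun b =>
    ⟨b * b, hO.square_nonneg (hD.eq_zero_of_forall_le_smul hsep) b⟩
  obtain ⟨Ψ, hΨ⟩ := hO.exists_bilinear hD hDO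
  obtain ⟨J, hJ⟩ := hO.exists_inclusion hZ
  have hγΨ : ∀ F f x, P (γ F f) x = Q F (Ψ x f) := fun F f x => hγ F f x (Ψ x f) (hΨ x f)
  constructor
  · rintro ⟨-, -, hsolid⟩ S hS
    exact exists_bidual_of_range_isIdeal hBO hDO hD hO hZ hJ hΨ hsq hγΨ hm hsolid hS
  · intro hsurj
    refine ⟨?_, ?_, ?_⟩
    · rintro _ _ ⟨F, rfl⟩ ⟨G, rfl⟩
      exact ⟨F + G, funext fun f => hD.inj _ _ fun x => by simp [hγΨ]⟩
    · rintro c _ ⟨F, rfl⟩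
      exact ⟨c • F, funext fun f => hD.inj _ _ fun x => by simp [hγΨ]⟩
    · rintro S hS ⟨F, hSF⟩
      exact mem_range_of_abs_le hBO hDO hD hO hZ hJ hΨ hsq hγΨ hm hsurj (hS.1.mk' S) F hSF
end

section
/- Let E be a Riesz space with point separating order dual. Then E has a topologically full center (for each x∈E_+ the σ(E,E^~)-closure of Z(E)x contains the order ideal generated by x) if and only if the Arens homomorphism m : Z(E)'' → Z(E^~) is surjective. -/
open Filter Topology

/-- A real bilinear form on a pair of Riesz spaces which is nonnegative on positive vectors. -/
structure IsPosBilin {D E : Type*} [Lattice D] [AddCommGroup D] [Module ℝ D]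
    [Lattice E] [AddCommGroup E] [Module ℝ E] (β : D → E → ℝ) : Prop where
  lin_left : ∀ z, IsLinearMap ℝ fun f => β f z
  lin_right : ∀ f, IsLinearMap ℝ (β f)
  nonneg : ∀ f z, 0 ≤ f → 0 ≤ z → 0 ≤ β f z

section HahnBanach

/-- Hahn–Banach for the infimal gauge of a nonnegative convex cone in `E × ℝ`: some linear
functional below the gauge attains the value of the gauge at `y`. -/
theorem exists_linear_le_of_cone {E : Type*} [AddCommGroup E] [Module ℝ E] (G : E → ℝ → Prop)
    (hadd : ∀ x y r s, G x r → G y s → G (x + y) (r + s))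
    (hsmul : ∀ (c : ℝ) x r, 0 < c → G x r → G (c • x) (c * r))
    (hne : ∀ x, ∃ r, G x r) (hnn : ∀ x r, G x r → 0 ≤ r) (y : E) :
    ∃ w : E →ₗ[ℝ] ℝ, (∀ x r, G x r → w x ≤ r) ∧ ∀ ε > 0, ∃ r, G y r ∧ r < w y + ε := by
  set N : E → ℝ := fun x => sInf {r | G x r} with hN
  have hbdd : ∀ x, BddBelow {r | G x r} := fun x => ⟨0, fun r hr => hnn x r hr⟩
  have hNle : ∀ x r, G x r → N x ≤ r := fun x r h => csInf_le (hbdd x) h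
  have hleN : ∀ x c, (∀ r, G x r → c ≤ r) → c ≤ N x := fun x c h => le_csInf (hne x) h
  have hN0 : ∀ x, 0 ≤ N x := fun x => hleN x 0 (hnn x)
  have hhom' : ∀ c : ℝ, 0 < c → ∀ x, N (c • x) ≤ c * N x := by
    intro c hc x
    rw [← div_le_iff₀' hc]
    refine hleN _ _ fun r hr => ?_
    rw [div_le_iff₀' hc]
    exact hNle _ _ (hsmul c x r hc hr)
  have hhom : ∀ c : ℝ, 0 < c → ∀ x, N (c • x) = c * N x := by
    intro c hc x
    refine le_antisymm (hhom' c hc x) ?_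
    have := hhom' c⁻¹ (inv_pos.2 hc) (c • x)
    rw [inv_smul_smul₀ hc.ne', ← div_eq_inv_mul, le_div_iff₀' hc] at this
    exact this
  have hsub : ∀ x z, N (x + z) ≤ N x + N z := by
    intro x z
    have : N (x + z) - N z ≤ N x := hleN _ _ fun r hr => by
      have : N (x + z) - r ≤ N z := hleN _ _ fun s hs => by
        linarith [hNle _ _ (hadd x z r s hr hs)]
      linarith
    linarith
  have hNz : N 0 = 0 := by
    have := hhom 2 (by norm_num) 0
    rw [smul_zero] at this
    linarith
  obtain ⟨w, hw, hwN⟩ := exists_extension_of_le_sublinear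
    (LinearPMap.mkSpanSingleton' (σ := RingHom.id ℝ) y (N y) (by
      intro c hc
      rcases smul_eq_zero.1 hc with h | h
      · simp [h]
      · simp [h, hNz])) N hhom hsub (by
    rintro ⟨z, hz⟩
    obtain ⟨c, rfl⟩ := Submodule.mem_span_singleton.1 hz
    rw [LinearPMap.mkSpanSingleton'_apply]
    simp only [RingHom.id_apply, smul_eq_mul]
    rcases lt_trichotomy c 0 with h | h | h
    · exact (mul_nonpos_of_nonpos_of_nonneg h.le (hN0 y)).trans (hN0 _)
    · simp [h, hNz]
    · rw [hhom c h])
  refine ⟨w, fun x r h => (hwN x).trans (hNle x r h), fun ε hε => ?_⟩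
  have hwy : w y = N y := by
    exact (hw ⟨y, Submodule.mem_span_singleton_self y⟩).trans
      (LinearPMap.mkSpanSingleton'_apply_self (σ := RingHom.id ℝ) _ _ _ _)
  rw [hwy]
  exact exists_lt_of_csInf_lt (hne y) (by linarith : N y < N y + ε)

end HahnBanach

section Basic

variable {D E : Type*} [Lattice D] [AddCommGroup D] [Module ℝ D]
  [Lattice E] [AddCommGroup E] [Module ℝ E]

theorem IsOrderDual.isPosBilin {p : D → E → ℝ} (hD : IsOrderDual E D p) : IsPosBilin p where
  lin_left := hD.lin_vec
  lin_right := hD.lin_fun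
  nonneg f z hf hz := by
    have := (hD.le_iff 0 f).1 hf z hz
    rwa [show p 0 z = 0 from (hD.lin_vec z).map_zero] at this

theorem IsOrderDual.nonneg_iff {p : D → E → ℝ} (hD : IsOrderDual E D p) (f : D) :
    0 ≤ f ↔ ∀ x, 0 ≤ x → 0 ≤ p f x := by
  rw [hD.le_iff]
  refine forall₂_congr fun x _ => ?_
  rw [show p 0 x = 0 from (hD.lin_vec x).map_zero]

variable [AddLeftMono D] [AddLeftMono E]

theorem IsPosBilin.mono {β : D → E → ℝ} (hβ : IsPosBilin β) {f g : D} {z x : E}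
    (hf : 0 ≤ f) (hfg : f ≤ g) (hz : 0 ≤ z) (hzx : z ≤ x) : β f z ≤ β g x := by
  have h1 := hβ.nonneg (g - f) z (sub_nonneg.2 hfg) hz
  have h2 := hβ.nonneg g (x - z) (hf.trans hfg) (sub_nonneg.2 hzx)
  have h3 : β (g - f) z = β g z - β f z := (hβ.lin_left z).map_sub g f
  have h4 : β g (x - z) = β g x - β g z := (hβ.lin_right g).map_sub x z
  linarith

theorem IsPosBilin.abs_le {β : D → E → ℝ} (hβ : IsPosBilin β) {f g : D} {z x : E}
    (hfg : |f| ≤ g) (hzx : |z| ≤ x) : |β f z| ≤ β g x := by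
  refine le_trans ?_ (hβ.mono (abs_nonneg f) hfg (abs_nonneg z) hzx)
  have e1 : β f z = β f⁺ z - β f⁻ z := by
    conv_lhs => rw [← posPart_sub_negPart f]
    exact (hβ.lin_left z).map_sub _ _
  have e2 : ∀ h, β h z = β h z⁺ - β h z⁻ := fun h => by
    conv_lhs => rw [← posPart_sub_negPart z]
    exact (hβ.lin_right h).map_sub _ _
  have e3 : β |f| |z| = β f⁺ |z| + β f⁻ |z| := by
    conv_lhs => rw [← posPart_add_negPart f]
    exact (hβ.lin_left _).map_add _ _
  have e4 : ∀ h, β h |z| = β h z⁺ + β h z⁻ := fun h => by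
    conv_lhs => rw [← posPart_add_negPart z]
    exact (hβ.lin_right h).map_add _ _
  have n1 := hβ.nonneg f⁺ z⁺ (posPart_nonneg f) (posPart_nonneg z)
  have n2 := hβ.nonneg f⁺ z⁻ (posPart_nonneg f) (negPart_nonneg z)
  have n3 := hβ.nonneg f⁻ z⁺ (negPart_nonneg f) (posPart_nonneg z)
  have n4 := hβ.nonneg f⁻ z⁻ (negPart_nonneg f) (negPart_nonneg z)
  rw [e1, e2, e2, e3, e4, e4, _root_.abs_le]
  constructor <;> linarith

omit [Module ℝ E] in
/-- A functional dominated by a monotone function of the absolute value is order bounded. -/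
theorem isOrdBdd_of_abs_le {φ h : E → ℝ} (hmono : ∀ x y, x ≤ y → h x ≤ h y)
    (hφ : ∀ z, |φ z| ≤ h |z|) : IsOrdBdd φ := by
  intro a b
  refine ⟨-h (|a| ⊔ |b|), h (|a| ⊔ |b|), fun x hax hxb => abs_le.1 ((hφ x).trans (hmono _ _ ?_))⟩
  refine abs_le'.2 ⟨(hxb.trans (le_abs_self b)).trans le_sup_right, ?_⟩
  exact ((neg_le_neg_iff.2 hax).trans (neg_le_abs a)).trans le_sup_left

omit [AddLeftMono D] in
theorem IsOrderDual.exists_of_abs_le {p : D → E → ℝ} (hD : IsOrderDual E D p) {φ : E → ℝ}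
    (hlin : IsLinearMap ℝ φ) {g : D} (hg : 0 ≤ g) (hφ : ∀ z, |φ z| ≤ p g |z|) :
    ∃ f, ∀ z, p f z = φ z := by
  refine hD.surj φ hlin (isOrdBdd_of_abs_le (h := p g) (fun x y hxy => ?_) hφ)
  have := hD.isPosBilin.nonneg g (y - x) hg (sub_nonneg.2 hxy)
  rw [(hD.lin_fun g).map_sub] at this
  linarith

/-- A Riesz space with point separating order dual is Archimedean. -/
theorem eq_zero_of_forall_nsmul_le {p : D → E → ℝ} (hD : IsOrderDual E D p) (hsep : SepPoints p)
    {z x : E} (hz : 0 ≤ z) (h : ∀ n : ℕ, (n : ℝ) • z ≤ x) : z = 0 := by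
  have key : ∀ f : D, 0 ≤ f → p f z = 0 := by
    intro f hf
    refine le_antisymm ?_ (hD.isPosBilin.nonneg f z hf hz)
    by_contra! hpos
    obtain ⟨n, hn⟩ := exists_nat_gt (p f x / p f z)
    rw [div_lt_iff₀ hpos] at hn
    have := hD.isPosBilin.nonneg f (x - (n : ℝ) • z) hf (sub_nonneg.2 (h n))
    rw [(hD.lin_fun f).map_sub, (hD.lin_fun f).map_smul, smul_eq_mul] at this
    linarith
  refine hsep z fun f => ?_
  have := hD.isPosBilin.abs_le (le_refl |f|) (le_refl |z|)
  rw [abs_of_nonneg hz, key _ (abs_nonneg f)] at this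
  exact abs_nonpos_iff.1 this

/-- The infimum formula: if `u` and `v` are disjoint positive functionals, every positive `x`
splits as `x = (x - y) + y` with `u (x - y) + v y` arbitrarily small. -/
theorem IsOrderDual.exists_split {p : D → E → ℝ} (hD : IsOrderDual E D p) {u v : D}
    (hu : 0 ≤ u) (hv : 0 ≤ v) (huv : ∀ w, 0 ≤ w → w ≤ u → w ≤ v → w = 0) {x : E} (hx : 0 ≤ x)
    {ε : ℝ} (hε : 0 < ε) [PosSMulMono ℝ E] :
    ∃ y, 0 ≤ y ∧ y ≤ x ∧ p u (x - y) + p v y < ε := by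
  have hP := hD.isPosBilin
  obtain ⟨w, hw, hwx⟩ := exists_linear_le_of_cone
    (fun z r => ∃ a b : E, 0 ≤ a ∧ 0 ≤ b ∧ z ≤ a + b ∧ r = p u a + p v b)
    (by
      rintro z z' r s ⟨a, b, ha, hb, hz, rfl⟩ ⟨a', b', ha', hb', hz', rfl⟩
      refine ⟨a + a', b + b', add_nonneg ha ha', add_nonneg hb hb', ?_, ?_⟩
      · calc z + z' ≤ (a + b) + (a' + b') := add_le_add hz hz'
          _ = _ := by abel
      · rw [(hD.lin_fun u).map_add, (hD.lin_fun v).map_add]; ring)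
    (by
      rintro c z r hc ⟨a, b, ha, hb, hz, rfl⟩
      refine ⟨c • a, c • b, smul_nonneg hc.le ha, smul_nonneg hc.le hb, ?_, ?_⟩
      · rw [← smul_add]; exact smul_le_smul_of_nonneg_left hz hc.le
      · rw [(hD.lin_fun u).map_smul, (hD.lin_fun v).map_smul, smul_eq_mul, smul_eq_mul]; ring)
    (fun z => ⟨_, |z|, 0, abs_nonneg z, le_rfl, by rw [add_zero]; exact le_abs_self z, rfl⟩)
    (by
      rintro z r ⟨a, b, ha, hb, -, rfl⟩
      exact add_nonneg (hP.nonneg u a hu ha) (hP.nonneg v b hv hb)) x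
  have hu0 : p u 0 = 0 := (hD.lin_fun u).map_zero
  have hv0 : p v 0 = 0 := (hD.lin_fun v).map_zero
  have hwu : ∀ z, 0 ≤ z → w z ≤ p u z := fun z hz =>
    hw z _ ⟨z, 0, hz, le_rfl, by rw [add_zero], by rw [hv0, add_zero]⟩
  have hwv : ∀ z, 0 ≤ z → w z ≤ p v z := fun z hz =>
    hw z _ ⟨0, z, le_rfl, hz, by rw [zero_add], by rw [hu0, zero_add]⟩
  have hw0 : ∀ z, 0 ≤ z → 0 ≤ w z := fun z hz => by
    have := hw (-z) 0 ⟨0, 0, le_rfl, le_rfl, by rw [add_zero]; exact neg_nonpos.2 hz,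
      by rw [hu0, hv0, add_zero]⟩
    rw [map_neg] at this
    linarith
  obtain ⟨f, hf⟩ := hD.exists_of_abs_le (φ := w) w.isLinear hu (fun z => by
    have e : w z = w z⁺ - w z⁻ := by rw [← map_sub, posPart_sub_negPart]
    have e' : p u |z| = p u z⁺ + p u z⁻ := by
      rw [← (hD.lin_fun u).map_add, posPart_add_negPart]
    have h1 := hwu _ (posPart_nonneg z)
    have h2 := hwu _ (negPart_nonneg z)
    have h3 := hw0 _ (posPart_nonneg z)
    have h4 := hw0 _ (negPart_nonneg z)
    rw [e, e', abs_le]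
    constructor <;> linarith)
  have hf0 : f = 0 := huv f ((hD.nonneg_iff f).2 fun z hz => by rw [hf]; exact hw0 z hz)
    ((hD.le_iff _ _).2 fun z hz => by rw [hf]; exact hwu z hz)
    ((hD.le_iff _ _).2 fun z hz => by rw [hf]; exact hwv z hz)
  have hwx0 : w x = 0 := by
    rw [← hf, hf0]
    exact (hD.lin_vec x).map_zero
  obtain ⟨r, ⟨a, b, ha, hb, hxab, rfl⟩, hr⟩ := hwx ε hε
  rw [hwx0, zero_add] at hr
  have hxa : x - x ⊓ b ≤ a := by
    rw [sub_le_iff_le_add, add_comm, ← sub_le_iff_le_add]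
    exact le_inf (sub_le_self _ ha) (by rwa [sub_le_iff_le_add, add_comm])
  refine ⟨x ⊓ b, le_inf hx hb, inf_le_left, lt_of_le_of_lt (add_le_add ?_ ?_) hr⟩
  · exact hP.mono hu le_rfl (sub_nonneg.2 inf_le_left) hxa
  · exact hP.mono hv le_rfl (le_inf hx hb) inf_le_right

end Basic

section Center

variable {E Z : Type*} [Lattice E] [AddCommGroup E] [Module ℝ E]
  [Lattice Z] [NormedRing Z] [NormedAlgebra ℝ Z] {ρ : Z → E → E}

namespace IsCenterOf

theorem isLinearMap (hZ : IsCenterOf E Z ρ) (T : Z) : IsLinearMap ℝ (ρ T) := (hZ.central T).1.1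

theorem nonneg_iff (hZ : IsCenterOf E Z ρ) (T : Z) : 0 ≤ T ↔ ∀ x, 0 ≤ x → 0 ≤ ρ T x := by
  rw [hZ.le_iff]
  refine forall₂_congr fun x _ => ?_
  rw [show ρ 0 x = 0 from (hZ.lin_vec x).map_zero]

theorem zero_le_one (hZ : IsCenterOf E Z ρ) : (0 : Z) ≤ 1 :=
  (hZ.nonneg_iff 1).2 fun x hx => by rwa [hZ.map_one]

theorem apply_le (hZ : IsCenterOf E Z ρ) (T : Z) {x : E} (hx : 0 ≤ x) : ρ T x ≤ ‖T‖ • x :=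
  ((hZ.norm_le_iff T ‖T‖ (norm_nonneg T)).1 le_rfl x hx).2

variable [AddLeftMono E]

theorem abs_apply_le (hZ : IsCenterOf E Z ρ) (T : Z) (x : E) : |ρ T x| ≤ ‖T‖ • |x| := by
  have hb := fun y hy => (hZ.norm_le_iff T ‖T‖ (norm_nonneg T)).1 le_rfl y hy
  have e : ρ T x = ρ T x⁺ - ρ T x⁻ := by
    rw [← (hZ.isLinearMap T).map_sub, posPart_sub_negPart]
  rw [← posPart_add_negPart x, smul_add, e]
  have h1 := hb _ (posPart_nonneg x)
  have h2 := hb _ (negPart_nonneg x)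
  refine abs_le'.2 ⟨?_, ?_⟩
  · rw [sub_eq_add_neg]
    exact add_le_add h1.2 (neg_le.1 h2.1)
  · rw [neg_sub, sub_eq_neg_add]
    exact add_le_add (neg_le.1 h1.1) h2.2

theorem apply_mono (hZ : IsCenterOf E Z ρ) {T : Z} (hT : 0 ≤ T) {x y : E} (h : x ≤ y) :
    ρ T x ≤ ρ T y := by
  have := (hZ.nonneg_iff T).1 hT (y - x) (sub_nonneg.2 h)
  rwa [(hZ.isLinearMap T).map_sub, sub_nonneg] at this

variable {D : Type*} [Lattice D] [AddCommGroup D] [Module ℝ D] [AddLeftMono D]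
  {p : D → E → ℝ} [PosSMulMono ℝ E]

/-- The kernel of a positive central operator is disjoint from its range. -/
theorem eq_zero_of_le_apply (hZ : IsCenterOf E Z ρ) (hD : IsOrderDual E D p) (hsep : SepPoints p)
    {A : Z} (hA : 0 ≤ A) {x z : E} (hx : 0 ≤ x) (hz : 0 ≤ z) (hAz : ρ A z = 0)
    (hzx : z ≤ ρ A x) : z = 0 := by
  refine eq_zero_of_forall_nsmul_le hD hsep hz (x := x) fun n => ?_
  have hn : (0 : ℝ) ≤ n := n.cast_nonneg
  have hnz : 0 ≤ (n : ℝ) • z := smul_nonneg hn hz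
  have h0 : ρ A (x ⊓ (n : ℝ) • z) = 0 := by
    refine le_antisymm ?_ ((hZ.nonneg_iff A).1 hA _ (le_inf hx hnz))
    refine (hZ.apply_mono hA inf_le_right).trans ?_
    rw [(hZ.isLinearMap A).map_smul, hAz, smul_zero]
  have h1 : z ≤ ‖A‖ • (x - x ⊓ (n : ℝ) • z) := by
    refine hzx.trans (le_trans (le_of_eq ?_) (hZ.apply_le A (sub_nonneg.2 inf_le_left)))
    rw [(hZ.isLinearMap A).map_sub, h0, sub_zero]
  set s := x - x ⊓ (n : ℝ) • z with hs
  set t := (n : ℝ) • z - x ⊓ (n : ℝ) • z with ht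
  have hs0 : 0 ≤ s := sub_nonneg.2 inf_le_left
  have ht0 : 0 ≤ t := sub_nonneg.2 inf_le_right
  have hst : s ⊓ t = 0 := by rw [hs, ht, ← inf_sub, sub_self]
  set C : ℝ := n * ‖A‖ + 1 with hC
  have hC0 : 0 < C := by positivity
  have hts : t ≤ C • s := by
    calc t ≤ (n : ℝ) • z := sub_le_self _ (le_inf hx hnz)
      _ ≤ (n : ℝ) • ‖A‖ • s := smul_le_smul_of_nonneg_left h1 hn
      _ ≤ (n : ℝ) • ‖A‖ • s + s := le_add_of_nonneg_right hs0
      _ = C • s := by rw [hC, add_smul, mul_smul, one_smul]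
  have htt : t ≤ C • t := by
    rw [hC, add_smul, one_smul]
    exact le_add_of_nonneg_left (smul_nonneg (by positivity) ht0)
  have h2 : C⁻¹ • t ≤ 0 := by
    rw [← hst]
    refine le_inf ?_ ?_
    · have := smul_le_smul_of_nonneg_left hts (inv_pos.2 hC0).le
      rwa [inv_smul_smul₀ hC0.ne'] at this
    · have := smul_le_smul_of_nonneg_left htt (inv_pos.2 hC0).le
      rwa [inv_smul_smul₀ hC0.ne'] at this
  have h3 : t ≤ 0 := by
    have := smul_le_smul_of_nonneg_left h2 hC0.le
    rwa [smul_inv_smul₀ hC0.ne', smul_zero] at this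
  exact (sub_nonpos.1 h3).trans inf_le_left

variable [AddLeftMono Z]

/-- The positive and negative parts of a central operator compose to zero. -/
theorem posPart_negPart_apply (hZ : IsCenterOf E Z ρ) (T : Z) {x : E} (hx : 0 ≤ x) :
    ρ T⁺ (ρ T⁻ x) = 0 := by
  set C : ℝ := ‖T⁺‖ + ‖T⁻‖ + 1 with hC
  have hC0 : 0 < C := by positivity
  have hp := posPart_nonneg T
  have hn := negPart_nonneg T
  have happ := fun y hy => (hZ.nonneg_iff _).1 hp y hy
  have hann := fun y hy => (hZ.nonneg_iff _).1 hn y hy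
  have hsm : ∀ (c : ℝ) (S : Z) (y : E), ρ (c • S) y = c • ρ S y := fun c S y =>
    (hZ.lin_vec y).map_smul c S
  have hbig : ∀ {c : ℝ} {y : E}, c ≤ C → 0 ≤ y → c • y ≤ C • y := fun {c y} hc hy => by
    rw [← sub_nonneg, ← sub_smul]
    exact smul_nonneg (sub_nonneg.2 hc) hy
  have hinv : ∀ {a b : E}, a ≤ C • b → C⁻¹ • a ≤ b := fun {a b} h => by
    have := smul_le_smul_of_nonneg_left h (inv_pos.2 hC0).le
    rwa [inv_smul_smul₀ hC0.ne'] at this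
  have hle : C⁻¹ • (T⁺ * T⁻) ≤ 0 := by
    rw [← posPart_inf_negPart_eq_zero T]
    refine le_inf ((hZ.le_iff _ _).2 fun y hy => ?_) ((hZ.le_iff _ _).2 fun y hy => ?_)
    · rw [hsm, hZ.map_mul]
      refine hinv (((hZ.apply_mono hp (hZ.apply_le T⁻ hy)).trans_eq
        ((hZ.isLinearMap _).map_smul _ _)).trans (hbig ?_ (happ y hy)))
      linarith [norm_nonneg T⁺]
    · rw [hsm, hZ.map_mul]
      refine hinv ((hZ.apply_le T⁺ (hann y hy)).trans (hbig ?_ (hann y hy)))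
      linarith [norm_nonneg T⁻]
  have := (hZ.le_iff _ _).1 hle x hx
  rw [hsm, hZ.map_mul, show ρ 0 x = 0 from (hZ.lin_vec x).map_zero] at this
  refine le_antisymm ?_ (happ _ (hann x hx))
  have := smul_le_smul_of_nonneg_left this hC0.le
  rwa [smul_inv_smul₀ hC0.ne', smul_zero] at this

theorem posPart_apply (hZ : IsCenterOf E Z ρ) (hD : IsOrderDual E D p) (hsep : SepPoints p)
    (T : Z) {x : E} (hx : 0 ≤ x) : ρ T⁺ x = (ρ T x)⁺ := by
  have hp := (hZ.nonneg_iff _).1 (posPart_nonneg T)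
  have hn := (hZ.nonneg_iff _).1 (negPart_nonneg T)
  have hinf0 : 0 ≤ ρ T⁺ x ⊓ ρ T⁻ x := le_inf (hp x hx) (hn x hx)
  have hinf : ρ T⁺ x ⊓ ρ T⁻ x = 0 := by
    refine hZ.eq_zero_of_le_apply hD hsep (posPart_nonneg T) hx hinf0 ?_ inf_le_left
    exact le_antisymm ((hZ.apply_mono (posPart_nonneg T) inf_le_right).trans_eq
      (hZ.posPart_negPart_apply T hx)) (hp _ hinf0)
  have e : ρ T x = ρ T⁺ x - ρ T⁻ x := by
    have : ρ (T⁺ - T⁻) x = ρ T⁺ x - ρ T⁻ x := (hZ.lin_vec x).map_sub _ _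
    rwa [posPart_sub_negPart] at this
  have := inf_add_sup (ρ T⁺ x) (ρ T⁻ x)
  rw [hinf, zero_add] at this
  calc ρ T⁺ x = ρ T⁺ x ⊔ ρ T⁻ x - ρ T⁻ x := by rw [this, add_sub_cancel_right]
    _ = (ρ T x)⁺ := by rw [sup_sub, sub_self, e, posPart_def (ρ T⁺ x - ρ T⁻ x)]

/-- Truncation of a central operator to the order interval `[0, 1]`. -/
theorem exists_truncation (hZ : IsCenterOf E Z ρ) (hD : IsOrderDual E D p) (hsep : SepPoints p)
    (T : Z) {x : E} (hx : 0 ≤ x) :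
    ∃ R : Z, 0 ≤ R ∧ R ≤ 1 ∧ ρ R x = (ρ T x ⊔ 0) ⊓ x := by
  refine ⟨1 - (1 - T⁺)⁺, ?_, sub_le_self _ (posPart_nonneg _), ?_⟩
  · rw [sub_nonneg, posPart_def]
    exact sup_le (sub_le_self _ (posPart_nonneg T)) hZ.zero_le_one
  · have hs : ∀ A B : Z, ρ (A - B) x = ρ A x - ρ B x := fun A B => (hZ.lin_vec x).map_sub A B
    rw [hs, hZ.posPart_apply hD hsep _ hx, hs, hZ.posPart_apply hD hsep _ hx, hZ.map_one,
      ← posPart_def, inf_comm, inf_eq_sub_posPart_sub]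

omit [AddLeftMono Z] [AddLeftMono D] [PosSMulMono ℝ E] in
/-- If every functional annihilating the orbit `Z(E)x` annihilates `y`, then `y` is approximated
by the orbit for every seminorm dominated by a positive functional. -/
theorem exists_approx_s7 (hZ : IsCenterOf E Z ρ) (hD : IsOrderDual E D p) {x y : E}
    (hkill : ∀ f, (∀ T, p f (ρ T x) = 0) → p f y = 0) {q : E → ℝ} {g : D} (hg : 0 ≤ g)
    (hadd : ∀ a b, q (a + b) ≤ q a + q b) (hsmul : ∀ (c : ℝ) a, 0 < c → q (c • a) = c * q a)
    (hnn : ∀ a, 0 ≤ q a) (hle : ∀ a, q a ≤ p g |a|) {ε : ℝ} (hε : 0 < ε) :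
    ∃ T, q (y - ρ T x) < ε := by
  have hq0 : q 0 = 0 := by
    refine le_antisymm ((hle 0).trans_eq ?_) (hnn 0)
    rw [abs_zero, (hD.lin_fun g).map_zero]
  have hmono : ∀ T S a b, q (a + b - ρ (T + S) x) ≤ q (a - ρ T x) + q (b - ρ S x) := by
    intro T S a b
    rw [show ρ (T + S) x = ρ T x + ρ S x from (hZ.lin_vec x).map_add T S, add_sub_add_comm]
    exact hadd _ _
  obtain ⟨w, hw, hwy⟩ := exists_linear_le_of_cone (fun z r => ∃ T, q (z - ρ T x) ≤ r)
    (by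
      rintro a b r s ⟨T, hT⟩ ⟨S, hS⟩
      exact ⟨T + S, (hmono T S a b).trans (add_le_add hT hS)⟩)
    (by
      rintro c a r hc ⟨T, hT⟩
      refine ⟨c • T, ?_⟩
      rw [show ρ (c • T) x = c • ρ T x from (hZ.lin_vec x).map_smul c T, ← smul_sub,
        hsmul _ _ hc]
      exact mul_le_mul_of_nonneg_left hT hc.le)
    (fun z => ⟨_, 0, le_rfl⟩) (fun z r ⟨T, hT⟩ => (hnn _).trans hT) y
  have hwq : ∀ z, w z ≤ q z := fun z => hw z _ ⟨0, by
    rw [show ρ 0 x = 0 from (hZ.lin_vec x).map_zero, sub_zero]⟩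
  have hwT : ∀ T, w (ρ T x) ≤ 0 := fun T => hw _ _ ⟨T, by rw [sub_self, hq0]⟩
  obtain ⟨f, hf⟩ := hD.exists_of_abs_le w.isLinear hg (fun z => by
    refine abs_le'.2 ⟨(hwq z).trans (hle z), ?_⟩
    rw [← map_neg, ← abs_neg z]
    exact (hwq _).trans (hle _))
  have hfy := hkill f fun T => by
    rw [hf]
    refine le_antisymm (hwT T) ?_
    have := hwT (-T)
    rw [show ρ (-T) x = -ρ T x from (hZ.lin_vec x).map_neg T, map_neg] at this
    linarith
  rw [hf] at hfy
  obtain ⟨r, ⟨T, hT⟩, hr⟩ := hwy ε hε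
  exact ⟨T, hT.trans_lt (by linarith)⟩

/-- In a Riesz space with topologically full center, `y ∈ [0, x]` is approximated by `T x` with
`T ∈ [0, 1]`, in the absolute weak topology. -/
theorem exists_approx_unitInterval (hZ : IsCenterOf E Z ρ) (hD : IsOrderDual E D p)
    (hsep : SepPoints p) (hfull : TopFullCenter p ρ) {x y : E} (hy : 0 ≤ y) (hyx : y ≤ x)
    {g : D} (hg : 0 ≤ g) {ε : ℝ} (hε : 0 < ε) :
    ∃ T, 0 ≤ T ∧ T ≤ 1 ∧ p g |y - ρ T x| < ε := by
  have hx := hy.trans hyx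
  have hP := hD.isPosBilin
  obtain ⟨T, hT⟩ := hZ.exists_approx_s7 hD (x := x) (y := y) (q := fun a => p g |a|) (fun f hf => by
      by_contra hne
      obtain ⟨_, ⟨T, rfl⟩, hT⟩ := hfull x hx y ⟨1, by norm_num, by
        rwa [one_smul, abs_of_nonneg hy]⟩ {f} |p f y| (abs_pos.2 hne)
      have := hT f (Finset.mem_singleton_self f)
      rw [hf, zero_sub, abs_neg] at this
      exact lt_irrefl _ this) hg
    (fun a b => by
      rw [← (hD.lin_fun g).map_add]
      exact hP.mono hg le_rfl (abs_nonneg _) (abs_add_le a b))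
    (fun c a hc => by
      rw [← smul_eq_mul, ← (hD.lin_fun g).map_smul]
      refine le_antisymm (hP.mono hg le_rfl (abs_nonneg _) ?_)
        (hP.mono hg le_rfl (smul_nonneg hc.le (abs_nonneg a)) ?_)
      · refine abs_le'.2 ⟨smul_le_smul_of_nonneg_left (le_abs_self a) hc.le, ?_⟩
        rw [← smul_neg]
        exact smul_le_smul_of_nonneg_left (neg_le_abs a) hc.le
      · have : |a| ≤ c⁻¹ • |c • a| := by
          have hc' := (inv_pos.2 hc).le
          refine abs_le'.2 ⟨?_, ?_⟩
          · simpa [inv_smul_smul₀ hc.ne'] using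
              smul_le_smul_of_nonneg_left (le_abs_self (c • a)) hc'
          · simpa [inv_smul_smul₀ hc.ne'] using
              smul_le_smul_of_nonneg_left (neg_le_abs (c • a)) hc'
        simpa [smul_inv_smul₀ hc.ne'] using smul_le_smul_of_nonneg_left this hc.le)
    (fun a => hP.nonneg g _ hg (abs_nonneg a)) (fun a => le_rfl) hε
  obtain ⟨R, hR0, hR1, hR⟩ := hZ.exists_truncation hD hsep T hx
  refine ⟨R, hR0, hR1, lt_of_le_of_lt (hP.mono hg le_rfl (abs_nonneg _) ?_) hT⟩
  calc |y - ρ R x| = |(y ⊔ 0) ⊓ x - (ρ T x ⊔ 0) ⊓ x| := by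
        rw [hR, sup_eq_left.2 hy, inf_eq_left.2 hyx]
    _ ≤ |y ⊔ 0 - ρ T x ⊔ 0| := abs_inf_sub_inf_le_abs _ _ _
    _ ≤ |y - ρ T x| := abs_sup_sub_sup_le_abs _ _ _

end IsCenterOf

end Center

section Bilinear

variable {D E : Type*} [Lattice D] [AddCommGroup D] [Module ℝ D]
  [Lattice E] [AddCommGroup E] [Module ℝ E]

namespace IsPosBilin

theorem add_smul {β γ : D → E → ℝ} (hβ : IsPosBilin β) (hγ : IsPosBilin γ) {a b : ℝ}
    (ha : 0 ≤ a) (hb : 0 ≤ b) : IsPosBilin fun f z => a * β f z + b * γ f z where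
  lin_left z := ⟨fun f g => by
      rw [(hβ.lin_left z).map_add, (hγ.lin_left z).map_add]; ring, fun c f => by
      rw [(hβ.lin_left z).map_smul, (hγ.lin_left z).map_smul]; simp only [smul_eq_mul]; ring⟩
  lin_right f := ⟨fun z w => by
      rw [(hβ.lin_right f).map_add, (hγ.lin_right f).map_add]; ring, fun c z => by
      rw [(hβ.lin_right f).map_smul, (hγ.lin_right f).map_smul]; simp only [smul_eq_mul]; ring⟩
  nonneg f z hf hz :=
    add_nonneg (mul_nonneg ha (hβ.nonneg f z hf hz)) (mul_nonneg hb (hγ.nonneg f z hf hz))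

theorem comp_left {β : D → E → ℝ} (hβ : IsPosBilin β) {P : D → D} (hP : IsLinearMap ℝ P)
    (hP0 : ∀ f, 0 ≤ f → 0 ≤ P f) : IsPosBilin fun f z => β (P f) z where
  lin_left z := ⟨fun f g => by rw [hP.map_add, (hβ.lin_left z).map_add], fun c f => by
      rw [hP.map_smul, (hβ.lin_left z).map_smul]⟩
  lin_right f := hβ.lin_right (P f)
  nonneg f z hf hz := hβ.nonneg _ z (hP0 f hf) hz

theorem comp_right {β : D → E → ℝ} (hβ : IsPosBilin β) {R : E → E} (hR : IsLinearMap ℝ R)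
    (hR0 : ∀ z, 0 ≤ z → 0 ≤ R z) : IsPosBilin fun f z => β f (R z) where
  lin_left z := hβ.lin_left (R z)
  lin_right f := ⟨fun z w => by rw [hR.map_add, (hβ.lin_right f).map_add], fun c z => by
      rw [hR.map_smul, (hβ.lin_right f).map_smul]⟩
  nonneg f z hf hz := hβ.nonneg f _ hf (hR0 z hz)

theorem isClosed : IsClosed {β : D → E → ℝ | IsPosBilin β} := by
  have : {β : D → E → ℝ | IsPosBilin β} =
      {β | ((∀ z f g, β (f + g) z = β f z + β g z) ∧ ∀ z (c : ℝ) f, β (c • f) z = c * β f z) ∧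
        ((∀ f z w, β f (z + w) = β f z + β f w) ∧ ∀ f (c : ℝ) z, β f (c • z) = c * β f z) ∧
        ∀ f z, 0 ≤ f → 0 ≤ z → 0 ≤ β f z} := by
    ext β
    exact ⟨fun h => ⟨⟨fun z => (h.lin_left z).map_add, fun z => (h.lin_left z).map_smul⟩,
      ⟨fun f => (h.lin_right f).map_add, fun f => (h.lin_right f).map_smul⟩, h.nonneg⟩,
      fun ⟨⟨h1, h2⟩, ⟨h3, h4⟩, h5⟩ => ⟨fun z => ⟨h1 z, h2 z⟩, fun f => ⟨h3 f, h4 f⟩, h5⟩⟩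
  rw [this]
  simp only [Set.ofPred_and, Set.ofPred_forall]
  refine ((isClosed_iInter fun z => isClosed_iInter fun f => isClosed_iInter fun g => ?_).inter
    (isClosed_iInter fun z => isClosed_iInter fun c => isClosed_iInter fun f => ?_)).inter
    (((isClosed_iInter fun f => isClosed_iInter fun z => isClosed_iInter fun w => ?_).inter
    (isClosed_iInter fun f => isClosed_iInter fun c => isClosed_iInter fun z => ?_)).inter
    (isClosed_iInter fun f => isClosed_iInter fun z => isClosed_iInter fun _ =>
      isClosed_iInter fun _ => ?_))
  · exact isClosed_eq (by fun_prop) (by fun_prop)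
  · exact isClosed_eq (by fun_prop) (by fun_prop)
  · exact isClosed_eq (by fun_prop) (by fun_prop)
  · exact isClosed_eq (by fun_prop) (by fun_prop)
  · exact isClosed_le (by fun_prop) (by fun_prop)

end IsPosBilin

/-- The order interval `[0, p]` of bilinear forms; for the duality `p` of `E` with `E^∼` it
represents the operators `P` on `E^∼` with `0 ≤ P ≤ id`. -/
def bilinInterval (p : D → E → ℝ) : Set (D → E → ℝ) :=
  {β | IsPosBilin β ∧ IsPosBilin fun f z => p f z - β f z}

theorem convex_bilinInterval (p : D → E → ℝ) : Convex ℝ (bilinInterval p) := by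
  rintro β ⟨hβ, hβ'⟩ γ ⟨hγ, hγ'⟩ a b ha hb hab
  refine ⟨hβ.add_smul hγ ha hb, ?_⟩
  convert hβ'.add_smul hγ' ha hb using 3 with f z
  simp only [Pi.add_apply, Pi.smul_apply, smul_eq_mul]
  linear_combination -(p f z) * hab

theorem isClosed_bilinInterval (p : D → E → ℝ) : IsClosed (bilinInterval p) :=
  IsPosBilin.isClosed.inter (IsPosBilin.isClosed.preimage
    (f := fun (β : D → E → ℝ) f z => p f z - β f z) (by fun_prop))

variable [AddLeftMono D] [AddLeftMono E]

theorem abs_le_of_mem_bilinInterval {p β : D → E → ℝ} (hβ : β ∈ bilinInterval p) (f : D) (z : E) :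
    |β f z| ≤ p |f| |z| := by
  have h1 := hβ.1.abs_le (le_refl |f|) (le_refl |z|)
  have h2 := hβ.2.nonneg |f| |z| (abs_nonneg f) (abs_nonneg z)
  linarith

theorem isCompact_bilinInterval (p : D → E → ℝ) : IsCompact (bilinInterval p) := by
  refine IsCompact.of_isClosed_subset (isCompact_univ_pi fun f => isCompact_univ_pi fun z =>
    isCompact_Icc (a := -p |f| |z|) (b := p |f| |z|)) (isClosed_bilinInterval p) ?_
  intro β hβ f _ z _
  exact abs_le.1 (abs_le_of_mem_bilinInterval hβ f z)

/-- An extreme point of `[0, p]` is given by an idempotent operator on the order dual. -/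
theorem exists_idempotent_of_extreme {p β : D → E → ℝ} (hD : IsOrderDual E D p)
    (hβ : β ∈ (bilinInterval p).extremePoints ℝ) :
    ∃ P : D → D, (∀ f z, p (P f) z = β f z) ∧ ∀ f z, β (P f) z = β f z := by
  have hP := hD.isPosBilin
  have hβK := hβ.1
  choose P hPβ using fun f => hD.exists_of_abs_le (hβK.1.lin_right f) (abs_nonneg f)
    (abs_le_of_mem_bilinInterval hβK f)
  refine ⟨P, hPβ, ?_⟩
  have hPlin : IsLinearMap ℝ P := by
    refine ⟨fun f g => hD.inj _ _ fun z => ?_, fun c f => hD.inj _ _ fun z => ?_⟩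
    · rw [(hD.lin_vec z).map_add, hPβ, hPβ, hPβ, (hβK.1.lin_left z).map_add]
    · rw [(hD.lin_vec z).map_smul, hPβ, hPβ, (hβK.1.lin_left z).map_smul]
  have hP0 : ∀ f, 0 ≤ f → 0 ≤ P f := fun f hf =>
    (hD.nonneg_iff _).2 fun z hz => by rw [hPβ]; exact hβK.1.nonneg f z hf hz
  have hPle : ∀ f, 0 ≤ f → P f ≤ f := fun f hf => (hD.le_iff _ _).2 fun z hz => by
    rw [hPβ]; exact sub_nonneg.1 (hβK.2.nonneg f z hf hz)
  have hQlin : IsLinearMap ℝ fun f => f - P f :=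
    ⟨fun f g => by rw [hPlin.map_add]; abel, fun c f => by rw [hPlin.map_smul, smul_sub]⟩
  have hQ0 : ∀ f, 0 ≤ f → 0 ≤ f - P f := fun f hf => sub_nonneg.2 (hPle f hf)
  have hsub : ∀ f z, β (f - P f) z = β f z - β (P f) z := fun f z =>
    (hβK.1.lin_left z).map_sub f (P f)
  have hγ : (fun f z => β (P f) z) ∈ bilinInterval p := by
    refine ⟨hβK.1.comp_left hPlin hP0, ?_⟩
    convert (hβK.2.comp_left hPlin hP0).add_smul (hβK.2) zero_le_one zero_le_one using 3 with f z
    rw [hPβ]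
    ring
  have hδ : (fun f z => 2 * β f z - β (P f) z) ∈ bilinInterval p := by
    constructor
    · convert (hβK.1.comp_left hQlin hQ0).add_smul hβK.1 zero_le_one zero_le_one using 3 with f z
      rw [hsub]
      ring
    · convert (hβK.2.comp_left hQlin hQ0).add_smul hP zero_le_one le_rfl using 3 with f z
      rw [hsub, (hD.lin_vec z).map_sub, hPβ]
      ring
  have := hβ.2 hγ hδ ⟨1 / 2, 1 / 2, by norm_num, by norm_num, by norm_num, by
    funext f z
    simp only [Pi.add_apply, Pi.smul_apply, smul_eq_mul]
    ring⟩
  exact fun f z => congrFun (congrFun this f) z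

end Bilinear

section Approximation

variable {D E Z : Type*} [Lattice D] [AddCommGroup D] [Module ℝ D] [AddLeftMono D]
  [Lattice E] [AddCommGroup E] [Module ℝ E] [AddLeftMono E] [PosSMulMono ℝ E]
  [Lattice Z] [NormedRing Z] [NormedAlgebra ℝ Z] [AddLeftMono Z]
  {p : D → E → ℝ} {ρ : Z → E → E}

/-- Over a Riesz space with topologically full center, extreme points of `[0, p]` are
approximated by central operators in `[0, 1]`. -/
theorem exists_approx_extreme (hD : IsOrderDual E D p) (hsep : SepPoints p)
    (hZ : IsCenterOf E Z ρ) (hfull : TopFullCenter p ρ) {β : D → E → ℝ}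
    (hβ : β ∈ (bilinInterval p).extremePoints ℝ) {g : D} (hg : 0 ≤ g) {x : E} (hx : 0 ≤ x)
    {ε : ℝ} (hε : 0 < ε) :
    ∃ T : Z, 0 ≤ T ∧ T ≤ 1 ∧
      ∀ f z, |f| ≤ g → |z| ≤ x → |β f z - p f (ρ T z)| < ε := by
  have hP := hD.isPosBilin
  obtain ⟨P, hPβ, hPP⟩ := exists_idempotent_of_extreme hD hβ
  obtain ⟨hβ1, hβ2⟩ := hβ.1
  have hu : 0 ≤ P g := (hD.nonneg_iff _).2 fun z hz => by
    rw [hPβ]; exact hβ1.nonneg g z hg hz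
  have hv : 0 ≤ g - P g := (hD.nonneg_iff _).2 fun z hz => by
    rw [(hD.lin_vec z).map_sub, hPβ]; exact hβ2.nonneg g z hg hz
  have hpv : ∀ z, p (g - P g) z = p g z - β g z := fun z => by
    rw [(hD.lin_vec z).map_sub, hPβ]
  have hdisj : ∀ w, 0 ≤ w → w ≤ P g → w ≤ g - P g → w = 0 := by
    intro w hw hwu hwv
    refine le_antisymm ((hD.le_iff _ _).2 fun z hz => ?_) hw
    rw [show p 0 z = 0 from (hD.lin_vec z).map_zero]
    have h1 := hβ2.nonneg (P g - w) z (sub_nonneg.2 hwu) hz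
    have h2 := hβ1.nonneg (g - P g - w) z (sub_nonneg.2 hwv) hz
    have e1 : β (P g - w) z = β (P g) z - β w z := (hβ1.lin_left z).map_sub _ _
    have e2 : β (g - P g - w) z = β g z - β (P g) z - β w z := by
      rw [(hβ1.lin_left z).map_sub, (hβ1.lin_left z).map_sub]
    rw [e1, (hD.lin_vec z).map_sub, hPβ, hPP] at h1
    rw [e2, hPP] at h2
    linarith
  obtain ⟨y, hy0, hyx, hy⟩ := hD.exists_split hu hv hdisj hx (half_pos hε)
  obtain ⟨T, hT0, hT1, hT⟩ :=
    hZ.exists_approx_unitInterval hD hsep hfull hy0 hyx hg (half_pos hε)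
  refine ⟨T, hT0, hT1, fun f z hf hz => ?_⟩
  have hRlin : IsLinearMap ℝ fun z => z - ρ T z :=
    ⟨fun a b => by rw [(hZ.isLinearMap T).map_add]; abel,
      fun c a => by rw [(hZ.isLinearMap T).map_smul, smul_sub]⟩
  have hR0 : ∀ z, 0 ≤ z → 0 ≤ z - ρ T z := fun z hz => by
    have := (hZ.le_iff _ _).1 hT1 z hz
    rw [hZ.map_one] at this
    exact sub_nonneg.2 this
  have b1 := (hβ1.comp_right hRlin hR0).abs_le hf hz
  have b2 := (hβ2.comp_right (hZ.isLinearMap T) ((hZ.nonneg_iff T).1 hT0)).abs_le hf hz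
  have b3 := hP.abs_le (le_of_eq (abs_of_nonneg hu)) (le_refl |y - ρ T x|)
  have b4 := hP.abs_le (le_of_eq (abs_of_nonneg hv)) (le_refl |y - ρ T x|)
  have e1 : ∀ h z, β h (z - ρ T z) = β h z - β h (ρ T z) := fun h z =>
    (hβ1.lin_right h).map_sub _ _
  simp only [e1] at b1
  rw [hpv, hpv, (hβ1.lin_right g).map_sub, (hD.lin_fun g).map_sub] at b4
  rw [hPβ, hPβ, (hβ1.lin_right g).map_sub] at b3
  rw [hPβ, hpv, (hβ1.lin_right g).map_sub] at hy
  rw [abs_le] at b1 b2 b3 b4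
  rw [abs_lt]
  constructor <;> linarith

/-- Over a Riesz space with topologically full center, every form in `[0, p]` is induced by an
element of the bidual of the center. -/
theorem exists_bidual_of_mem_bilinInterval (hD : IsOrderDual E D p) (hsep : SepPoints p)
    (hZ : IsCenterOf E Z ρ) (hfull : TopFullCenter p ρ) {β : D → E → ℝ}
    (hβ : β ∈ bilinInterval p) :
    ∃ F : (Z →L[ℝ] ℝ) →L[ℝ] ℝ, ∀ (f : D) (z : E) (μ : Z →L[ℝ] ℝ),
      (∀ T, μ T = p f (ρ T z)) → F μ = β f z := by
  set Φ : Z → D → E → ℝ := fun T f z => p f (ρ T z) with hΦ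
  set I : Set Z := {T | 0 ≤ T ∧ T ≤ 1} with hI
  have hΦlin : ∀ (a b : ℝ) (T S : Z), Φ (a • T + b • S) = a • Φ T + b • Φ S := by
    intro a b T S
    funext f z
    simp only [hΦ, Pi.add_apply, Pi.smul_apply]
    rw [show ρ (a • T + b • S) z = a • ρ T z + b • ρ S z from by
      rw [← (hZ.lin_vec z).map_smul, ← (hZ.lin_vec z).map_smul]
      exact (hZ.lin_vec z).map_add _ _, (hD.lin_fun f).map_add, (hD.lin_fun f).map_smul,
      (hD.lin_fun f).map_smul]
  have hconv : Convex ℝ (Φ '' I) := by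
    rintro _ ⟨T, hT, rfl⟩ _ ⟨S, hS, rfl⟩ a b ha hb hab
    refine ⟨a • T + b • S, ⟨(hZ.nonneg_iff _).2 fun x hx => ?_,
      (hZ.le_iff _ _).2 fun x hx => ?_⟩, hΦlin a b T S⟩
    all_goals
      rw [show ρ (a • T + b • S) x = a • ρ T x + b • ρ S x from by
        rw [← (hZ.lin_vec x).map_smul, ← (hZ.lin_vec x).map_smul]
        exact (hZ.lin_vec x).map_add _ _]
    · exact add_nonneg (smul_nonneg ha ((hZ.nonneg_iff T).1 hT.1 x hx))
        (smul_nonneg hb ((hZ.nonneg_iff S).1 hS.1 x hx))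
    · have hx1 : ρ 1 x = a • ρ 1 x + b • ρ 1 x := by rw [← _root_.add_smul, hab, one_smul]
      rw [hx1]
      exact add_le_add (smul_le_smul_of_nonneg_left ((hZ.le_iff _ _).1 hT.2 x hx) ha)
        (smul_le_smul_of_nonneg_left ((hZ.le_iff _ _).1 hS.2 x hx) hb)
  have hext : (bilinInterval p).extremePoints ℝ ⊆ closure (Φ '' I) := by
    intro γ hγ
    choose T hT0 hT1 hT using fun i : D × E × ℕ =>
      exists_approx_extreme hD hsep hZ hfull hγ (abs_nonneg i.1) (abs_nonneg i.2.1)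
        (Nat.one_div_pos_of_nat (α := ℝ) (n := i.2.2))
    refine mem_closure_of_tendsto (f := fun i => Φ (T i)) (b := atTop) ?_
      (Eventually.of_forall fun i => ⟨T i, ⟨hT0 i, hT1 i⟩, rfl⟩)
    refine tendsto_pi_nhds.2 fun f => tendsto_pi_nhds.2 fun z => Metric.tendsto_atTop.2 ?_
    intro ε hε
    obtain ⟨n, hn⟩ := exists_nat_one_div_lt hε
    refine ⟨(|f|, |z|, n), fun i hi => ?_⟩
    rw [dist_comm, Real.dist_eq]
    refine (hT i f z (hi.1.trans (le_abs_self _)) (hi.2.1.trans (le_abs_self _))).trans ?_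
    exact (Nat.one_div_le_one_div hi.2.2).trans_lt hn
  have hcl : β ∈ closure (Φ '' I) := by
    rw [← closure_convexHull_extremePoints (isCompact_bilinInterval p)
      (convex_bilinInterval p)] at hβ
    exact closure_minimal (convexHull_min hext hconv.closure) isClosed_closure hβ
  obtain ⟨V, hVI, hV⟩ := mem_closure_iff_ultrafilter.1 hcl
  obtain ⟨U, hUI, rfl⟩ : ∃ U : Ultrafilter Z, I ∈ U ∧ U.map Φ = V :=
    ⟨.ofComapInfPrincipal hVI, Ultrafilter.ofComapInfPrincipal_mem hVI,
      Ultrafilter.ofComapInfPrincipal_eq_of_map hVI⟩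
  have hnorm : ∀ T ∈ I, ‖T‖ ≤ 1 := fun T hT => (hZ.norm_le_iff T 1 zero_le_one).2 fun x hx => by
    have h1 := (hZ.nonneg_iff T).1 hT.1 x hx
    have h2 := (hZ.le_iff _ _).1 hT.2 x hx
    rw [hZ.map_one] at h2
    rw [one_smul]
    exact ⟨(neg_nonpos.2 hx).trans h1, h2⟩
  have hlim : ∀ μ : Z →L[ℝ] ℝ, ∃ a, |a| ≤ ‖μ‖ ∧ Tendsto μ U (𝓝 a) := by
    intro μ
    obtain ⟨a, ha, h⟩ := (isCompact_Icc (a := -‖μ‖) (b := ‖μ‖)).ultrafilter_le_nhds (U.map μ) (by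
      rw [le_principal_iff]
      refine Ultrafilter.mem_map.2 (mem_of_superset hUI fun T hT => abs_le.1 ?_)
      exact (μ.le_opNorm T).trans (mul_le_of_le_one_right (norm_nonneg μ) (hnorm T hT)))
    exact ⟨a, abs_le.2 ha, h⟩
  choose F hFle hF using hlim
  refine ⟨LinearMap.mkContinuous
    { toFun := F
      map_add' := fun μ ν => tendsto_nhds_unique (hF _) ((hF μ).add (hF ν))
      map_smul' := fun c μ => tendsto_nhds_unique (hF _) ((hF μ).const_smul c) } 1
    (fun μ => by rw [one_mul]; exact hFle μ), fun f z μ hμ => ?_⟩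
  refine tendsto_nhds_unique (hF μ) ?_
  have := tendsto_pi_nhds.1 (tendsto_pi_nhds.1 (show Tendsto Φ U (𝓝 β) from hV) f) z
  exact this.congr fun T => (hμ T).symm

end Approximation

section BandProjection

variable {D E : Type*} [Lattice D] [AddCommGroup D] [Module ℝ D] [AddLeftMono D] [PosSMulMono ℝ D]
  [Lattice E] [AddCommGroup E] [Module ℝ E] [AddLeftMono E] {p : D → E → ℝ}

omit [PosSMulMono ℝ D] in
/-- A linear operator between `0` and the identity is central. -/
theorem isCentral_of_le_id {P : D → D} (hlin : IsLinearMap ℝ P)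
    (hP : ∀ g, 0 ≤ g → 0 ≤ P g ∧ P g ≤ g) : IsCentral P := by
  have habs : ∀ g, |P g| ≤ |g| := fun g => by
    have e : P g = P g⁺ - P g⁻ := by rw [← hlin.map_sub, posPart_sub_negPart]
    obtain ⟨h1, h2⟩ := hP _ (posPart_nonneg g)
    obtain ⟨h3, h4⟩ := hP _ (negPart_nonneg g)
    rw [e, ← posPart_add_negPart g]
    refine abs_le'.2 ⟨(sub_le_self _ h3).trans (h2.trans ?_), ?_⟩
    · exact le_add_of_nonneg_right (negPart_nonneg g)
    · rw [neg_sub]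
      exact (sub_le_self _ h1).trans (h4.trans (le_add_of_nonneg_left (posPart_nonneg g)))
  refine ⟨⟨hlin, fun a b => ⟨P a, P b, fun x hax hxb => ?_⟩, fun x y hxy => ?_⟩, 1, fun x hx => ?_⟩
  · have h1 := (hP _ (sub_nonneg.2 hax)).1
    have h2 := (hP _ (sub_nonneg.2 hxb)).1
    rw [hlin.map_sub, sub_nonneg] at h1 h2
    exact ⟨h1, h2⟩
  · exact le_antisymm ((inf_le_inf_right _ (habs x)).trans hxy.le)
      (le_inf (abs_nonneg _) (abs_nonneg _))
  · rw [one_smul]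
    exact ⟨(neg_nonpos.2 hx).trans (hP x hx).1, (hP x hx).2⟩

namespace IsOrderDual

omit [AddLeftMono D] [PosSMulMono ℝ D] [AddLeftMono E] in
theorem eq_of_nonneg (hD : IsOrderDual E D p) {f g : D} (h : ∀ z, 0 ≤ z → p f z = p g z) :
    f = g :=
  le_antisymm ((hD.le_iff f g).2 fun z hz => (h z hz).le)
    ((hD.le_iff g f).2 fun z hz => (h z hz).ge)

theorem exists_tendsto_inf_smul (hD : IsOrderDual E D p) {u g : D} (hu : 0 ≤ u) (hg : 0 ≤ g) :
    ∃ h, ∀ z, Tendsto (fun t : ℝ => p (g ⊓ t • u) z) atTop (𝓝 (p h z)) := by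
  have hP := hD.isPosBilin
  have hmono : ∀ z, 0 ≤ z → Monotone fun t : ℝ => p (g ⊓ t • u) z := fun z hz s t hst => by
    refine (hD.le_iff _ _).1 (inf_le_inf_left g ?_) z hz
    rw [← sub_nonneg, ← sub_smul]
    exact smul_nonneg (sub_nonneg.2 hst) hu
  have hpos : ∀ z, 0 ≤ z → ∃ a, Tendsto (fun t : ℝ => p (g ⊓ t • u) z) atTop (𝓝 a) :=
    fun z hz => ⟨_, tendsto_atTop_ciSup (hmono z hz) ⟨p g z, by
      rintro _ ⟨t, rfl⟩
      exact (hD.le_iff _ _).1 inf_le_left z hz⟩⟩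
  have hlim : ∀ z, ∃ a, Tendsto (fun t : ℝ => p (g ⊓ t • u) z) atTop (𝓝 a) := fun z => by
    obtain ⟨a, ha⟩ := hpos _ (posPart_nonneg z)
    obtain ⟨b, hb⟩ := hpos _ (negPart_nonneg z)
    refine ⟨a - b, (ha.sub hb).congr fun t => ?_⟩
    rw [← (hD.lin_fun _).map_sub, posPart_sub_negPart]
  choose φ hφ using hlim
  have hlin : IsLinearMap ℝ φ :=
    ⟨fun z w => tendsto_nhds_unique (hφ _) (((hφ z).add (hφ w)).congr fun t =>
      ((hD.lin_fun _).map_add z w).symm),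
     fun c z => tendsto_nhds_unique (hφ _) (((hφ z).const_smul c).congr fun t =>
      ((hD.lin_fun _).map_smul c z).symm)⟩
  obtain ⟨h, hh⟩ := hD.exists_of_abs_le hlin hg fun z => by
    refine le_of_tendsto (hφ z).abs ((eventually_ge_atTop 0).mono fun t ht => ?_)
    refine hP.abs_le ?_ le_rfl
    rw [abs_of_nonneg (le_inf hg (smul_nonneg ht hu))]
    exact inf_le_left
  exact ⟨h, fun z => by rw [hh]; exact hφ z⟩

/-- The band projection of the order dual onto the band generated by `u`. -/
theorem exists_bandProjection (hD : IsOrderDual E D p) {u : D} (hu : 0 ≤ u) :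
    ∃ P : D → D, IsLinearMap ℝ P ∧ (∀ g, 0 ≤ g → 0 ≤ P g ∧ P g ≤ g) ∧
      ∀ g, 0 ≤ g → ∀ z, Tendsto (fun t : ℝ => p (g ⊓ t • u) z) atTop (𝓝 (p (P g) z)) := by
  choose Q hQ using fun g : D => hD.exists_tendsto_inf_smul hu (abs_nonneg g)
  replace hQ : ∀ g, 0 ≤ g → ∀ z, Tendsto (fun t : ℝ => p (g ⊓ t • u) z) atTop (𝓝 (p (Q g) z)) :=
    fun g hg => by simpa only [abs_of_nonneg hg] using hQ g
  have hadd : ∀ a b, 0 ≤ a → 0 ≤ b → Q (a + b) = Q a + Q b := by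
    intro a b ha hb
    refine hD.eq_of_nonneg fun z hz => ?_
    rw [(hD.lin_vec z).map_add]
    have hab := hQ _ (add_nonneg ha hb) z
    have hs := (hQ a ha z).add (hQ b hb z)
    refine le_antisymm (le_of_tendsto_of_tendsto hab hs ?_)
      (le_of_tendsto_of_tendsto hs
        (hab.comp (tendsto_id.const_mul_atTop (zero_lt_two' ℝ))) ?_)
    · filter_upwards [eventually_ge_atTop 0] with t ht
      have htu := smul_nonneg ht hu
      rw [← (hD.lin_vec z).map_add]
      refine (hD.le_iff _ _).1 ?_ z hz
      rw [inf_add, add_inf, add_inf]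
      exact le_inf (le_inf inf_le_left (inf_le_right.trans (le_add_of_nonneg_left ha)))
        (le_inf (inf_le_right.trans (le_add_of_nonneg_right hb))
          (inf_le_right.trans (le_add_of_nonneg_right htu)))
    · filter_upwards with t
      rw [← (hD.lin_vec z).map_add]
      refine (hD.le_iff _ _).1 (le_inf (add_le_add inf_le_left inf_le_left) ?_) z hz
      change _ ≤ (2 * t) • u
      rw [two_mul, _root_.add_smul]
      exact add_le_add inf_le_right inf_le_right
  have hzero : Q 0 = 0 := by
    have := hadd 0 0 le_rfl le_rfl
    rwa [add_zero, left_eq_add] at this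
  have hsmul : ∀ (c : ℝ) a, 0 ≤ c → 0 ≤ a → Q (c • a) = c • Q a := by
    intro c a hc ha
    rcases hc.eq_or_lt with rfl | hc
    · rw [zero_smul, zero_smul, hzero]
    refine hD.inj _ _ fun z => ?_
    rw [(hD.lin_vec z).map_smul]
    refine tendsto_nhds_unique (hQ _ (smul_nonneg hc.le ha) z)
      ((((hQ a ha z).comp (tendsto_id.atTop_div_const hc)).const_smul c).congr fun t => ?_)
    change c • p (a ⊓ (t / c) • u) z = _
    rw [← (hD.lin_vec z).map_smul]
    have : c • (a ⊓ (t / c) • u) = c • a ⊓ c • (t / c) • u := (OrderIso.smulRight hc).map_inf _ _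
    rw [this, smul_smul, mul_div_cancel₀ _ hc.ne']
  have hdiff : ∀ a b, 0 ≤ a → 0 ≤ b → Q (a - b)⁺ - Q (a - b)⁻ = Q a - Q b := by
    intro a b ha hb
    rw [sub_eq_sub_iff_add_eq_add, ← hadd _ _ (posPart_nonneg _) hb,
      ← hadd _ _ ha (negPart_nonneg _), ← sub_eq_sub_iff_add_eq_add.1 (posPart_sub_negPart (a - b))]
  have hnn : ∀ g, 0 ≤ g → Q g⁺ - Q g⁻ = Q g := fun g hg => by
    simpa [hzero] using hdiff g 0 hg le_rfl
  refine ⟨fun g => Q g⁺ - Q g⁻, ⟨fun f g => ?_, fun c f => ?_⟩, fun g hg => ?_, fun g hg => ?_⟩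
  · have := hdiff (f⁺ + g⁺) (f⁻ + g⁻) (add_nonneg (posPart_nonneg _) (posPart_nonneg _))
      (add_nonneg (negPart_nonneg _) (negPart_nonneg _))
    rw [add_sub_add_comm, posPart_sub_negPart, posPart_sub_negPart,
      hadd _ _ (posPart_nonneg _) (posPart_nonneg _),
      hadd _ _ (negPart_nonneg _) (negPart_nonneg _)] at this
    rw [this, add_sub_add_comm]
  · have hc := posPart_nonneg c
    have hc' := negPart_nonneg c
    have hf := posPart_nonneg f
    have hf' := negPart_nonneg f
    have := hdiff (c⁺ • f⁺ + c⁻ • f⁻) (c⁺ • f⁻ + c⁻ • f⁺)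
      (add_nonneg (smul_nonneg hc hf) (smul_nonneg hc' hf'))
      (add_nonneg (smul_nonneg hc hf') (smul_nonneg hc' hf))
    rw [hadd _ _ (smul_nonneg hc hf) (smul_nonneg hc' hf'),
      hadd _ _ (smul_nonneg hc hf') (smul_nonneg hc' hf), hsmul _ _ hc hf, hsmul _ _ hc hf',
      hsmul _ _ hc' hf, hsmul _ _ hc' hf'] at this
    have e : ∀ a b : D, c⁺ • a + c⁻ • b - (c⁺ • b + c⁻ • a) = c • (a - b) := fun a b => by
      conv_rhs => rw [← posPart_sub_negPart c]
      module
    rwa [e, e, posPart_sub_negPart] at this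
  · simp only [hnn g hg]
    refine ⟨(hD.nonneg_iff _).2 fun z hz => ge_of_tendsto (hQ g hg z) ?_,
      (hD.le_iff _ _).2 fun z hz => le_of_tendsto (hQ g hg z) ?_⟩
    · filter_upwards [eventually_ge_atTop 0] with t ht
      exact hD.isPosBilin.nonneg _ z (le_inf hg (smul_nonneg ht hu)) hz
    · exact Eventually.of_forall fun t => (hD.le_iff _ _).1 inf_le_left z hz
  · simpa only [hnn g hg] using hQ g hg

/-- The positive part of a functional is its image under a central operator. -/
theorem exists_isCentral_apply_eq_posPart (hD : IsOrderDual E D p) (f : D) :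
    ∃ P : D → D, IsCentral P ∧ P f = f⁺ := by
  obtain ⟨P, hlin, hP, hlim⟩ := hD.exists_bandProjection (posPart_nonneg f)
  refine ⟨P, isCentral_of_le_id hlin hP, ?_⟩
  have h1 : P f⁺ = f⁺ := hD.inj _ _ fun z => by
    refine tendsto_nhds_unique (hlim _ (posPart_nonneg f) z) (tendsto_const_nhds.congr' ?_)
    filter_upwards [eventually_ge_atTop 1] with t ht
    rw [inf_eq_left.2]
    rw [← sub_nonneg, show t • f⁺ - f⁺ = (t - 1) • f⁺ by module]
    exact smul_nonneg (sub_nonneg.2 ht) (posPart_nonneg f)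
  have h2 : P f⁻ = 0 := hD.inj _ _ fun z => by
    refine tendsto_nhds_unique (hlim _ (negPart_nonneg f) z) (tendsto_const_nhds.congr' ?_)
    filter_upwards [eventually_ge_atTop 1] with t ht
    have ht0 : 0 < t := one_pos.trans_le ht
    have h0 : t • f⁻ ⊓ t • f⁺ = 0 := by
      rw [show t • f⁻ ⊓ t • f⁺ = t • (f⁻ ⊓ f⁺) from ((OrderIso.smulRight ht0).map_inf _ _).symm,
        inf_comm, posPart_inf_negPart_eq_zero, smul_zero]
    congr 1
    refine le_antisymm (le_inf (negPart_nonneg f) (smul_nonneg ht0.le (posPart_nonneg f))) ?_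
    rw [← h0]
    refine inf_le_inf_right _ ?_
    rw [← sub_nonneg, show t • f⁻ - f⁻ = (t - 1) • f⁻ by module]
    exact smul_nonneg (sub_nonneg.2 ht) (negPart_nonneg f)
  conv_lhs => rw [← posPart_sub_negPart f]
  rw [hlin.map_sub, h1, h2, sub_zero]

end IsOrderDual

end BandProjection

/-- Proposition 5, equivalence.  Let `E` be a Riesz space with point
separating order dual (realized as `D`), `Z` realizing the ideal center `Z(E)`.  Then `E`
has a topologically full center (for each `x ∈ E₊` the `σ(E,E^∼)`-closure of `Z(E)x`
contains the order ideal generated by `x`) if and only if the Arens homomorphism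
`m : Z(E)'' → Z(E^∼)` is surjective. -/
theorem statement7
    {E D Z : Type*}
    [Lattice E] [AddCommGroup E] [Module ℝ E]
    [CovariantClass E E (· + ·) (· ≤ ·)] [PosSMulMono ℝ E]
    [Lattice D] [AddCommGroup D] [Module ℝ D]
    [CovariantClass D D (· + ·) (· ≤ ·)] [PosSMulMono ℝ D]
    [Lattice Z] [NormedRing Z] [NormedAlgebra ℝ Z]
    [CovariantClass Z Z (· + ·) (· ≤ ·)] [PosSMulMono ℝ Z]
    (pE : D → E → ℝ) (hD : IsOrderDual E D pE) (hsep : SepPoints pE)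
    (ρ : Z → E → E) (hZ : IsCenterOf E Z ρ)
    (m : ((Z →L[ℝ] ℝ) →L[ℝ] ℝ) → D → D)
    (hm : ∀ (F : (Z →L[ℝ] ℝ) →L[ℝ] ℝ) (f : D) (x : E) (μ : Z →L[ℝ] ℝ),
      (∀ T : Z, μ T = pE f (ρ T x)) → pE (m F f) x = F μ) :
    TopFullCenter pE ρ ↔
      (∀ S : D → D, IsCentral S → ∃ F : (Z →L[ℝ] ℝ) →L[ℝ] ℝ, ∀ f : D, m F f = S f) := by
  have hP := hD.isPosBilin
  constructor
  · rintro hfull S ⟨⟨hSlin, -, -⟩, c, hc⟩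
    set C : ℝ := max c 1 with hC
    have hC0 : 0 < C := lt_max_of_lt_right one_pos
    have hCS : ∀ f, 0 ≤ f → ∀ z, 0 ≤ z → -(C * pE f z) ≤ pE (S f) z ∧ pE (S f) z ≤ C * pE f z := by
      intro f hf z hz
      obtain ⟨h1, h2⟩ := hc f hf
      have h1' := (hD.le_iff _ _).1 h1 z hz
      have h2' := (hD.le_iff _ _).1 h2 z hz
      rw [(hD.lin_vec z).map_neg, (hD.lin_vec z).map_smul, smul_eq_mul] at h1'
      rw [(hD.lin_vec z).map_smul, smul_eq_mul] at h2'
      have := mul_le_mul_of_nonneg_right (le_max_left c 1) (hP.nonneg f z hf hz)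
      constructor <;> linarith
    have hS' : ∀ s : ℝ, IsLinearMap ℝ fun f => C • f + s • S f := fun s =>
      ⟨fun f g => by rw [hSlin.map_add]; module, fun a f => by rw [hSlin.map_smul]; module⟩
    have hval : ∀ (s : ℝ) f z, pE (C • f + s • S f) z = C * pE f z + s * pE (S f) z :=
      fun s f z => by
        rw [(hD.lin_vec z).map_add, (hD.lin_vec z).map_smul, (hD.lin_vec z).map_smul, smul_eq_mul,
          smul_eq_mul]
    have hβ : (fun f z => (2 * C)⁻¹ * pE (C • f + (1 : ℝ) • S f) z) ∈ bilinInterval pE := by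
      have hinv : 0 ≤ (2 * C)⁻¹ := by positivity
      constructor
      · convert (hP.comp_left (hS' 1) fun f hf => (hD.nonneg_iff _).2 fun z hz => ?_).add_smul hP
          hinv le_rfl using 3 with f z
        · rw [zero_mul, add_zero]
        · rw [hval]
          linarith [(hCS f hf z hz).1]
      · convert (hP.comp_left (hS' (-1)) fun f hf => (hD.nonneg_iff _).2 fun z hz => ?_).add_smul hP
          hinv le_rfl using 3 with f z
        · simp only [hval]
          field_simp
          ring
        · rw [hval]
          linarith [(hCS f hf z hz).2]
    obtain ⟨F, hF⟩ := exists_bidual_of_mem_bilinInterval hD hsep hZ hfull hβ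
    refine ⟨(2 * C) • F - C • ContinuousLinearMap.apply ℝ ℝ (1 : Z),
      fun f => hD.inj _ _ fun x => ?_⟩
    set μ : Z →L[ℝ] ℝ := LinearMap.mkContinuous
      { toFun := fun T => pE f (ρ T x)
        map_add' := fun T S => by rw [(hZ.lin_vec x).map_add, (hD.lin_fun f).map_add]
        map_smul' := fun a T => by
          rw [(hZ.lin_vec x).map_smul, (hD.lin_fun f).map_smul, RingHom.id_apply] }
      (pE |f| |x|) (fun T => by
        refine (hP.abs_le le_rfl (hZ.abs_apply_le T x)).trans_eq ?_
        rw [(hD.lin_fun _).map_smul, smul_eq_mul, mul_comm]) with hμ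
    have hμT : ∀ T, μ T = pE f (ρ T x) := fun T => rfl
    rw [hm _ f x μ hμT]
    change 2 * C * F μ - C * μ 1 = _
    rw [hF f x μ hμT, hμT, hZ.map_one, hval]
    field_simp
    ring
  · intro hsurj x hx y ⟨c, hc, hy⟩ fs ε hε
    have hpos : ∀ f, (∀ T, pE f (ρ T x) = 0) → pE f⁺ x = 0 := by
      intro f hf
      obtain ⟨P, hPc, hPf⟩ := hD.exists_isCentral_apply_eq_posPart f
      obtain ⟨F, hF⟩ := hsurj P hPc
      rw [← hPf, ← hF, hm F f x 0 fun T => (hf T).symm, map_zero]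
    have hkill : ∀ f, (∀ T, pE f (ρ T x) = 0) → pE f y = 0 := by
      intro f hf
      have h1 := hpos f hf
      have h2 := hf 1
      rw [hZ.map_one, ← posPart_sub_negPart f, (hD.lin_vec x).map_sub, h1, zero_sub,
        neg_eq_zero] at h2
      have h3 := hP.abs_le (le_refl |f|) hy
      rw [(hD.lin_fun _).map_smul, ← posPart_add_negPart f, (hD.lin_vec x).map_add, h1, h2,
        add_zero, smul_zero] at h3
      exact abs_nonpos_iff.1 h3
    obtain ⟨T, hT⟩ := hZ.exists_approx_s7 hD hkill (q := fun a => ∑ f ∈ fs, |pE f a|)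
      (g := ∑ f ∈ fs, |f|) (Finset.sum_nonneg fun f _ => abs_nonneg f)
      (fun a b => by
        rw [← Finset.sum_add_distrib]
        refine Finset.sum_le_sum fun f _ => ?_
        rw [(hD.lin_fun f).map_add]
        exact abs_add_le _ _)
      (fun a z ha => by
        rw [Finset.mul_sum]
        refine Finset.sum_congr rfl fun f _ => ?_
        rw [(hD.lin_fun f).map_smul, smul_eq_mul, abs_mul, abs_of_pos ha])
      (fun a => Finset.sum_nonneg fun f _ => abs_nonneg _)
      (fun a => by
        have : pE (∑ f ∈ fs, |f|) |a| = ∑ f ∈ fs, pE |f| |a| :=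
          map_sum ((hD.lin_vec |a|).mk' _) _ _
        rw [this]
        exact Finset.sum_le_sum fun f _ => hP.abs_le le_rfl le_rfl) hε
    refine ⟨_, ⟨T, rfl⟩, fun f hf => lt_of_le_of_lt ?_ hT⟩
    rw [abs_sub_comm, ← (hD.lin_fun f).map_sub]
    exact Finset.single_le_sum (f := fun f => |pE f (y - ρ T x)|) (fun f _ => abs_nonneg _) hf
end
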